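/- arXiv:1706.00529 — 3 statements merged into one kernel-verified Lean document; each statement's English description precedes it below -/
import Mathlib

section
/- For n ≥ 2, the lattice NCB_n of noncrossing partitions of type B_n is supersolvable if and only if n ≤ 3. -/
namespace NCPaper

/-- A partition (setoid) of `Fin m` is noncrossing if there are no indices
`a < b < c < d` with `a, c` in one block and `b, d` in a different block;
equivalently, crossing pairs must lie in the same block. Applied to `Fin (2*n)` with
the vertices of a regular `2n`-gon labelled `1, …, n, -1, …, -n` clockwise, this is
the type `B` noncrossing condition. -/
def IsNoncrossing {m : ℕ} (P : Setoid (Fin m)) : Prop :=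
  ∀ a b c d : Fin m, a < b → b < c → c < d → P a c → P b d → P a b

/-- Negation on the vertices of the `2n`-gon labelled `1, …, n, -1, …, -n` clockwise:
the antipodal map `x ↦ x + n (mod 2n)`. -/
def negB (n : ℕ) (x : Fin (2*n)) : Fin (2*n) :=
  ⟨(x.val + n) % (2*n), Nat.mod_lt _ (by have := x.isLt; omega)⟩

/-- A `B_n`-partition: it is invariant under negation (`B ∈ π ↔ -B ∈ π`) and has at
most one zero block (block `B` with `B = -B`). -/
def IsBnPartition {n : ℕ} (P : Setoid (Fin (2*n))) : Prop :=
  (∀ x y, P x y → P (negB n x) (negB n y)) ∧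
  (∀ x y, P x (negB n x) → P y (negB n y) → P x y)

/-- The lattice `NCB n` of noncrossing `B_n`-partitions, ordered by refinement. -/
def NCB (n : ℕ) : Type :=
  {P : Setoid (Fin (2*n)) // IsNoncrossing P ∧ IsBnPartition P}

instance (n : ℕ) : PartialOrder (NCB n) :=
  Subtype.partialOrder _

/-- A subset of a poset is closed under (binary) joins and meets of the ambient poset. -/
def LatClosed {α : Type*} [PartialOrder α] (L : Set α) : Prop :=
  (∀ x ∈ L, ∀ y ∈ L, ∀ z, IsLUB {x, y} z → z ∈ L) ∧
  (∀ x ∈ L, ∀ y ∈ L, ∀ z, IsGLB {x, y} z → z ∈ L)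

/-- The distributive law `x ⊓ (y ⊔ z) = (x ⊓ y) ⊔ (x ⊓ z)` holds among elements of `L`,
expressed via least upper bounds and greatest lower bounds of the ambient poset. -/
def DistribOn {α : Type*} [PartialOrder α] (L : Set α) : Prop :=
  ∀ x ∈ L, ∀ y ∈ L, ∀ z ∈ L, ∀ a b p q r : α,
    IsLUB {y, z} a → IsGLB {x, a} b → IsGLB {x, y} p → IsGLB {x, z} q →
    IsLUB {p, q} r → b = r

/-- A finite lattice (here: poset) is supersolvable if it has an M-chain: a maximal
chain `D` such that for every chain `C` the sublattice generated by `C ∪ D` is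
distributive. -/
def SupersolvablePoset (α : Type*) [PartialOrder α] : Prop :=
  ∃ D : Set α, IsMaxChain (· ≤ ·) D ∧
    ∀ C : Set α, IsChain (· ≤ ·) C →
      ∃ L : Set α, C ∪ D ⊆ L ∧ LatClosed L ∧ DistribOn L

/-! ### The lattice structure -/

theorem negB_val_cases {n : ℕ} (x : Fin (2*n)) :
    (x.val < n ∧ (negB n x).val = x.val + n) ∨ (n ≤ x.val ∧ (negB n x).val + n = x.val) := by
  have hx := x.isLt
  rcases lt_or_ge x.val n with h | h
  · exact Or.inl ⟨h, by simp only [negB]; rw [Nat.mod_eq_of_lt (by omega)]⟩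
  · refine Or.inr ⟨h, ?_⟩
    simp only [negB]
    rw [Nat.mod_eq_sub_mod (by omega), Nat.mod_eq_of_lt (by omega)]
    omega

@[simp] theorem negB_negB {n : ℕ} (x : Fin (2*n)) : negB n (negB n x) = x := by
  have h1 := negB_val_cases x
  have h2 := negB_val_cases (negB n x)
  have := x.isLt
  exact Fin.ext (by omega)

namespace NCB

variable {n : ℕ}

theorem le_def {P Q : NCB n} : P ≤ Q ↔ ∀ x y, P.1 x y → Q.1 x y :=
  ⟨fun h _ _ hxy => h hxy, fun h {_ _} hxy => h _ _ hxy⟩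

theorem refl' (P : NCB n) (x : Fin (2*n)) : P.1 x x := P.1.refl' x

theorem symm' (P : NCB n) {x y : Fin (2*n)} (h : P.1 x y) : P.1 y x := P.1.symm' h

theorem trans' (P : NCB n) {x y z : Fin (2*n)} (h : P.1 x y) (h' : P.1 y z) : P.1 x z :=
  P.1.trans' h h'

theorem neg (P : NCB n) {x y : Fin (2*n)} (h : P.1 x y) : P.1 (negB n x) (negB n y) :=
  P.2.2.1 x y h

instance : InfSet (NCB n) where
  sInf S := ⟨{
      r := fun x y => ∀ P ∈ S, P.1 x y
      iseqv := ⟨fun x P _ => P.refl' x, fun h P hP => P.symm' (h P hP),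
        fun h h' P hP => P.trans' (h P hP) (h' P hP)⟩ },
    fun a b c d hab hbc hcd h h' P hP => P.2.1 a b c d hab hbc hcd (h P hP) (h' P hP),
    fun _ _ h P hP => P.neg (h P hP),
    fun x y h h' P hP => P.2.2.2 x y (h P hP) (h' P hP)⟩

noncomputable instance : CompleteLattice (NCB n) :=
  completeLatticeOfInf _ fun _ =>
    ⟨fun P hP {_ _} h => h P hP, fun _ hQ {_ _} h _ hP => hQ hP h⟩

theorem inf_rel {P Q : NCB n} {x y : Fin (2*n)} (h : (P ⊓ Q).1 x y) : P.1 x y ∧ Q.1 x y :=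
  have h₁ : P ⊓ Q ≤ P := inf_le_left
  have h₂ : P ⊓ Q ≤ Q := inf_le_right
  ⟨h₁ h, h₂ h⟩

instance : Finite (NCB n) :=
  Finite.of_injective (fun (P : NCB n) x y => P.1 x y) fun _ _ h =>
    Subtype.ext (Setoid.ext fun x y => iff_of_eq (congrFun (congrFun h x) y))

end NCB

/-! ### Two families of noncrossing partitions -/

namespace NCB

variable {n : ℕ}

/-- The partition whose only nontrivial block is the zero block `{a, b, -a, -b}`. -/
def zero (a b : Fin (2*n)) : NCB n :=
  ⟨{  r := fun x y => x = y ∨ ((x = a ∨ x = b ∨ x = negB n a ∨ x = negB n b) ∧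
        (y = a ∨ y = b ∨ y = negB n a ∨ y = negB n b))
      iseqv := ⟨fun _ => Or.inl rfl, fun h => h.imp Eq.symm And.symm, by
        rintro x y z (rfl | h) (rfl | h')
        · exact Or.inl rfl
        · exact Or.inr h'
        · exact Or.inr h
        · exact Or.inr ⟨h.1, h'.2⟩⟩ }, by
    rintro a b c d hab hbc hcd (h | h) (h' | h')
    · omega
    · omega
    · omega
    · exact Or.inr ⟨h.1, h'.1⟩, by
    rintro x y (rfl | ⟨h, h'⟩)
    · exact Or.inl rfl
    · refine Or.inr ⟨?_, ?_⟩
      · rcases h with rfl | rfl | rfl | rfl <;> simp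
      · rcases h' with rfl | rfl | rfl | rfl <;> simp, by
    rintro x y (h | h) (h' | h')
    · have := negB_val_cases x
      have := congrArg Fin.val h
      omega
    · have := negB_val_cases x
      have := congrArg Fin.val h
      omega
    · have := negB_val_cases y
      have := congrArg Fin.val h'
      omega
    · exact Or.inr ⟨h.1, h'.1⟩⟩

theorem zero_le {a b : Fin (2*n)} {P : NCB n} (ha : P.1 a (negB n a)) (hab : P.1 a b) :
    zero a b ≤ P := by
  have hb : P.1 a (negB n b) := P.trans' ha (P.neg hab)
  have key : ∀ x, (x = a ∨ x = b ∨ x = negB n a ∨ x = negB n b) → P.1 a x := by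
    rintro x (rfl | rfl | rfl | rfl)
    exacts [P.refl' _, hab, ha, hb]
  refine le_def.2 ?_
  rintro x y (rfl | ⟨h, h'⟩)
  · exact P.refl' _
  · exact P.trans' (P.symm' (key x h)) (key y h')

/-- The edges `{p, s}`, `{q, r}` and their negatives. -/
def nestRel (p q r s : Fin (2*n)) (x y : Fin (2*n)) : Prop :=
  x = y ∨ (x = p ∧ y = s) ∨ (x = s ∧ y = p) ∨
    (x = negB n p ∧ y = negB n s) ∨ (x = negB n s ∧ y = negB n p) ∨
    (x = q ∧ y = r) ∨ (x = r ∧ y = q) ∨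
    (x = negB n q ∧ y = negB n r) ∨ (x = negB n r ∧ y = negB n q)

theorem nestRel_neg {p q r s x y : Fin (2*n)} (h : nestRel p q r s x y) :
    nestRel p q r s (negB n x) (negB n y) := by
  unfold nestRel at *
  rcases h with rfl | ⟨rfl, rfl⟩ | ⟨rfl, rfl⟩ | ⟨rfl, rfl⟩ | ⟨rfl, rfl⟩ | ⟨rfl, rfl⟩ | ⟨rfl, rfl⟩ |
    ⟨rfl, rfl⟩ | ⟨rfl, rfl⟩ <;> simp

theorem nestRel_symm {p q r s x y : Fin (2*n)} (h : nestRel p q r s x y) :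
    nestRel p q r s y x := by
  rcases h with rfl | ⟨rfl, rfl⟩ | ⟨rfl, rfl⟩ | ⟨rfl, rfl⟩ | ⟨rfl, rfl⟩ | ⟨rfl, rfl⟩ | ⟨rfl, rfl⟩ |
    ⟨rfl, rfl⟩ | ⟨rfl, rfl⟩ <;> simp [nestRel]

/-- The vertices are nested as `p < q < r < s ≤ p + n`, except that the inner edge may be trivial. -/
def Nested (p q r s : Fin (2*n)) : Prop :=
  p.val < s.val ∧ s.val ≤ p.val + n ∧
    (q.val = r.val ∨ p.val < q.val ∧ q.val < r.val ∧ r.val < s.val)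

theorem nestRel_self {p q s x y : Fin (2*n)} (h : nestRel p q q s x y) :
    x = y ∨ (x = p ∧ y = s) ∨ (x = s ∧ y = p) ∨
      (x = negB n p ∧ y = negB n s) ∨ (x = negB n s ∧ y = negB n p) := by
  rcases h with h | h | h | h | h | h | h | h | h
  · exact Or.inl h
  · exact Or.inr (Or.inl h)
  · exact Or.inr (Or.inr (Or.inl h))
  · exact Or.inr (Or.inr (Or.inr (Or.inl h)))
  · exact Or.inr (Or.inr (Or.inr (Or.inr h)))
  all_goals exact Or.inl (h.1.trans h.2.symm)

theorem nestRel_trans {p q r s x y z : Fin (2*n)} (h : Nested p q r s)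
    (hxy : nestRel p q r s x y) (hyz : nestRel p q r s y z) : nestRel p q r s x z := by
  have hp := negB_val_cases p
  have hq := negB_val_cases q
  have hr := negB_val_cases r
  have hs := negB_val_cases s
  obtain ⟨h1, h2, h3⟩ := h
  rcases h3 with h3 | h3
  · obtain rfl : q = r := Fin.ext h3
    rcases nestRel_self hxy with rfl | hxy'
    · exact hyz
    rcases nestRel_self hyz with rfl | hyz'
    · exact hxy
    refine Or.inl ?_
    clear hxy hyz
    simp only [Fin.ext_iff] at *
    generalize (negB n p).val = p' at *
    generalize (negB n s).val = s' at *
    rcases hxy' with hxy | hxy | hxy | hxy <;>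
    rcases hyz' with hyz | hyz | hyz | hyz <;>
    omega
  rcases hxy with rfl | hxy
  · exact hyz
  rcases hyz with rfl | hyz
  · exact Or.inr hxy
  refine Or.inl ?_
  simp only [Fin.ext_iff] at *
  generalize (negB n p).val = p' at *
  generalize (negB n q).val = q' at *
  generalize (negB n r).val = r' at *
  generalize (negB n s).val = s' at *
  rcases hxy with hxy | hxy | hxy | hxy | hxy | hxy | hxy | hxy <;>
  rcases hyz with hyz | hyz | hyz | hyz | hyz | hyz | hyz | hyz <;>
  omega

theorem nestRel_noncrossing {p q r s a b c d : Fin (2*n)} (h : Nested p q r s)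
    (hab : a < b) (hbc : b < c) (hcd : c < d)
    (hac : nestRel p q r s a c) (hbd : nestRel p q r s b d) : nestRel p q r s a b := by
  have hp := negB_val_cases p
  have hq := negB_val_cases q
  have hr := negB_val_cases r
  have hs := negB_val_cases s
  obtain ⟨h1, h2, h3⟩ := h
  exfalso
  simp only [nestRel, Fin.ext_iff, Fin.lt_def] at *
  generalize (negB n p).val = p' at *
  generalize (negB n q).val = q' at *
  generalize (negB n r).val = r' at *
  generalize (negB n s).val = s' at *
  rcases hac with hac | hac | hac | hac | hac | hac | hac | hac | hac <;>
  rcases hbd with hbd | hbd | hbd | hbd | hbd | hbd | hbd | hbd | hbd <;>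
  omega

theorem eq_or_eq_of_nestRel_negB {p q r s x : Fin (2*n)} (h : Nested p q r s)
    (hx : nestRel p q r s x (negB n x)) : s.val = p.val + n ∧ (x = p ∨ x = s) := by
  have hp := negB_val_cases p
  have hq := negB_val_cases q
  have hr := negB_val_cases r
  have hs := negB_val_cases s
  have hx' := negB_val_cases x
  obtain ⟨h1, h2, h3⟩ := h
  simp only [nestRel, Fin.ext_iff] at *
  generalize (negB n p).val = p' at *
  generalize (negB n q).val = q' at *
  generalize (negB n r).val = r' at *
  generalize (negB n s).val = s' at *
  generalize (negB n x).val = x' at *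
  rcases hx with hx | hx | hx | hx | hx | hx | hx | hx | hx <;>
  omega

theorem nestRel_zero {p q r s x y : Fin (2*n)} (h : Nested p q r s)
    (hx : nestRel p q r s x (negB n x)) (hy : nestRel p q r s y (negB n y)) :
    nestRel p q r s x y := by
  obtain ⟨-, rfl | rfl⟩ := eq_or_eq_of_nestRel_negB h hx <;>
  obtain ⟨-, rfl | rfl⟩ := eq_or_eq_of_nestRel_negB h hy <;>
  simp [nestRel]

/-- The partition with nontrivial blocks `±{p, s}` and `±{q, r}`. -/
def nest (p q r s : Fin (2*n)) (h : Nested p q r s) : NCB n :=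
  ⟨{  r := nestRel p q r s
      iseqv := ⟨fun _ => Or.inl rfl, nestRel_symm, nestRel_trans h⟩ },
    fun _ _ _ _ => nestRel_noncrossing h, fun _ _ => nestRel_neg, fun _ _ => nestRel_zero h⟩

theorem nest_le {p q r s : Fin (2*n)} (h : Nested p q r s) {P : NCB n}
    (hps : P.1 p s) (hqr : P.1 q r) : nest p q r s h ≤ P := by
  refine le_def.2 ?_
  rintro x y (rfl | ⟨rfl, rfl⟩ | ⟨rfl, rfl⟩ | ⟨rfl, rfl⟩ | ⟨rfl, rfl⟩ | ⟨rfl, rfl⟩ | ⟨rfl, rfl⟩ |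
    ⟨rfl, rfl⟩ | ⟨rfl, rfl⟩)
  exacts [P.refl' _, hps, P.symm' hps, P.neg hps, P.symm' (P.neg hps), hqr, P.symm' hqr,
    P.neg hqr, P.symm' (P.neg hqr)]

end NCB

/-! ### Left modular elements -/

namespace NCB

variable {n : ℕ}

/-- A consequence of left modularity of `d`: the pentagons through `d` are degenerate. -/
def LeftModular (d : NCB n) : Prop :=
  ∀ x y : NCB n, x ≤ y → y ≤ x ⊔ d → d ⊓ y ≤ x → y ≤ x

theorem leftModular_of_mem {D : Set (NCB n)}
    (hD : ∀ C : Set (NCB n), IsChain (· ≤ ·) C →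
      ∃ L : Set (NCB n), C ∪ D ⊆ L ∧ LatClosed L ∧ DistribOn L)
    {d : NCB n} (hd : d ∈ D) : LeftModular d := by
  intro x y hxy h₁ h₂
  obtain ⟨L, hL, -, hdist⟩ := hD {x, y} (IsChain.pair hxy)
  have hx : x ∈ L := hL (by simp)
  have hy : y ∈ L := hL (by simp)
  have hdL : d ∈ L := hL (Or.inr hd)
  have h := hdist y hy x hx d hdL (x ⊔ d) (y ⊓ (x ⊔ d)) (y ⊓ x) (y ⊓ d) (y ⊓ x ⊔ y ⊓ d)
    isLUB_pair isGLB_pair isGLB_pair isGLB_pair isLUB_pair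
  rw [inf_eq_left.2 h₁, inf_comm y d] at h
  exact h.le.trans (sup_le inf_le_right h₂)

theorem left_rel_sup {P Q : NCB n} {x y : Fin (2*n)} (h : P.1 x y) : (P ⊔ Q).1 x y :=
  le_def.1 (le_sup_left : P ≤ P ⊔ Q) x y h

theorem right_rel_sup {P Q : NCB n} {x y : Fin (2*n)} (h : Q.1 x y) : (P ⊔ Q).1 x y :=
  le_def.1 (le_sup_right : Q ≤ P ⊔ Q) x y h

theorem rel_of_neg {P : NCB n} {x y : Fin (2*n)} (h : P.1 (negB n x) (negB n y)) : P.1 x y := by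
  simpa using P.neg h

theorem rel_of_neg_left {P : NCB n} {x y : Fin (2*n)} (h : P.1 (negB n x) y) :
    P.1 x (negB n y) := by
  simpa using P.neg h

/-- Two crossing edges of a noncrossing partition lie in one block. -/
theorem rel_of_cross (P : NCB n) {p s k l : Fin (2*n)} (hpk : p < k) (hks : k < s)
    (hl : l < p ∨ s < l) (hps : P.1 p s) (hkl : P.1 k l) : P.1 p k := by
  rcases hl with hl | hl
  · exact P.symm' (P.trans' hkl (P.2.1 l p k s hl hpk hks (P.symm' hkl) hps))
  · exact P.2.1 p k s l hpk hks hl hps hkl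

/-- `{x, y}` is one of the edges `±{a, b}`. -/
def IsEdge (a b x y : Fin (2*n)) : Prop :=
  (x = a ∧ y = b) ∨ (x = b ∧ y = a) ∨
    (x = negB n a ∧ y = negB n b) ∨ (x = negB n b ∧ y = negB n a)

theorem IsEdge.rel {P : NCB n} {a b x y : Fin (2*n)} (h : IsEdge a b x y) (hab : P.1 a b) :
    P.1 x y := by
  rcases h with ⟨rfl, rfl⟩ | ⟨rfl, rfl⟩ | ⟨rfl, rfl⟩ | ⟨rfl, rfl⟩
  exacts [hab, P.symm' hab, P.neg hab, P.symm' (P.neg hab)]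

theorem IsEdge.rel_of_rel {P : NCB n} {a b x y : Fin (2*n)} (h : IsEdge a b x y)
    (hxy : P.1 x y) : P.1 a b := by
  rcases h with ⟨rfl, rfl⟩ | ⟨rfl, rfl⟩ | ⟨rfl, rfl⟩ | ⟨rfl, rfl⟩
  exacts [hxy, P.symm' hxy, rel_of_neg hxy, rel_of_neg (P.symm' hxy)]

theorem IsEdge.swap {a b x y : Fin (2*n)} (h : IsEdge a b x y) : IsEdge b a x y := by
  rcases h with h | h | h | h
  exacts [Or.inr (Or.inl h), Or.inl h, Or.inr (Or.inr (Or.inr h)), Or.inr (Or.inr (Or.inl h))]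

theorem IsEdge.of_neg {a b x y : Fin (2*n)} (h : IsEdge (negB n a) (negB n b) x y) :
    IsEdge a b x y := by
  unfold IsEdge at h
  rw [negB_negB, negB_negB] at h
  rcases h with h | h | h | h
  exacts [Or.inr (Or.inr (Or.inl h)), Or.inr (Or.inr (Or.inr h)), Or.inl h, Or.inr (Or.inl h)]

theorem nestRel_iff {p q r s x y : Fin (2*n)} :
    nestRel p q r s x y ↔ x = y ∨ IsEdge p s x y ∨ IsEdge q r x y := by
  unfold nestRel IsEdge
  simp only [or_assoc]

theorem nest_rel_outer {p q r s : Fin (2*n)} (h : Nested p q r s) : (nest p q r s h).1 p s :=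
  Or.inr (Or.inl ⟨rfl, rfl⟩)

theorem nest_rel_inner {p q r s : Fin (2*n)} (h : Nested p q r s) : (nest p q r s h).1 q r :=
  nestRel_iff.2 (Or.inr (Or.inr (Or.inl ⟨rfl, rfl⟩)))

theorem exists_edge {a b : Fin (2*n)} (hab : a ≠ b) :
    ∃ E : NCB n, E.1 a b ∧ ∀ x y, E.1 x y → x = y ∨ IsEdge a b x y := by
  wlog hlt : a < b generalizing a b
  · obtain ⟨E, h, h'⟩ := this hab.symm (lt_of_le_of_ne (not_lt.1 hlt) hab.symm)
    exact ⟨E, E.symm' h, fun x y hxy => (h' x y hxy).imp_right IsEdge.swap⟩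
  have ha := negB_val_cases a
  have hb := negB_val_cases b
  rcases le_or_gt b.val (a.val + n) with h | h
  · refine ⟨nest a a a b ⟨hlt, h, Or.inl rfl⟩, Or.inr (Or.inl ⟨rfl, rfl⟩), fun x y hxy => ?_⟩
    exact nestRel_self hxy
  · have hN : Nested (negB n b) (negB n b) (negB n b) (negB n a) :=
      ⟨by omega, by omega, Or.inl rfl⟩
    refine ⟨nest _ _ _ _ hN, nestRel_iff.2 (Or.inr (Or.inl ?_)), fun x y hxy => ?_⟩
    · simp [IsEdge]
    · exact (nestRel_self hxy).imp_right fun h => IsEdge.swap (IsEdge.of_neg h)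

theorem zero_rel {a b x y : Fin (2*n)} (h : (zero a b).1 x y) :
    x = y ∨ ((x = a ∨ x = b ∨ x = negB n a ∨ x = negB n b) ∧
        (y = a ∨ y = b ∨ y = negB n a ∨ y = negB n b)) := h

theorem zero_rel_self_neg (a b : Fin (2*n)) : (zero a b).1 a (negB n a) :=
  Or.inr ⟨by simp, by simp⟩

theorem zero_rel_pair (a b : Fin (2*n)) : (zero a b).1 a b :=
  Or.inr ⟨by simp, by simp⟩

theorem eq_of_rel_of_zero_rel {d : NCB n} {k l u v : Fin (2*n)}
    (hk : ¬ d.1 k (negB n k)) (hl : ¬ d.1 l (negB n l)) (hkl : ¬ d.1 k l)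
    (hkl' : ¬ d.1 k (negB n l)) (hd : d.1 u v) (h : (zero k l).1 u v) : u = v := by
  rcases zero_rel h with h | ⟨hu, hv⟩
  · exact h
  have hd' := d.symm' hd
  rcases hu with rfl | rfl | rfl | rfl <;> rcases hv with rfl | rfl | rfl | rfl <;>
  first
  | rfl
  | exact absurd hd ‹_›
  | exact absurd hd' ‹_›
  | exact absurd (rel_of_neg hd) ‹_›
  | exact absurd (rel_of_neg hd') ‹_›
  | exact absurd (rel_of_neg_left hd) ‹_›
  | exact absurd (rel_of_neg_left hd') ‹_›

/-- If `d` is left modular with a zero block, any two nonzero elements of `d` are related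
up to sign. -/
theorem LeftModular.false_of_zero {d : NCB n} (hd : LeftModular d) {j k l : Fin (2*n)}
    (hj : d.1 j (negB n j)) (hjn : j.val < n) (hjk : j.val < k.val) (hkj : k.val < j.val + n)
    (hl : l.val < j.val ∨ j.val + n < l.val) (hne : k ≠ negB n l)
    (hk : ¬ d.1 k (negB n k)) (hl' : ¬ d.1 l (negB n l)) (hkl : ¬ d.1 k l)
    (hkl' : ¬ d.1 k (negB n l)) : False := by
  have hj' := negB_val_cases j
  have hkv := negB_val_cases k
  have hlv := negB_val_cases l
  have hkl_ne : k ≠ l := fun h => hkl (h ▸ d.refl' k)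
  obtain ⟨x, hx, hx'⟩ := exists_edge hkl_ne
  have hxy : x ≤ zero k l := le_def.2 fun u v huv => by
    rcases hx' u v huv with rfl | h
    · exact refl' _ _
    · exact h.rel (zero_rel_pair k l)
  have hJj : (x ⊔ d).1 j (negB n j) := right_rel_sup hj
  have hJkl : (x ⊔ d).1 k l := left_rel_sup hx
  have hJjk : (x ⊔ d).1 j k :=
    rel_of_cross _ (Fin.lt_def.2 hjk) (Fin.lt_def.2 (by omega))
      (hl.imp (fun h => Fin.lt_def.2 h) fun h => Fin.lt_def.2 (by omega)) hJj hJkl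
  have hJk : (x ⊔ d).1 k (negB n k) :=
    trans' _ (symm' _ hJjk) (trans' _ hJj (neg _ hJjk))
  have hle := hd x (zero k l) hxy (zero_le hJk hJkl) (le_def.2 fun u v huv => by
    obtain ⟨h₁, h₂⟩ := inf_rel huv
    rw [eq_of_rel_of_zero_rel hk hl' hkl hkl' h₁ h₂])
  have := hx' _ _ (le_def.1 hle _ _ (zero_rel_self_neg k l))
  simp only [IsEdge, Fin.ext_iff, ne_eq] at this hne hkl_ne
  omega

theorem LeftModular.false_of_zero' {d : NCB n} (hd : LeftModular d) {j k l : Fin (2*n)}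
    (hj : d.1 j (negB n j)) (hk : ¬ d.1 k (negB n k)) (hl : ¬ d.1 l (negB n l))
    (hkl : ¬ d.1 k l) (hkl' : ¬ d.1 k (negB n l)) : False := by
  wlog hjn : j.val < n generalizing j
  · have hjv := negB_val_cases j
    exact this (d.neg hj) (by omega)
  have neg_neg : ∀ {x : Fin (2*n)}, ¬ d.1 x (negB n x) → ¬ d.1 (negB n x) (negB n (negB n x)) :=
    fun h h' => h (rel_of_neg h')
  wlog hjk : j.val < k.val ∧ k.val < j.val + n generalizing k
  · have h₁ := negB_val_cases k
    have h₂ := negB_val_cases j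
    have h₃ : k ≠ j := fun h => hk (h ▸ hj)
    have h₄ : k ≠ negB n j := fun h => hk (by rw [h]; exact d.neg hj)
    simp only [ne_eq, Fin.ext_iff] at h₃ h₄
    exact this (neg_neg hk) (fun h => hkl' (rel_of_neg_left h))
      (fun h => hkl (rel_of_neg h)) (by omega)
  wlog hjl : l.val < j.val ∨ j.val + n < l.val generalizing l
  · have h₁ := negB_val_cases l
    have h₂ := negB_val_cases j
    have h₃ : l ≠ j := fun h => hl (h ▸ hj)
    have h₄ : l ≠ negB n j := fun h => hl (by rw [h]; exact d.neg hj)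
    simp only [ne_eq, Fin.ext_iff] at h₃ h₄
    exact this (neg_neg hl) hkl' (by simpa using hkl) (by omega)
  exact hd.false_of_zero hj hjn hjk.1 hjk.2 hjl (fun h => hkl' (h ▸ d.refl' _)) hk hl hkl hkl'

theorem LeftModular.false_of_three {d : NCB n} (hd : LeftModular d)
    (h0 : ∀ x, ¬ d.1 x (negB n x)) {i k j : Fin (2*n)} (hik : d.1 i k) (hkj : d.1 k j)
    (h₁ : i.val < k.val) (h₂ : k.val < j.val) (h₃ : j.val < i.val + n) : False := by
  have hiv := negB_val_cases i
  have hkv := negB_val_cases k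
  have hjv := negB_val_cases j
  have hij := d.trans' hik hkj
  have hne : j ≠ negB n i := fun h => by simp only [Fin.ext_iff] at h; omega
  obtain ⟨x, hx, hx'⟩ := exists_edge hne
  obtain ⟨y, hyk, hyj, hy⟩ : ∃ y : NCB n, y.1 k (negB n k) ∧ y.1 j (negB n i) ∧
      ∀ u v, y.1 u v → u = v ∨ IsEdge k (negB n k) u v ∨ IsEdge j (negB n i) u v := by
    rcases lt_or_ge k.val n with h | h
    · have hN : Nested k j (negB n i) (negB n k) := ⟨by omega, by omega, by omega⟩
      exact ⟨nest _ _ _ _ hN, nest_rel_outer hN, nest_rel_inner hN, fun u v h => nestRel_iff.1 h⟩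
    · have hN : Nested (negB n k) (negB n j) i k := ⟨by omega, by omega, by omega⟩
      refine ⟨nest _ _ _ _ hN, symm' _ (nest_rel_outer hN),
        rel_of_neg (by simpa using nest_rel_inner hN), fun u v h => ?_⟩
      refine (nestRel_iff.1 h).imp_right (Or.imp IsEdge.swap fun h => IsEdge.of_neg ?_)
      rwa [negB_negB]
  have hJij : (x ⊔ d).1 i j := right_rel_sup hij
  have hJik : (x ⊔ d).1 i k := right_rel_sup hik
  have hJj : (x ⊔ d).1 j (negB n i) := left_rel_sup hx
  have hJk : (x ⊔ d).1 k (negB n k) :=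
    trans' _ (symm' _ hJik) (trans' _ (trans' _ hJij hJj) (neg _ hJik))
  have hle := hd x y
    (le_def.2 fun u v huv => by
      rcases hx' u v huv with rfl | h
      · exact refl' _ _
      · exact h.rel hyj)
    (le_def.2 fun u v huv => by
      rcases hy u v huv with rfl | h | h
      · exact refl' _ _
      · exact h.rel hJk
      · exact h.rel hJj)
    (le_def.2 fun u v huv => by
      obtain ⟨hduv, hyuv⟩ := inf_rel huv
      rcases hy u v hyuv with rfl | h | h
      · exact refl' _ _
      · exact absurd (h.rel_of_rel hduv) (h0 k)
      · exact h.rel hx)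
  have := hx' _ _ (le_def.1 hle _ _ hyk)
  simp only [IsEdge, negB_negB, Fin.ext_iff] at this
  omega

theorem LeftModular.rel_of_between {d : NCB n} (hd : LeftModular d)
    (h0 : ∀ x, ¬ d.1 x (negB n x)) {i k j : Fin (2*n)} (hij : d.1 i j)
    (h₁ : i.val < k.val) (h₂ : k.val < j.val) (h₃ : j.val < i.val + n) : d.1 i k := by
  by_contra hik
  have hiv := negB_val_cases i
  have hkv := negB_val_cases k
  have hki : ¬ d.1 k i := fun h => hik (d.symm' h)
  have hki' : ¬ d.1 k (negB n i) := fun h =>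
    hik (d.rel_of_cross (Fin.lt_def.2 h₁) (Fin.lt_def.2 h₂)
      (by simp only [Fin.lt_def]; omega) hij h)
  have hJk : (zero k k ⊔ d).1 k (negB n k) := left_rel_sup (zero_rel_self_neg k k)
  have hJik : (zero k k ⊔ d).1 i k :=
    rel_of_cross _ (Fin.lt_def.2 h₁) (Fin.lt_def.2 h₂)
      (by simp only [Fin.lt_def]; omega) (right_rel_sup hij) hJk
  have hle := hd (zero k k) (zero k i)
    (zero_le (zero_rel_self_neg k i) (refl' _ _))
    (zero_le hJk (symm' _ hJik)) (le_def.2 fun u v huv => by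
      obtain ⟨h₁, h₂⟩ := inf_rel huv
      rw [eq_of_rel_of_zero_rel (h0 k) (h0 i) hki hki' h₁ h₂])
  have := zero_rel (le_def.1 hle _ _ (zero_rel_pair k i))
  simp only [Fin.ext_iff] at this
  omega

theorem LeftModular.false_of_two_pairs {d : NCB n} (hd : LeftModular d)
    {i i' j j' : Fin (2*n)} (hi : d.1 i i') (hj : d.1 j j') (hij : ¬ d.1 i j)
    (h₁ : i.val < i'.val) (h₂ : i'.val < j.val) (h₃ : j.val < j'.val)
    (h₄ : j'.val < i.val + n) : False := by
  have hiv := negB_val_cases i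
  have hiv' := negB_val_cases i'
  have hjv := negB_val_cases j
  have hjv' := negB_val_cases j'
  have hne : i ≠ j' := fun h => by simp only [Fin.ext_iff] at h; omega
  obtain ⟨x, hx, hx'⟩ := exists_edge hne
  have hN : Nested i i' j j' := ⟨by omega, by omega, by omega⟩
  have hyi : (nest i i' j j' hN).1 i j' := nest_rel_outer hN
  have hyi' : (nest i i' j j' hN).1 i' j := nest_rel_inner hN
  have hJ : (x ⊔ d).1 i j' := left_rel_sup hx
  have hle := hd x (nest i i' j j' hN)
    (le_def.2 fun u v huv => by
      rcases hx' u v huv with rfl | h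
      · exact refl' _ _
      · exact h.rel hyi)
    (nest_le hN hJ (trans' _ (symm' _ (right_rel_sup hi))
      (trans' _ hJ (symm' _ (right_rel_sup hj)))))
    (le_def.2 fun u v huv => by
      obtain ⟨hduv, hyuv⟩ := inf_rel huv
      rcases nestRel_iff.1 hyuv with rfl | h | h
      · exact refl' _ _
      · exact absurd (d.trans' (h.rel_of_rel hduv) (d.symm' hj)) hij
      · exact absurd (d.trans' hi (h.rel_of_rel hduv)) hij)
  have := hx' _ _ (le_def.1 hle _ _ hyi')
  simp only [IsEdge, Fin.ext_iff] at this
  omega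

theorem LeftModular.exists_adjacent {d : NCB n} (hd : LeftModular d)
    (h0 : ∀ x, ¬ d.1 x (negB n x)) {x y : Fin (2*n)} (hxy : d.1 x y) (hne : x ≠ y) :
    ∃ i i' : Fin (2*n), i.val < n ∧ i'.val = i.val + 1 ∧ d.1 i i' ∧ IsEdge i i' x y := by
  wlog hlt : x < y generalizing x y
  · obtain ⟨i, i', h₁, h₂, h₃, h₄⟩ :=
      this (d.symm' hxy) hne.symm (lt_of_le_of_ne (not_lt.1 hlt) hne.symm)
    refine ⟨i, i', h₁, h₂, h₃, ?_⟩
    unfold IsEdge at *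
    tauto
  have hxv := negB_val_cases x
  have hyv := negB_val_cases y
  have hy : y ≠ negB n x := fun h => h0 x (h ▸ hxy)
  simp only [ne_eq, Fin.ext_iff] at hy
  rw [Fin.lt_def] at hlt
  obtain ⟨i, j, hin, hij, hji, he⟩ : ∃ i j : Fin (2*n), i.val < n ∧ i.val < j.val ∧
      j.val < i.val + n ∧ IsEdge i j x y := by
    rcases lt_or_ge y.val (x.val + n) with h | h
    · rcases lt_or_ge x.val n with h' | h'
      · exact ⟨x, y, h', hlt, h, by simp [IsEdge]⟩
      · exact ⟨negB n x, negB n y, by omega, by omega, by omega, by simp [IsEdge]⟩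
    · exact ⟨negB n y, negB n x, by omega, by omega, by omega, by simp [IsEdge]⟩
  have hdij := he.rel_of_rel hxy
  rcases Nat.lt_or_ge (i.val + 1) j.val with h | h
  · exfalso
    have hk := hd.rel_of_between h0 (k := ⟨i.val + 1, by omega⟩) hdij (by simp) h hji
    exact hd.false_of_three h0 hk (d.trans' (d.symm' hk) hdij) (by simp) h hji
  · exact ⟨i, j, hin, by omega, hdij, he⟩

/-- A left modular element without zero block has at most one pair of nontrivial blocks,
which are edges between neighbours. -/
theorem LeftModular.eq_bot_or_adjacent {d : NCB n} (hd : LeftModular d)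
    (h0 : ∀ x, ¬ d.1 x (negB n x)) :
    (∀ x y, d.1 x y → x = y) ∨
    ∃ i i' : Fin (2*n), i.val < n ∧ i'.val = i.val + 1 ∧ d.1 i i' ∧
      ∀ x y, d.1 x y → x = y ∨ IsEdge i i' x y := by
  by_cases htriv : ∀ x y, d.1 x y → x = y
  · exact Or.inl htriv
  push Not at htriv
  obtain ⟨x, y, hxy, hne⟩ := htriv
  obtain ⟨i, i', hin, hi', hd₁, -⟩ := hd.exists_adjacent h0 hxy hne
  have main : ∀ {i i' j j' : Fin (2*n)}, i.val < j.val → j.val < n → i'.val = i.val + 1 →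
      j'.val = j.val + 1 → d.1 i i' → d.1 j j' → False := by
    intro i i' j j' hij hj hi' hj' hdi hdj
    have hiv := negB_val_cases i
    have hiv' := negB_val_cases i'
    have hjv := negB_val_cases j
    have hjv' := negB_val_cases j'
    by_cases hdij : d.1 i j
    · rcases Nat.lt_or_ge j'.val (i.val + n) with h | h
      · exact hd.false_of_three h0 hdij hdj hij (by omega) h
      · have : j' = negB n i := Fin.ext (by omega)
        exact h0 i (this ▸ d.trans' hdij hdj)
    · rcases Nat.lt_or_ge j'.val (i.val + n) with h | h
      · have : i'.val ≠ j.val := fun h => hdij (Fin.ext h ▸ hdi)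
        exact hd.false_of_two_pairs hdi hdj hdij (by omega) (by omega) (by omega) h
      · have hj'i : j' = negB n i := Fin.ext (by omega)
        rw [hj'i] at hdj
        have hdn := d.trans' hdj (d.neg hdi)
        by_cases hji : j.val = i.val + 1
        · have : j = i' := Fin.ext (by omega)
          exact hdij (this ▸ hdi)
        · exact hd.false_of_three h0 hdj (d.neg hdi) (by omega) (by omega) (by omega)
  refine Or.inr ⟨i, i', hin, hi', hd₁, fun u v huv => ?_⟩
  by_cases huv' : u = v
  · exact Or.inl huv'
  obtain ⟨j, j', hjn, hj', hd₂, he⟩ := hd.exists_adjacent h0 huv huv'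
  rcases lt_trichotomy i.val j.val with h | h | h
  · exact (main h hjn hi' hj' hd₁ hd₂).elim
  · obtain rfl : i = j := Fin.ext h
    obtain rfl : i' = j' := Fin.ext (by omega)
    exact Or.inr he
  · exact (main h hin hj' hi' hd₂ hd₁).elim

end NCB

/-! ### Rank at least four -/

namespace NCB

variable {n : ℕ}

theorem eq_of_bot_rel (hn : 2 ≤ n) {x y : Fin (2*n)} (h : (⊥ : NCB n).1 x y) : x = y := by
  have h₀ := zero_rel (le_def.1 (bot_le : ⊥ ≤ zero ⟨0, by omega⟩ ⟨0, by omega⟩) x y h)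
  have h₁ := zero_rel (le_def.1 (bot_le : ⊥ ≤ zero ⟨1, by omega⟩ ⟨1, by omega⟩) x y h)
  have e₀ := negB_val_cases (⟨0, by omega⟩ : Fin (2*n))
  have e₁ := negB_val_cases (⟨1, by omega⟩ : Fin (2*n))
  simp only [Fin.ext_iff] at *
  omega

theorem mem_of_isMaxChain {D : Set (NCB n)} (hD : IsMaxChain (· ≤ ·) D) {e : NCB n}
    (he : ∀ d ∈ D, d ≤ e ∨ e ≤ d) : e ∈ D := by
  have h : D = insert e D :=
    hD.2 (hD.1.insert fun d hd _ => (he d hd).symm) (Set.subset_insert e D)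
  rw [h]
  exact Set.mem_insert e D

/-- In a maximal chain there is a step from a largest element `d` without zero block to a smallest
element `u` with zero block. -/
theorem exists_zero_step (hn : 2 ≤ n) {D : Set (NCB n)} (hD : IsMaxChain (· ≤ ·) D) :
    ∃ d ∈ D, ∃ u ∈ D, (∀ x, ¬ d.1 x (negB n x)) ∧ (∃ x, u.1 x (negB n x)) ∧ d ≤ u ∧
      ∀ e : NCB n, d ≤ e → e ≤ u → (∃ x, e.1 x (negB n x)) → u ≤ e := by
  have hne : ∀ x : Fin (2*n), x ≠ negB n x := fun x h => by
    have := negB_val_cases x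
    simp only [Fin.ext_iff] at h
    omega
  obtain ⟨d, hd⟩ := Set.Finite.exists_maximal
    (Set.toFinite {d : NCB n | d ∈ D ∧ ∀ x, ¬ d.1 x (negB n x)})
    ⟨⊥, mem_of_isMaxChain hD fun _ _ => Or.inr bot_le, fun x h => hne x (eq_of_bot_rel hn h)⟩
  obtain ⟨u, hu⟩ := Set.Finite.exists_minimal
    (Set.toFinite {u : NCB n | u ∈ D ∧ ∃ x, u.1 x (negB n x)})
    ⟨⊤, mem_of_isMaxChain hD fun _ _ => Or.inl le_top, ⟨0, by omega⟩,
      le_def.1 le_top _ _ (zero_rel_self_neg _ ⟨0, by omega⟩)⟩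
  have hd' : ∀ e ∈ D, (∀ x, ¬ e.1 x (negB n x)) → e ≤ d := fun e he he0 =>
    (hD.1.total he hd.1.1).elim id fun h => hd.2 ⟨he, he0⟩ h
  have hu' : ∀ e ∈ D, (∃ x, e.1 x (negB n x)) → u ≤ e := fun e he he0 =>
    (hD.1.total hu.1.1 he).elim id fun h => hu.2 ⟨he, he0⟩ h
  have hdu : d ≤ u := (hD.1.total hd.1.1 hu.1.1).elim id fun h => by
    obtain ⟨x, hx⟩ := hu.1.2
    exact absurd (le_def.1 h _ _ hx) (hd.1.2 x)
  refine ⟨d, hd.1.1, u, hu.1.1, hd.1.2, hu.1.2, hdu, fun e hde heu he0 => ?_⟩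
  refine hu' e (mem_of_isMaxChain hD fun w hw => ?_) he0
  by_cases hw0 : ∃ x, w.1 x (negB n x)
  · exact Or.inr (heu.trans (hu' w hw hw0))
  · push Not at hw0
    exact Or.inl ((hd' w hw hw0).trans hde)

theorem not_zero_rel {a b k l : Fin (2*n)} (ha : k ≠ a) (ha' : k ≠ negB n a) (hb : k ≠ b)
    (hb' : k ≠ negB n b) (hkl : k ≠ l) : ¬ (zero a b).1 k l := fun h => by
  rcases zero_rel h with h | ⟨h, -⟩
  · exact hkl h
  · rcases h with h | h | h | h
    exacts [ha h, hb h, ha' h, hb' h]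

/-- Choose a vertex which differs from three given ones up to sign. -/
theorem exists_ne (hn : 4 ≤ n) (a b c : Fin (2*n)) : ∃ k : Fin (2*n),
    (k ≠ a ∧ k ≠ negB n a) ∧ (k ≠ b ∧ k ≠ negB n b) ∧ (k ≠ c ∧ k ≠ negB n c) := by
  by_contra! h
  have ha := negB_val_cases a
  have hb := negB_val_cases b
  have hc := negB_val_cases c
  have h₀ := h ⟨0, by omega⟩
  have h₁ := h ⟨1, by omega⟩
  have h₂ := h ⟨2, by omega⟩
  have h₃ := h ⟨3, by omega⟩
  simp only [ne_eq, Fin.ext_iff] at h₀ h₁ h₂ h₃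
  omega

/-- A left modular element is not contained in a partition with a single zero block of at most
four elements. -/
theorem LeftModular.false_of_le_zero (hn : 4 ≤ n) {u : NCB n} (hu : LeftModular u)
    (hu0 : ∃ x, u.1 x (negB n x)) {a b : Fin (2*n)} (h : u ≤ zero a b) : False := by
  obtain ⟨t, ht⟩ := hu0
  obtain ⟨k, ⟨ka, ka'⟩, ⟨kb, kb'⟩, -⟩ := exists_ne hn a b b
  obtain ⟨l, ⟨la, la'⟩, ⟨lb, lb'⟩, ⟨lk, lk'⟩⟩ := exists_ne hn a b k
  have hkv := negB_val_cases k
  have hlv := negB_val_cases l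
  have hk : k ≠ negB n k := fun h => by simp only [Fin.ext_iff] at h; omega
  have hl : l ≠ negB n l := fun h => by simp only [Fin.ext_iff] at h; omega
  have hkl : k ≠ negB n l := fun h => lk' (by rw [h, negB_negB])
  refine hu.false_of_zero' ht (k := k) (l := l) ?_ ?_ ?_ ?_ <;> intro h'
  · exact not_zero_rel ka ka' kb kb' hk (le_def.1 h _ _ h')
  · exact not_zero_rel la la' lb lb' hl (le_def.1 h _ _ h')
  · exact not_zero_rel ka ka' kb kb' lk.symm (le_def.1 h _ _ h')
  · exact not_zero_rel ka ka' kb kb' hkl (le_def.1 h _ _ h')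

theorem not_supersolvable (hn : 4 ≤ n) : ¬ SupersolvablePoset (NCB n) := by
  rintro ⟨D, hD, hM⟩
  obtain ⟨d, hdD, u, huD, hd0, hu0, hdu, hstep⟩ := exists_zero_step (by omega) hD
  have hd := leftModular_of_mem hM hdD
  have hu := leftModular_of_mem hM huD
  obtain ⟨t, ht⟩ := hu0
  rcases hd.eq_bot_or_adjacent hd0 with hbot | ⟨i, i', hin, hi', hdi, hedge⟩
  · refine hu.false_of_le_zero hn ⟨t, ht⟩ (a := t) (b := t) (hstep _ ?_ ?_ ?_)
    · exact le_def.2 fun x y h => hbot x y h ▸ refl' _ _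
    · exact zero_le ht (refl' _ _)
    · exact ⟨t, zero_rel_self_neg t t⟩
  by_cases hui : u.1 i (negB n i)
  · refine hu.false_of_le_zero hn ⟨t, ht⟩ (a := i) (b := i') (hstep _ ?_ ?_ ?_)
    · refine le_def.2 fun x y h => ?_
      rcases hedge x y h with rfl | h
      · exact refl' _ _
      · exact h.rel (zero_rel_pair i i')
    · exact zero_le hui (le_def.1 hdu _ _ hdi)
    · exact ⟨i, zero_rel_self_neg i i'⟩
  have hiv := negB_val_cases i
  have hiv' := negB_val_cases i'
  wlog htn : t.val < n generalizing t
  · have htv := negB_val_cases t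
    exact this _ (u.neg ht) (by omega)
  have htv := negB_val_cases t
  have hti : t ≠ i := fun h => hui (h ▸ ht)
  have hti' : t ≠ i' := fun h => by
    rw [h] at ht
    have := le_def.1 hdu _ _ hdi
    exact hui (u.trans' this (u.trans' ht (u.symm' (u.neg this))))
  have hti'' : i' ≠ negB n t := fun h => by
    have := u.trans' (le_def.1 hdu _ _ hdi) (h ▸ u.symm' ht)
    exact hui (u.trans' this (u.trans' ht (u.symm' (u.neg this))))
  simp only [ne_eq, Fin.ext_iff] at hti hti' hti''
  obtain ⟨e, het, hei, he⟩ : ∃ e : NCB n, e.1 t (negB n t) ∧ e.1 i i' ∧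
      ∀ x y, e.1 x y → x = y ∨ IsEdge t (negB n t) x y ∨ IsEdge i i' x y := by
    rcases lt_or_ge t.val i.val with h | h
    · have hN : Nested t i i' (negB n t) := ⟨by omega, by omega, by omega⟩
      exact ⟨_, nest_rel_outer hN, nest_rel_inner hN, fun x y h => nestRel_iff.1 h⟩
    · have hN : Nested t (negB n i) (negB n i') (negB n t) := ⟨by omega, by omega, by omega⟩
      exact ⟨_, nest_rel_outer hN, rel_of_neg (nest_rel_inner hN),
        fun x y h => (nestRel_iff.1 h).imp_right (Or.imp_right IsEdge.of_neg)⟩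
  have hue : u ≤ e := hstep e
    (le_def.2 fun x y h => by
      rcases hedge x y h with rfl | h
      · exact refl' _ _
      · exact h.rel hei)
    (le_def.2 fun x y h => by
      rcases he x y h with rfl | h | h
      · exact refl' _ _
      · exact h.rel ht
      · exact h.rel (le_def.1 hdu _ _ hdi))
    ⟨t, het⟩
  obtain ⟨k, ⟨kt, kt'⟩, ⟨ki, ki'⟩, ⟨kj, kj'⟩⟩ := exists_ne hn t i i'
  have hk : ∀ l, k ≠ l → ¬ u.1 k l := fun l hkl h => by
    rcases he k l (le_def.1 hue _ _ h) with h | h | h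
    · exact hkl h
    · rcases h with h | h | h | h
      exacts [kt h.1, kt' h.1, kt' h.1, kt (by rw [h.1, negB_negB])]
    · rcases h with h | h | h | h
      exacts [ki h.1, kj h.1, ki' h.1, kj' h.1]
  have hkv := negB_val_cases k
  exact hu.false_of_zero' ht (hk _ fun h => by simp only [Fin.ext_iff] at h; omega) hui
    (hk _ ki) (hk _ ki')

end NCB

/-! ### Supersolvability from a coding by bit masks -/

namespace Mask

/-- The first mask of `F` containing `m` and `k`. -/
def join (F : List ℕ) (m k : ℕ) : ℕ :=
  (F.find? fun f => f &&& (m ||| k) == (m ||| k)).getD 0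

/-- A family of masks that is a lattice under inclusion, with meet `&&&` and join `join F`. -/
def IsLattice (F : List ℕ) : Prop :=
  ∀ m ∈ F, ∀ k ∈ F, m &&& k ∈ F ∧ join F m k ∈ F ∧ m &&& join F m k = m ∧
    k &&& join F m k = k ∧ ∀ f ∈ F, m &&& f = m → k &&& f = k → join F m k &&& f = join F m k

/-- The masks obtained from `l` by taking meets and then joins. -/
def generate (F l : List ℕ) : List ℕ :=
  let meets := (l.flatMap fun x => l.map fun y => x &&& y).dedup
  let joins := (meets.flatMap fun x => meets.map fun y => join F x y).dedup
  (joins.flatMap fun x => joins.map fun y => join F x y).dedup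

/-- `l` is a distributive sublattice of `F`. -/
def IsDistrib (F l : List ℕ) : Prop :=
  ∀ x ∈ l, ∀ y ∈ l, x &&& y ∈ l ∧ join F x y ∈ l ∧
    ∀ z ∈ l, x &&& join F y z = join F (x &&& y) (x &&& z)

/-- `D` is a maximal chain of `F`, chains of `F` have at most two elements besides `0` and `t`,
and together with `D` they generate distributive sublattices. -/
def IsMChain (F D : List ℕ) (t : ℕ) : Prop :=
  (0 ∈ D ∧ t ∈ D) ∧ (∀ d ∈ D, d ∈ F) ∧
  (∀ d ∈ D, ∀ e ∈ D, d &&& e = d ∨ e &&& d = e) ∧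
  (∀ f ∈ F, (∀ d ∈ D, d &&& f = d ∨ f &&& d = f) → f ∈ D) ∧
  (∀ x ∈ F, x ≠ 0 → ∀ y ∈ F, x ≠ y → x &&& y = x → ∀ z ∈ F, y ≠ z → y &&& z = y → z = t) ∧
  ∀ x ∈ F, ∀ y ∈ F, x &&& y = x →
    (∀ d ∈ x :: y :: D, d ∈ generate F (x :: y :: D)) ∧ IsDistrib F (generate F (x :: y :: D))

instance (F : List ℕ) : Decidable (IsLattice F) := by unfold IsLattice; infer_instance
instance (F l : List ℕ) : Decidable (IsDistrib F l) := by unfold IsDistrib; infer_instance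
instance (F D : List ℕ) (t : ℕ) : Decidable (IsMChain F D t) := by
  unfold IsMChain; infer_instance

section

variable {α : Type*} [PartialOrder α] {φ : α → ℕ} {F : List ℕ}

theorem map_isGLB (hmem : ∀ x, φ x ∈ F) (hsurj : ∀ m ∈ F, ∃ x, φ x = m)
    (hle : ∀ x y, x ≤ y ↔ φ x &&& φ y = φ x) (hF : IsLattice F) {x y z : α}
    (h : IsGLB {x, y} z) : φ z = φ x &&& φ y := by
  obtain ⟨w, hw⟩ := hsurj _ (hF _ (hmem x) _ (hmem y)).1
  have hwz : w = z := by
    refine le_antisymm (h.2 ?_) ((hle _ _).2 ?_)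
    · rintro u (rfl | rfl)
      · rw [hle, hw, Nat.land_comm, ← Nat.land_assoc, Nat.and_self]
      · rw [hle, hw, Nat.land_assoc, Nat.and_self]
    · have h1 := (hle _ _).1 (h.1 (Or.inl rfl))
      have h2 := (hle _ _).1 (h.1 (Or.inr rfl))
      rw [hw, ← Nat.land_assoc, h1, h2]
  rw [← hwz, hw]

theorem map_isLUB (hmem : ∀ x, φ x ∈ F) (hsurj : ∀ m ∈ F, ∃ x, φ x = m)
    (hle : ∀ x y, x ≤ y ↔ φ x &&& φ y = φ x) (hF : IsLattice F) {x y z : α}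
    (h : IsLUB {x, y} z) : φ z = join F (φ x) (φ y) := by
  obtain ⟨-, h1, h2, h3, h4⟩ := hF _ (hmem x) _ (hmem y)
  obtain ⟨w, hw⟩ := hsurj _ h1
  have hwz : w = z := by
    refine le_antisymm ((hle _ _).2 ?_) (h.2 ?_)
    · rw [hw]
      exact h4 _ (hmem z) ((hle _ _).1 (h.1 (Or.inl rfl))) ((hle _ _).1 (h.1 (Or.inr rfl)))
    · rintro u (rfl | rfl)
      · rw [hle, hw, h2]
      · rw [hle, hw, h3]
  rw [← hwz, hw]

theorem exists_pair_of_isChain (hmem : ∀ x, φ x ∈ F) (hinj : Function.Injective φ)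
    (hle : ∀ x y, x ≤ y ↔ φ x &&& φ y = φ x) {D : List ℕ} {t : ℕ} (hD : IsMChain F D t)
    {C : Set α} (hC : IsChain (· ≤ ·) C) (x₀ : α) :
    ∃ x y : α, x ≤ y ∧ ∀ c ∈ C, φ c = 0 ∨ φ c = t ∨ c = x ∨ c = y := by
  have key : ∀ x y z, φ x ≠ 0 → φ z ≠ t → x < y → y < z → False := by
    intro x y z hx hz hxy hyz
    exact hz (hD.2.2.2.2.1 _ (hmem x) hx _ (hmem y) (fun h => hxy.ne (hinj h))
      ((hle _ _).1 hxy.le) _ (hmem z) (fun h => hyz.ne (hinj h)) ((hle _ _).1 hyz.le))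
  by_cases h1 : ∃ x ∈ C, φ x ≠ 0 ∧ φ x ≠ t
  · obtain ⟨x, hx, hx0, hxt⟩ := h1
    by_cases h2 : ∃ y ∈ C, φ y ≠ 0 ∧ φ y ≠ t ∧ y ≠ x
    · obtain ⟨y, hy, hy0, hyt, hyx⟩ := h2
      wlog hxy : x ≤ y generalizing x y
      · exact this y hy hy0 hyt x hx hx0 hxt hyx.symm
          ((hC.total hx hy).resolve_left hxy)
      refine ⟨x, y, hxy, fun c hc => ?_⟩
      by_contra! hcon
      obtain ⟨hc0, hct, hcx, hcy⟩ := hcon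
      have hxy' := lt_of_le_of_ne hxy hyx.symm
      rcases hC.total hc hx with h | h
      · exact key c x y hc0 hyt (lt_of_le_of_ne h hcx) hxy'
      rcases hC.total hc hy with h' | h'
      · exact key x c y hx0 hyt (lt_of_le_of_ne h hcx.symm) (lt_of_le_of_ne h' hcy)
      · exact key x y c hx0 hct hxy' (lt_of_le_of_ne h' hcy.symm)
    · push Not at h2
      refine ⟨x, x, le_rfl, fun c hc => ?_⟩
      by_contra! hcon
      exact hcon.2.2.1 (h2 c hc hcon.1 hcon.2.1)
  · push Not at h1
    refine ⟨x₀, x₀, le_rfl, fun c hc => ?_⟩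
    by_contra! hcon
    exact hcon.2.1 (h1 c hc hcon.1)

theorem supersolvable (hmem : ∀ x, φ x ∈ F) (hsurj : ∀ m ∈ F, ∃ x, φ x = m)
    (hle : ∀ x y, x ≤ y ↔ φ x &&& φ y = φ x) (hF : IsLattice F) {D : List ℕ} {t : ℕ}
    (hD : IsMChain F D t) : SupersolvablePoset α := by
  have hinj : Function.Injective φ := fun x y h =>
    le_antisymm ((hle _ _).2 (by rw [h, Nat.and_self])) ((hle _ _).2 (by rw [h, Nat.and_self]))
  obtain ⟨x₀, -⟩ := hsurj 0 (hD.2.1 _ hD.1.1)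
  refine ⟨{x | φ x ∈ D}, ⟨?_, ?_⟩, ?_⟩
  · intro x hx y hy _
    simpa only [hle] using hD.2.2.1 _ hx _ hy
  · intro s hs hDs
    refine hDs.antisymm fun x hx => hD.2.2.2.1 _ (hmem x) fun d hd => ?_
    obtain ⟨y, rfl⟩ := hsurj d (hD.2.1 d hd)
    simpa only [hle] using hs.total (hDs hd) hx
  · intro C hC
    obtain ⟨x, y, hxy, hCxy⟩ := exists_pair_of_isChain hmem hinj hle hD hC x₀
    obtain ⟨hL, hdist⟩ := hD.2.2.2.2.2 _ (hmem x) _ (hmem y) ((hle _ _).1 hxy)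
    refine ⟨{z | φ z ∈ generate F (φ x :: φ y :: D)}, ?_, ⟨?_, ?_⟩, ?_⟩
    · rintro z (hz | hz)
      · refine hL _ ?_
        rcases hCxy z hz with h | h | rfl | rfl
        · simp [h, hD.1.1]
        · simp [h, hD.1.2]
        · simp
        · simp
      · exact hL _ (by simp [show φ z ∈ D from hz])
    · intro a ha b hb c hc
      rw [Set.mem_ofPred_eq, map_isLUB hmem hsurj hle hF hc]
      exact (hdist _ ha _ hb).2.1
    · intro a ha b hb c hc
      rw [Set.mem_ofPred_eq, map_isGLB hmem hsurj hle hF hc]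
      exact (hdist _ ha _ hb).1
    · intro u hu v hv w hw a b p q r ha hb hp hq hr
      apply hinj
      rw [map_isGLB hmem hsurj hle hF hb, map_isLUB hmem hsurj hle hF ha,
        map_isLUB hmem hsurj hle hF hr, map_isGLB hmem hsurj hle hF hp,
        map_isGLB hmem hsurj hle hF hq]
      exact (hdist _ hu _ hv).2.2 _ hw

end

/-! ### Coding noncrossing partitions for `n ≤ 3` -/

/-- For `n ≤ 3`, numbers the pairs of distinct vertices up to order and negation. -/
def index {n : ℕ} (x y : Fin (2*n)) : ℕ :=
  if x.val % n = y.val % n then n * (n - 1) + x.val % n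
  else (x.val % n + y.val % n - 1) * 2 + if x.val / n = y.val / n then 0 else 1

/-- The relation on the vertices of the `2n`-gon coded by a mask. -/
def Rel {n : ℕ} (m : ℕ) (x y : Fin (2*n)) : Prop :=
  x = y ∨ m.testBit (index x y) = true

instance {n : ℕ} (m : ℕ) (x y : Fin (2*n)) : Decidable (Rel m x y) := by
  unfold Rel; infer_instance

/-- The mask codes a noncrossing `B_n`-partition. -/
def IsNCB (n m : ℕ) : Prop :=
  (∀ x y : Fin (2*n), Rel m x y → Rel m y x ∧ Rel m (negB n x) (negB n y) ∧
    ∀ z, Rel m y z → Rel m x z) ∧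
  (∀ x : Fin (2*n), Rel m x (negB n x) → ∀ y, Rel m y (negB n y) → Rel m x y) ∧
  ∀ a b : Fin (2*n), a < b → ∀ c, b < c → Rel m a c → ∀ d, c < d → Rel m b d → Rel m a b

instance (n m : ℕ) : Decidable (IsNCB n m) := by
  unfold IsNCB; infer_instance

theorem exists_code {n : ℕ} (hlt : ∀ x y : Fin (2*n), x ≠ y → index x y < n * n)
    (hidx : ∀ x y z w : Fin (2*n), x ≠ y → z ≠ w → index x y = index z w →
      (z = x ∧ w = y) ∨ (z = y ∧ w = x) ∨ (z = negB n x ∧ w = negB n y) ∨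
        (z = negB n y ∧ w = negB n x)) (P : NCB n) :
    ∃ m < 2 ^ (n * n), ∀ x y, P.1 x y ↔ Rel m x y := by
  classical
  let f : Fin (n * n) → Bool := fun i =>
    decide (∃ x y : Fin (2*n), x ≠ y ∧ index x y = i.val ∧ P.1 x y)
  refine ⟨Nat.ofBits f, Nat.ofBits_lt_two_pow f, fun x y => ?_⟩
  by_cases hxy : x = y
  · simp [hxy, Rel]
  · rw [Rel, Nat.testBit_ofBits_lt f _ (hlt x y hxy)]
    simp only [hxy, false_or, f, decide_eq_true_eq]
    refine ⟨fun h => ⟨x, y, hxy, rfl, h⟩, ?_⟩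
    rintro ⟨z, w, hzw, he, h⟩
    rcases hidx z w x y hzw hxy he with ⟨rfl, rfl⟩ | ⟨rfl, rfl⟩ | ⟨rfl, rfl⟩ | ⟨rfl, rfl⟩
    · exact h
    · exact P.symm' h
    · exact P.neg h
    · exact P.neg (P.symm' h)

theorem NCB_supersolvable {n : ℕ} (hlt : ∀ x y : Fin (2*n), x ≠ y → index x y < n * n)
    (hidx : ∀ x y z w : Fin (2*n), x ≠ y → z ≠ w → index x y = index z w →
      (z = x ∧ w = y) ∨ (z = y ∧ w = x) ∨ (z = negB n x ∧ w = negB n y) ∨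
        (z = negB n y ∧ w = negB n x)) {F D : List ℕ} {t : ℕ}
    (hFm : ∀ m < 2 ^ (n * n), IsNCB n m → m ∈ F) (hF' : ∀ m ∈ F, IsNCB n m)
    (hFlt : ∀ m ∈ F, m < 2 ^ (n * n)) (hF : IsLattice F)
    (hsurj : ∀ i < n * n, ∃ x y : Fin (2*n), x ≠ y ∧ index x y = i)
    (hD : IsMChain F D t) : SupersolvablePoset (NCB n) := by
  choose φ hφ hrel using exists_code hlt hidx
  have hbit : ∀ m k, m < 2 ^ (n * n) →
      ((∀ x y : Fin (2*n), Rel m x y → Rel k x y) ↔ m &&& k = m) := by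
    intro m k hm
    constructor
    · intro h
      refine Nat.eq_of_testBit_eq fun i => ?_
      rw [Nat.testBit_land]
      cases hi : m.testBit i
      · rfl
      · have hin : i < n * n := by
          by_contra! hcon
          rw [Nat.testBit_lt_two_pow (hm.trans_le (Nat.pow_le_pow_right two_pos hcon))] at hi
          cases hi
        obtain ⟨x, y, hxy, rfl⟩ := hsurj i hin
        rw [(h x y (Or.inr hi)).resolve_left hxy]
        rfl
    · rintro h x y (rfl | hxy)
      · exact Or.inl rfl
      · rw [← h, Nat.testBit_land, Bool.and_eq_true] at hxy
        exact Or.inr hxy.2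
  have hle : ∀ x y, x ≤ y ↔ φ x &&& φ y = φ x := fun x y => by
    rw [← hbit _ _ (hφ x), NCB.le_def]
    simp only [hrel]
  refine supersolvable (φ := φ) (fun P => hFm _ (hφ P) ?_) (fun m hm => ?_) hle hF hD
  · refine ⟨fun x y h => ?_, fun x h y h' => ?_, fun a b hab c hbc h d hcd h' => ?_⟩ <;>
      simp only [← hrel] at *
    · exact ⟨P.symm' h, P.neg h, fun z h' => P.trans' h h'⟩
    · exact P.2.2.2 x y h h'
    · exact P.2.1 a b c d hab hbc hcd h h'
  · obtain ⟨h1, h2, h3⟩ := hF' m hm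
    let P : NCB n := ⟨⟨Rel m, fun _ => Or.inl rfl, fun h => (h1 _ _ h).1,
      fun h h' => (h1 _ _ h).2.2 _ h'⟩, fun a b c d hab hbc hcd h h' =>
        h3 a b hab c hbc h d hcd h', fun x y h => (h1 x y h).2.1, fun x y h h' => h2 x h y h'⟩
    have hP : ∀ x y, P.1 x y ↔ Rel m x y := fun _ _ => Iff.rfl
    refine ⟨P, ?_⟩
    have e1 := (hbit (φ P) m (hφ P)).1 fun x y h => (hP x y).1 ((hrel P x y).2 h)
    have e2 := (hbit m (φ P) (hFlt m hm)).1 fun x y h => (hrel P x y).1 ((hP x y).2 h)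
    rw [← e1, Nat.land_comm, e2]

theorem supersolvable_NCB_two : SupersolvablePoset (NCB 2) :=
  NCB_supersolvable (F := [0, 1, 2, 4, 8, 15]) (D := [0, 1, 15]) (t := 15)
    (by decide +kernel) (by decide +kernel) (by decide +kernel) (by decide +kernel)
    (by decide +kernel) (by decide +kernel) (by decide +kernel) (by decide +kernel)

theorem supersolvable_NCB_three : SupersolvablePoset (NCB 3) :=
  NCB_supersolvable (F := [0, 1, 2, 4, 8, 16, 32, 64, 128, 256, 80, 136, 257, 21, 26, 41, 195,
      332, 432, 511]) (D := [0, 1, 195, 511]) (t := 511)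
    (by decide +kernel) (by decide +kernel) (by decide +kernel) (by decide +kernel)
    (by decide +kernel) (by decide +kernel) (by decide +kernel) (by decide +kernel)

end Mask

/-- for `n ≥ 2`, the lattice `NCB n` of type `B_n` noncrossing partitions
is supersolvable if and only if `n ≤ 3`. -/
theorem NCB_supersolvable_iff (n : ℕ) (hn : 2 ≤ n) :
    SupersolvablePoset (NCB n) ↔ n ≤ 3 := by
  refine ⟨fun h => ?_, fun h => ?_⟩
  · by_contra! hn'
    exact NCB.not_supersolvable hn' h
  · interval_cases n
    exacts [Mask.supersolvable_NCB_two, Mask.supersolvable_NCB_three]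

end NCPaper
end

section
/- Let D be a maximal chain of NCP_n. Then the following are equivalent: (i) for every maximal chain C of NCP_n there is a sublattice of NCP_n containing both C and D that is order-isomorphic to the Boolean lattice of all subsets of an (n−1)-element set; (ii) D is universal, i.e. every element of D other than the bottom and top is a universal noncrossing partition. -/
namespace NCPaper

/-- The noncrossing partitions of `{1, …, n}`, ordered by refinement. -/
def NCP (n : ℕ) : Type := {P : Setoid (Fin n) // IsNoncrossing P}

instance (n : ℕ) : PartialOrder (NCP n) :=
  Subtype.partialOrder _

/-- A noncrossing partition is universal if it has exactly one block with more than one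
element and the elements of that block are circularly consecutive modulo `n`. -/
def IsUniversalNCP {n : ℕ} (P : NCP n) : Prop :=
  (∃ a b : Fin n, a ≠ b ∧ P.1 a b) ∧
  (∀ a b a' b' : Fin n, a ≠ b → P.1 a b → a' ≠ b' → P.1 a' b' → P.1 a a') ∧
  (∃ (s : Fin n) (m : ℕ), ∀ x : Fin n,
     ((∃ y, y ≠ x ∧ P.1 x y) ↔ ∃ i < m, x.val = (s.val + i) % n))

/-- The endpoint reached from `v` by passing to parents as long as the vertex lies in `S` and
its parent is strictly earlier. -/
noncomputable def rootMap {V : Type*} (f : V → ℕ) (p : V → V) (S : Set V) (v : V) : V :=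
  open Classical in if v ∈ S ∧ f (p v) < f v then rootMap f p S (p v) else v
termination_by f v
decreasing_by simp_all

/-- The partition into the trees of the forest with edges joining `v` to `p v` for `v ∈ S`. -/
noncomputable def forest {V : Type*} (f : V → ℕ) (p : V → V) (S : Set V) : Setoid V :=
  Setoid.ker (rootMap f p S)

section Forest

variable {V : Type*} {f : V → ℕ} {p : V → V} {S T : Set V}

theorem rootMap_of_mem {v : V} (hv : v ∈ S) (h : f (p v) < f v) :
    rootMap f p S v = rootMap f p S (p v) := by
  rw [rootMap, if_pos ⟨hv, h⟩]

theorem rootMap_of_notMem {v : V} (hv : v ∉ S) : rootMap f p S v = v := by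
  rw [rootMap, if_neg (fun h => hv h.1)]

theorem forest_apply {u v : V} :
    forest f p S u v ↔ rootMap f p S u = rootMap f p S v := Iff.rfl

theorem rootMap_induction (hS : ∀ v ∈ S, f (p v) < f v) {motive : V → Prop}
    (base : ∀ v, v ∉ S → motive v) (step : ∀ v, v ∈ S → motive (p v) → motive v) (v : V) :
    motive v := by
  induction h : f v using Nat.strong_induction_on generalizing v with
  | _ k ih =>
    by_cases hv : v ∈ S
    · exact step v hv (ih _ (h ▸ hS v hv) _ rfl)
    · exact base v hv

theorem apply_rootMap_le (hS : ∀ v ∈ S, f (p v) < f v) (v : V) :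
    f (rootMap f p S v) ≤ f v := by
  induction v using rootMap_induction hS with
  | base v hv => rw [rootMap_of_notMem hv]
  | step v hv ih => rw [rootMap_of_mem hv (hS v hv)]; exact ih.trans (hS v hv).le

theorem rootMap_notMem (hS : ∀ v ∈ S, f (p v) < f v) (v : V) : rootMap f p S v ∉ S := by
  induction v using rootMap_induction hS with
  | base v hv => rwa [rootMap_of_notMem hv]
  | step v hv ih => rwa [rootMap_of_mem hv (hS v hv)]

theorem forest_rootMap (hS : ∀ v ∈ S, f (p v) < f v) (v : V) :
    forest f p S v (rootMap f p S v) :=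
  (rootMap_of_notMem (rootMap_notMem hS v)).symm

theorem forest_parent (hS : ∀ v ∈ S, f (p v) < f v) {v : V} (hv : v ∈ S) :
    forest f p S v (p v) :=
  rootMap_of_mem hv (hS v hv)

theorem rel_rootMap (hS : ∀ v ∈ S, f (p v) < f v) {Q : Setoid V}
    (hQ : ∀ v ∈ S, Q v (p v)) (v : V) : Q v (rootMap f p S v) := by
  induction v using rootMap_induction hS with
  | base v hv => rw [rootMap_of_notMem hv]
  | step v hv ih => rw [rootMap_of_mem hv (hS v hv)]; exact Q.trans (hQ v hv) ih

theorem forest_le (hS : ∀ v ∈ S, f (p v) < f v) {Q : Setoid V}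
    (hQ : ∀ v ∈ S, Q v (p v)) : forest f p S ≤ Q := fun {u v} h =>
  Q.trans (rel_rootMap hS hQ u)
    (by rw [forest_apply.1 h]; exact Q.symm (rel_rootMap hS hQ v))

theorem forest_le_forest (hS : ∀ v ∈ S, f (p v) < f v) (hT : ∀ v ∈ T, f (p v) < f v) :
    forest f p S ≤ forest f p T ↔ S ⊆ T := by
  refine ⟨fun h v hv => ?_, fun h => forest_le hS fun v hv => forest_parent hT (h hv)⟩
  by_contra hvT
  have h1 : rootMap f p T v = rootMap f p T (p v) := h (forest_parent hS hv)
  rw [rootMap_of_notMem hvT] at h1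
  have h2 := apply_rootMap_le hT (p v)
  have h3 := hS v hv
  rw [← h1] at h2
  omega

theorem forest_inf_le (hf : Function.Injective f) (hS : ∀ v ∈ S, f (p v) < f v)
    (hT : ∀ v ∈ T, f (p v) < f v) :
    forest f p S ⊓ forest f p T ≤ forest f p (S ∩ T) := by
  have main : ∀ k u v, f u + f v = k → forest f p S u v → forest f p T u v → f v < f u →
      forest f p (S ∩ T) u v := by
    intro k
    induction k using Nat.strong_induction_on with
    | _ k ih =>
      intro u v hk h1 h2 huv
      have key : ∀ R : Set V, (∀ v ∈ R, f (p v) < f v) → forest f p R u v → u ∈ R := by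
        intro R hR h
        by_contra hu
        have h3 := apply_rootMap_le hR v
        rw [← forest_apply.1 h, rootMap_of_notMem hu] at h3
        omega
      have huS := key S hS h1
      have huT := key T hT h2
      have hlt := hS u huS
      have e : forest f p (S ∩ T) u (p u) := rootMap_of_mem ⟨huS, huT⟩ hlt
      refine Setoid.trans' _ e ?_
      have h1' := Setoid.trans' _ (Setoid.symm' _ (forest_parent hS huS)) h1
      have h2' := Setoid.trans' _ (Setoid.symm' _ (forest_parent hT huT)) h2
      rcases lt_trichotomy (f (p u)) (f v) with h | h | h
      · exact Setoid.symm' _ (ih _ (by omega) v (p u) rfl (Setoid.symm' _ h1')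
          (Setoid.symm' _ h2') h)
      · rw [hf h]
      · exact ih _ (by omega) (p u) v rfl h1' h2' h
  rintro u v ⟨h1, h2⟩
  rcases lt_trichotomy (f u) (f v) with h | h | h
  · exact Setoid.symm' _ (main _ v u rfl (Setoid.symm' _ h1) (Setoid.symm' _ h2) h)
  · rw [hf h]
  · exact main _ u v rfl h1 h2 h

end Forest

/-- The chord `c d` crosses the chord `a b` (on a linearly ordered set drawn on a circle). -/
def Cross {V : Type*} [LinearOrder V] (a b c d : V) : Prop :=
  c ≠ a ∧ c ≠ b ∧ d ≠ a ∧ d ≠ b ∧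
    ¬ ((a < c ∧ c < b ∨ b < c ∧ c < a) ↔ (a < d ∧ d < b ∨ b < d ∧ d < a))

theorem Cross.symm {V : Type*} [LinearOrder V] {a b c d : V} (h : Cross a b c d) :
    Cross c d a b := by
  unfold Cross at *; grind

theorem Cross.swap_left {V : Type*} [LinearOrder V] {a b c d : V} (h : Cross a b c d) :
    Cross b a c d := by
  unfold Cross at *; grind

theorem IsNoncrossing.rel_of_cross {n : ℕ} {P : Setoid (Fin n)} (hP : IsNoncrossing P)
    {a b c d : Fin n} (hab : P a b) (hcd : P c d) (h : Cross a b c d) : P a c := by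
  have hba := P.symm hab
  have hdc := P.symm hcd
  have key : ∀ w x y z, w < x → x < y → y < z → P w y → P x z → P w x := hP
  have hs : ∀ x y, P x y → P y x := fun x y => P.symm
  have ht : ∀ x y z, P x y → P y z → P x z := fun x y z => P.trans
  unfold Cross at h
  grind

theorem isNoncrossing_of_cross {n : ℕ} {P : Setoid (Fin n)}
    (h : ∀ a b c d, P a b → P c d → ¬ P a c → ¬ Cross a b c d) : IsNoncrossing P := by
  intro a b c d hab hbc hcd hac hbd
  by_contra hn
  refine h a c b d hac hbd hn ?_
  unfold Cross
  grind

theorem forest_isNoncrossing {n : ℕ} {f : Fin n → ℕ} {p : Fin n → Fin n} {S : Set (Fin n)}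
    (hS : ∀ v ∈ S, f (p v) < f v)
    (hc : ∀ v ∈ S, ∀ w ∈ S, ¬ Cross v (p v) w (p w)) : IsNoncrossing (forest f p S) := by
  have trans_cross : ∀ {a b x y z : Fin n}, ¬ Cross a b x y → ¬ Cross a b y z →
      y ≠ a → y ≠ b → ¬ Cross a b x z := by
    intro a b x y z h1 h2 hya hyb h
    simp only [Cross, not_and, not_not] at h1 h2
    obtain ⟨hxa, hxb, hza, hzb, h⟩ := h
    exact h ((h1 hxa hxb hya hyb).trans (h2 hya hyb hza hzb))
  have cross_self : ∀ {a b x : Fin n}, ¬ Cross a b x x := by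
    exact fun h => h.2.2.2.2 Iff.rfl
  have rel_ne : ∀ {x y : Fin n}, ¬ forest f p S x y → x ≠ y := by
    rintro x y h rfl; exact h (Setoid.refl' _ x)
  have walk : ∀ a b, forest f p S a b →
      (∀ w ∈ S, ¬ forest f p S a w → ¬ Cross a b w (p w)) →
      ∀ x, ¬ forest f p S a x → ¬ Cross a b x (rootMap f p S x) := by
    intro a b hab hw x
    induction x using rootMap_induction hS with
    | base v hv => rw [rootMap_of_notMem hv]; exact fun _ => cross_self
    | step v hv ih =>
      intro hav
      have e := forest_parent hS hv
      have hap : ¬ forest f p S a (p v) :=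
        fun h => hav (Setoid.trans' _ h (Setoid.symm' _ e))
      rw [rootMap_of_mem hv (hS v hv)]
      exact trans_cross (hw v hv hav) (ih hap) (rel_ne hap).symm
        (rel_ne fun h => hap (Setoid.trans' _ hab (Setoid.symm' _ h)))
  have walk' : ∀ a b, forest f p S a b →
      (∀ w ∈ S, ¬ forest f p S a w → ¬ Cross a b w (p w)) →
      ∀ x y, forest f p S x y → ¬ forest f p S a x → ¬ Cross a b x y := by
    intro a b hab hw x y hxy hax
    have hay : ¬ forest f p S a y := fun h => hax (Setoid.trans' _ h (Setoid.symm' _ hxy))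
    have h1 := walk a b hab hw x hax
    have h2 := walk a b hab hw y hay
    have h3 := Setoid.trans' _ hxy (forest_rootMap hS y)
    have hne : ∀ z, forest f p S x z → z ≠ a ∧ z ≠ b := fun z hz =>
      ⟨by rintro rfl; exact hax (Setoid.symm' _ hz),
       by rintro rfl; exact hax (Setoid.trans' _ hab (Setoid.symm' _ hz))⟩
    rw [forest_apply.1 hxy] at h1
    refine trans_cross h1 (fun h => h2 ?_) (hne _ h3).1 (hne _ h3).2
    obtain ⟨hxa, hxb, hya, hyb, h⟩ := h
    exact ⟨hya, hyb, hxa, hxb, fun h' => h h'.symm⟩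
  refine isNoncrossing_of_cross fun a b c d hab hcd hac => ?_
  refine walk' a b hab (fun w hw haw hcr => ?_) c d hcd hac
  refine walk' w (p w) (forest_parent hS hw) (fun v hv _ => hc w hw v hv) a b hab
    (fun h => haw (Setoid.symm' _ h)) hcr.symm

instance (n : ℕ) : Finite (NCP n) := by
  have : Finite (Setoid (Fin n)) :=
    Finite.of_injective (fun s : Setoid (Fin n) => (s.r : Fin n → Fin n → Prop))
      fun s t h => Setoid.ext fun a b => iff_of_eq (congrFun (congrFun h a) b)
  unfold NCP
  infer_instance

theorem forests_sublattice {n : ℕ} {f : Fin n → ℕ} (hf : Function.Injective f)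
    {p : Fin n → Fin n} {r : Fin n} (hp : ∀ v, v ≠ r → f (p v) < f v)
    (hc : ∀ v, v ≠ r → ∀ w, w ≠ r → ¬ Cross v (p v) w (p w)) :
    ∃ L : Set (NCP n), (∀ Q : NCP n, ∀ S, r ∉ S → Q.1 = forest f p S → Q ∈ L) ∧
      LatClosed L ∧ Nonempty (L ≃o Set (Fin (n - 1))) := by
  have hS : ∀ S : Set {v // v ≠ r}, ∀ v ∈ Subtype.val '' S, f (p v) < f v := by
    rintro S _ ⟨v, -, rfl⟩
    exact hp v v.2
  let F : Set {v // v ≠ r} → NCP n := fun S => ⟨forest f p (Subtype.val '' S),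
    forest_isNoncrossing (hS S) (by
      rintro _ ⟨v, -, rfl⟩ _ ⟨w, -, rfl⟩
      exact hc v v.2 w w.2)⟩
  have hF : ∀ S T, F S ≤ F T ↔ S ≤ T := fun S T =>
    (forest_le_forest (hS S) (hS T)).trans (Set.image_subset_image_iff Subtype.val_injective)
  let e : Set {v // v ≠ r} ↪o NCP n := OrderEmbedding.ofMapLEIff F hF
  have hcard : Nonempty ({v // v ≠ r} ≃ Fin (n - 1)) := by
    refine ⟨Fintype.equivFinOfCardEq ?_⟩
    simp [Fintype.card_subtype_compl]
  obtain ⟨g⟩ := hcard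
  refine ⟨Set.range e, ?_, ⟨?_, ?_⟩, ⟨e.orderIso.symm.trans g.toOrderIsoSet⟩⟩
  · intro Q S hrS hQ
    refine ⟨Subtype.val ⁻¹' S, Subtype.ext ?_⟩
    rw [hQ]
    change forest f p (Subtype.val '' (Subtype.val ⁻¹' S)) = _
    congr 1
    exact Set.image_preimage_eq_of_subset fun v hv => ⟨⟨v, fun h => hrS (h ▸ hv)⟩, rfl⟩
  · rintro _ ⟨S, rfl⟩ _ ⟨T, rfl⟩ z hz
    refine ⟨S ∪ T, IsLUB.unique ⟨?_, ?_⟩ hz⟩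
    · rintro _ (rfl | rfl)
      · exact (hF _ _).2 Set.subset_union_left
      · exact (hF _ _).2 Set.subset_union_right
    · intro w hw
      refine forest_le (hS _) ?_
      have h1 : F S ≤ w := hw (Or.inl rfl)
      have h2 : F T ≤ w := hw (Or.inr rfl)
      rintro _ ⟨v, hv | hv, rfl⟩
      · exact h1 (forest_parent (hS S) ⟨v, hv, rfl⟩)
      · exact h2 (forest_parent (hS T) ⟨v, hv, rfl⟩)
  · rintro _ ⟨S, rfl⟩ _ ⟨T, rfl⟩ z hz
    refine ⟨S ∩ T, IsGLB.unique ⟨?_, ?_⟩ hz⟩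
    · rintro _ (rfl | rfl)
      · exact (hF _ _).2 Set.inter_subset_left
      · exact (hF _ _).2 Set.inter_subset_right
    · intro w hw
      have h1 : w.1 ≤ forest f p (Subtype.val '' S) := hw (Or.inl rfl)
      have h2 : w.1 ≤ forest f p (Subtype.val '' T) := hw (Or.inr rfl)
      have h3 := le_inf h1 h2
      refine h3.trans ((forest_inf_le hf (hS S) (hS T)).trans ?_)
      rw [← Set.image_inter Subtype.val_injective]
      exact le_rfl

/-- If each vertex `w`, and each nonempty set `Z` of earlier vertices, admit a chord from `w` to
`Z` one side of which only meets earlier vertices outside `Z`, then every chain `C` shares a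
Boolean sublattice with the chains growing initial segments of the order. -/
theorem exists_boolean_sublattice_of_order {n : ℕ} {f : Fin n → ℕ}
    (hf : Function.Injective f) {r : Fin n} (hr : ∀ v, v ≠ r → f r < f v)
    (hgeo : ∀ (w : Fin n) (Z : Set (Fin n)), Z.Nonempty → (∀ z ∈ Z, f z < f w) →
      ∃ a ∈ Z, ∀ u v, Cross a w u v → (f u < f w ∧ u ∉ Z) ∨ (f v < f w ∧ v ∉ Z))
    {C : Set (NCP n)} (hC : IsChain (· ≤ ·) C) (htop : ∃ c ∈ C, c.1 = ⊤) {D : Set (NCP n)}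
    (hDr : ∀ d ∈ D, ∀ x y, d.1 x y → x ≠ y → d.1 r x)
    (hDf : ∀ d ∈ D, ∀ v w, f v < f w → d.1 r w → d.1 r v) :
    ∃ L : Set (NCP n), C ∪ D ⊆ L ∧ LatClosed L ∧ Nonempty (L ≃o Set (Fin (n - 1))) := by
  have hex : ∀ w : Fin n, ∃ a : Fin n, ∃ c : NCP n, w ≠ r → c ∈ C ∧ c.1 a w ∧ f a < f w ∧
      (∀ c' ∈ C, (∃ v, c'.1 v w ∧ f v < f w) → c ≤ c') ∧
      ∀ u v, Cross a w u v → (f u < f w ∧ ¬ c.1 u w) ∨ (f v < f w ∧ ¬ c.1 v w) := by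
    intro w
    obtain ⟨t, ht, htt⟩ := htop
    by_cases hw : w = r
    · exact ⟨w, t, fun h => absurd hw h⟩
    obtain ⟨c, ⟨hcC, hcw⟩, hmin⟩ := Set.Finite.exists_minimal
      (Set.toFinite {c | c ∈ C ∧ ∃ v, c.1 v w ∧ f v < f w})
      ⟨t, ht, r, by rw [htt]; trivial, hr w hw⟩
    obtain ⟨a, ha, hcr⟩ := hgeo w {v | c.1 v w ∧ f v < f w} hcw fun z hz => hz.2
    refine ⟨a, c, fun _ => ⟨hcC, ha.1, ha.2, fun c' hc' h' => ?_, fun u v huv => ?_⟩⟩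
    · rcases hC.total hcC hc' with h | h
      · exact h
      · exact hmin ⟨hc', h'⟩ h
    · exact (hcr u v huv).imp (fun h => ⟨h.1, fun h' => h.2 ⟨h', h.1⟩⟩)
        (fun h => ⟨h.1, fun h' => h.2 ⟨h', h.1⟩⟩)
  choose p t ht using hex
  have hp : ∀ v, v ≠ r → f (p v) < f v := fun v hv => (ht v hv).2.2.1
  have hcross : ∀ v, v ≠ r → ∀ w, w ≠ r → t v ≤ t w → ¬ Cross (p w) w v (p v) := by
    intro v hv w hw hle hcr
    have h1 : (t w).1 (p w) w := (ht w hw).2.1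
    have h2 : (t w).1 v (p v) := (t w).1.symm (hle (ht v hv).2.1)
    have h3 : (t w).1 v w :=
      (t w).1.trans ((t w).1.symm ((t w).2.rel_of_cross h1 h2 hcr)) h1
    rcases (ht w hw).2.2.2.2 _ _ hcr with h | h
    · exact h.2 h3
    · exact h.2 ((t w).1.trans ((t w).1.symm h2) h3)
  obtain ⟨L, hL, hLat, hiso⟩ := forests_sublattice hf hp (by
    intro v hv w hw hcr
    rcases hC.total (ht v hv).1 (ht w hw).1 with h | h
    · exact hcross v hv w hw h hcr.symm.swap_left
    · exact hcross w hw v hv h hcr.swap_left)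
  refine ⟨L, Set.union_subset (fun c hc => ?_) (fun d hd => ?_), hLat, hiso⟩
  · set S : Set (Fin n) := {w | ∃ v, c.1 v w ∧ f v < f w}
    have hrS : r ∉ S := by
      rintro ⟨v, -, hv⟩
      have := hr v (by rintro rfl; exact lt_irrefl _ hv)
      omega
    have hS : ∀ v ∈ S, f (p v) < f v := fun v hv => hp v fun h => hrS (h ▸ hv)
    have hcS : ∀ w ∈ S, c.1 w (p w) := fun w hw => by
      have h := ht w fun h => hrS (h ▸ hw)
      exact c.1.symm (h.2.2.2.1 c hc hw h.2.1)
    refine hL c S hrS (le_antisymm (fun {u v} huv => ?_) (forest_le hS hcS))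
    have h : c.1 (rootMap f p S u) (rootMap f p S v) :=
      c.1.trans (c.1.symm (rel_rootMap hS hcS u)) (c.1.trans huv (rel_rootMap hS hcS v))
    refine forest_apply.2 (hf (le_antisymm ?_ ?_))
    · exact not_lt.1 fun hlt => rootMap_notMem hS u ⟨_, c.1.symm h, hlt⟩
    · exact not_lt.1 fun hlt => rootMap_notMem hS v ⟨_, h, hlt⟩
  · set S : Set (Fin n) := {w | w ≠ r ∧ d.1 r w}
    have hrS : r ∉ S := fun h => h.1 rfl
    have hS : ∀ v ∈ S, f (p v) < f v := fun v hv => hp v hv.1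
    have hdS : ∀ w ∈ S, d.1 w (p w) := fun w hw =>
      d.1.trans (d.1.symm hw.2) (hDf d hd _ _ (hS w hw) hw.2)
    refine hL d S hrS (le_antisymm (fun {u v} huv => ?_) (forest_le hS hdS))
    have hroot : ∀ x, d.1 r x → rootMap f p S x = r := fun x hx => by
      by_contra h
      exact rootMap_notMem hS x ⟨h, d.1.trans hx (rel_rootMap hS hdS x)⟩
    by_cases h : u = v
    · rw [h]
    · rw [forest_apply, hroot u (hDr d hd u v huv h),
        hroot v (hDr d hd v u (d.1.symm huv) (Ne.symm h))]

/-- A set of circularly consecutive elements modulo `n`. -/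
def IsArc {n : ℕ} (X : Set (Fin n)) : Prop :=
  ∃ (s : Fin n) (m : ℕ), ∀ x : Fin n, x ∈ X ↔ ∃ i < m, x.val = (s.val + i) % n

/-- The clockwise distance from `v` to `w`. -/
def cwDist {n : ℕ} (v w : Fin n) : ℕ := if v ≤ w then w.val - v.val else w.val + n - v.val

theorem IsArc.exists_iff {n : ℕ} {X : Set (Fin n)} (hX : IsArc X) :
    ∃ (s : Fin n) (m : ℕ), ∀ x : Fin n, x ∈ X ↔ cwDist s x < m := by
  obtain ⟨s, m, h⟩ := hX
  refine ⟨s, m, fun x => (h x).trans ⟨?_, fun hlt => ⟨cwDist s x, hlt, ?_⟩⟩⟩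
  · rintro ⟨i, him, hi⟩
    refine lt_of_le_of_lt ?_ him
    have hs := s.2
    have hmod := Nat.div_add_mod (s.val + i) n
    rw [← hi] at hmod
    unfold cwDist
    rcases Nat.eq_zero_or_pos ((s.val + i) / n) with h0 | h0
    · rw [h0] at hmod
      split_ifs with hle <;> rw [Fin.le_def] at hle <;> omega
    · have : n ≤ n * ((s.val + i) / n) := Nat.le_mul_of_pos_right n h0
      split_ifs with hle <;> omega
  · have hs := s.2
    have hx := x.2
    unfold cwDist
    split_ifs with hle <;> rw [Fin.le_def] at hle
    · rw [Nat.add_sub_cancel' hle, Nat.mod_eq_of_lt hx]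
    · rw [show s.val + (x.val + n - s.val) = x.val + n by omega, Nat.add_mod_right,
        Nat.mod_eq_of_lt hx]

theorem exists_cwDist_eq {n : ℕ} (s : Fin n) {k : ℕ} (hk : k < n) :
    ∃ x : Fin n, cwDist s x = k := by
  have hs := s.2
  by_cases h : s.val + k < n
  · refine ⟨⟨s.val + k, h⟩, ?_⟩
    unfold cwDist
    split_ifs with hle <;> simp only [Fin.le_def] at * <;> omega
  · refine ⟨⟨s.val + k - n, by omega⟩, ?_⟩
    unfold cwDist
    split_ifs with hle <;> simp only [Fin.le_def] at * <;> omega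

theorem IsArc.exists_adjacent {n : ℕ} {X : Set (Fin n)} {w a : Fin n} (hw : w ∉ X)
    (ha : a ∈ X) (hX : IsArc (insert w X)) :
    ∃ x ∈ X, cwDist w x = 1 ∨ cwDist x w = 1 := by
  obtain ⟨s, m, h⟩ := hX.exists_iff
  have hwa : w ≠ a := fun e => hw (e ▸ ha)
  have h1 := (h w).1 (Or.inl rfl)
  have h2 := (h a).1 (Or.inr ha)
  have hs := s.2
  have hw2 := w.2
  have ha2 := a.2
  rw [Ne, Fin.ext_iff] at hwa
  by_cases hlt : cwDist s w < cwDist s a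
  · have hlt' : cwDist s a < n := by
      unfold cwDist; split_ifs with hle <;> rw [Fin.le_def] at hle <;> omega
    obtain ⟨x, hx⟩ := exists_cwDist_eq s (k := cwDist s w + 1) (by omega)
    have hx2 := x.2
    have hxX := (h x).2 (by omega)
    have hxw : cwDist w x = 1 := by
      unfold cwDist at *; simp only [Fin.le_def] at *; split_ifs at * <;> omega
    refine ⟨x, hxX.resolve_left ?_, Or.inl hxw⟩
    rintro rfl
    simp [cwDist] at hxw
  · have hgt : cwDist s a < cwDist s w := by
      unfold cwDist at *; simp only [Fin.le_def] at *; split_ifs at * <;> omega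
    have hlt' : cwDist s w < n := by
      unfold cwDist; split_ifs with hle <;> rw [Fin.le_def] at hle <;> omega
    obtain ⟨x, hx⟩ := exists_cwDist_eq s (k := cwDist s w - 1) (by omega)
    have hx2 := x.2
    have hxX := (h x).2 (by omega)
    have hxw : cwDist x w = 1 := by
      unfold cwDist at *; simp only [Fin.le_def] at *; split_ifs at * <;> omega
    refine ⟨x, hxX.resolve_left ?_, Or.inr hxw⟩
    rintro rfl
    simp [cwDist] at hxw

theorem IsArc.mem_of_cwDist_lt {n : ℕ} {X : Set (Fin n)} {w a x u : Fin n} (hX : IsArc X)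
    (hw : w ∉ X) (hx : x ∈ X) (ha : a ∈ X) :
    (cwDist w x = 1 → u ≠ w → cwDist w u < cwDist w a → u ∈ X) ∧
    (cwDist x w = 1 → u ≠ w → cwDist u w < cwDist a w → u ∈ X) := by
  obtain ⟨s, m, h⟩ := hX.exists_iff
  rw [h] at hw hx ha ⊢
  have hs := s.2
  have hw2 := w.2
  have ha2 := a.2
  have hx2 := x.2
  have hu2 := u.2
  rw [Ne, Fin.ext_iff]
  unfold cwDist at *
  simp only [Fin.le_def] at *
  constructor <;> intro h1 h2 h3 <;> split_ifs at * <;> omega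

theorem IsArc.exists_chord {n : ℕ} {X : Set (Fin n)} {w : Fin n} (hX : IsArc X) (hw : w ∉ X)
    (hXw : IsArc (insert w X)) {Z : Set (Fin n)} (hZ : Z.Nonempty) (hZX : Z ⊆ X) :
    ∃ a ∈ Z, ∀ u v, Cross a w u v → (u ∈ X ∧ u ∉ Z) ∨ (v ∈ X ∧ v ∉ Z) := by
  obtain ⟨z, hz⟩ := hZ
  obtain ⟨x, hx, h1⟩ := hXw.exists_adjacent hw (hZX hz)
  have aux : ∀ g : Fin n → ℕ,
      (∀ a ∈ X, ∀ u, u ≠ w → g u < g a → u ∈ X) →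
      (∀ a u v, Cross a w u v → g u < g a ∨ g v < g a) →
      ∃ a ∈ Z, ∀ u v, Cross a w u v → (u ∈ X ∧ u ∉ Z) ∨ (v ∈ X ∧ v ∉ Z) := by
    intro g hg hcr
    obtain ⟨a, ha, hmin⟩ := Set.exists_min_image Z g (Set.toFinite Z) ⟨z, hz⟩
    refine ⟨a, ha, fun u v huv => (hcr a u v huv).imp (fun h => ?_) (fun h => ?_)⟩
    · exact ⟨hg a (hZX ha) u huv.2.1 h, fun h' => absurd (hmin u h') (by omega)⟩
    · exact ⟨hg a (hZX ha) v huv.2.2.2.1 h, fun h' => absurd (hmin v h') (by omega)⟩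
  rcases h1 with h1 | h1
  · refine aux (cwDist w) (fun a ha u => (hX.mem_of_cwDist_lt hw hx ha).1 h1) ?_
    intro a u v huv
    have := a.2
    have := u.2
    have := v.2
    have := w.2
    unfold Cross at huv
    unfold cwDist
    simp only [Fin.le_def, Fin.lt_def, Ne, Fin.ext_iff] at *
    split_ifs <;> omega
  · refine aux (cwDist · w) (fun a ha u => (hX.mem_of_cwDist_lt hw hx ha).2 h1) ?_
    intro a u v huv
    have := a.2
    have := u.2
    have := v.2
    have := w.2
    unfold Cross at huv
    unfold cwDist
    simp only [Fin.le_def, Fin.lt_def, Ne, Fin.ext_iff] at *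
    split_ifs <;> omega

theorem isNoncrossing_bot (n : ℕ) : IsNoncrossing (⊥ : Setoid (Fin n)) :=
  fun _ _ _ _ hab hbc _ hac _ => absurd hac (hab.trans hbc).ne

theorem isNoncrossing_top (n : ℕ) : IsNoncrossing (⊤ : Setoid (Fin n)) :=
  fun _ _ _ _ _ _ _ _ _ => trivial

theorem mem_of_comparable {α : Type*} [PartialOrder α] {D : Set α}
    (hD : IsMaxChain (· ≤ ·) D) {x : α} (hx : ∀ y ∈ D, x ≤ y ∨ y ≤ x) : x ∈ D := by
  rw [hD.2 (hD.1.insert fun y hy _ => hx y hy) (Set.subset_insert x D)]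
  exact Set.mem_insert x D

theorem bot_mem_of_isMaxChain {n : ℕ} {D : Set (NCP n)} (hD : IsMaxChain (· ≤ ·) D) :
    (⟨⊥, isNoncrossing_bot n⟩ : NCP n) ∈ D :=
  mem_of_comparable hD fun y _ => Or.inl (bot_le : ⊥ ≤ y.1)

theorem top_mem_of_isMaxChain {n : ℕ} {D : Set (NCP n)} (hD : IsMaxChain (· ≤ ·) D) :
    (⟨⊤, isNoncrossing_top n⟩ : NCP n) ∈ D :=
  mem_of_comparable hD fun y _ => Or.inr (le_top : y.1 ≤ ⊤)

/-- The noncrossing partition all of whose blocks except possibly `Y` are singletons. -/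
def oneBlock {n : ℕ} (Y : Set (Fin n)) : NCP n :=
  ⟨{ r := fun x y => x = y ∨ (x ∈ Y ∧ y ∈ Y)
     iseqv := ⟨fun _ => Or.inl rfl, by grind, by grind⟩ }, by
    rintro a b c d hab hbc hcd (hac | hac) (hbd | hbd)
    · exact absurd hac (hab.trans hbc).ne
    · exact absurd hac (hab.trans hbc).ne
    · exact absurd hbd (hbc.trans hcd).ne
    · exact Or.inr ⟨hac.1, hbd.1⟩⟩

section Order

variable {n : ℕ} {D : Set (NCP n)} {r : Fin n}

/-- The number of members of the chain `D` whose block of `r` does not contain `v`. -/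
noncomputable def birth (D : Set (NCP n)) (r v : Fin n) : ℕ :=
  {d : NCP n | d ∈ D ∧ ¬ d.1 r v}.ncard

theorem birth_lt_birth (hD : IsChain (· ≤ ·) D) {v w : Fin n} :
    birth D r v < birth D r w ↔ ∃ d ∈ D, d.1 r v ∧ ¬ d.1 r w := by
  constructor
  · intro h
    by_contra! hn
    refine absurd h (not_lt.2 (Set.ncard_le_ncard (fun d hd => ⟨hd.1, fun hv => ?_⟩)
      (Set.toFinite _)))
    exact hd.2 (hn d hd.1 hv)
  · rintro ⟨d, hd, hv, hw⟩
    refine Set.ncard_lt_ncard ⟨fun e he => ⟨he.1, fun hew => ?_⟩, fun hs => ?_⟩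
      (Set.toFinite _)
    · rcases hD.total hd he.1 with h | h
      · exact he.2 (h hv)
      · exact hw (h hew)
    · exact (hs (show d ∈ _ from ⟨hd, hw⟩)).2 hv

theorem exists_initial_segments (hD : IsMaxChain (· ≤ ·) D)
    (hDr : ∀ d ∈ D, ∀ x y, d.1 x y → x ≠ y → d.1 r x) {w : Fin n} (hw : w ≠ r) :
    ∃ d ∈ D, ∃ e ∈ D, {v | birth D r v < birth D r w} = {v | d.1 r v} ∧
      {v | e.1 r v} = insert w {v | d.1 r v} := by
  obtain ⟨d, ⟨hd, hdw⟩, hmax⟩ := Set.Finite.exists_maximal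
    (Set.toFinite {d : NCP n | d ∈ D ∧ ¬ d.1 r w})
    ⟨_, bot_mem_of_isMaxChain hD, fun h : r = w => hw h.symm⟩
  have hmax' : ∀ e ∈ D, ¬ e.1 r w → e ≤ d := fun e he hew =>
    (hD.1.total he hd).elim id fun h => hmax ⟨he, hew⟩ h
  have hle : ∀ e ∈ D, e.1 r w → d ≤ e := fun e he hew =>
    (hD.1.total hd he).elim id fun h => absurd (h hew) hdw
  refine ⟨d, hd, oneBlock (insert w {v | d.1 r v}), ?_, ?_, ?_⟩
  · refine mem_of_comparable hD fun e he => ?_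
    by_cases hew : e.1 r w
    · have hall : ∀ x ∈ insert w {v | d.1 r v}, e.1 r x := by
        rintro x (rfl | hx)
        · exact hew
        · exact hle e he hew hx
      left
      rintro x y (rfl | ⟨hx, hy⟩)
      · exact e.1.refl x
      · exact e.1.trans (e.1.symm (hall x hx)) (hall y hy)
    · right
      refine (hmax' e he hew).trans fun {x y} hxy => ?_
      by_cases h : x = y
      · exact Or.inl h
      · exact Or.inr ⟨Or.inr (hDr d hd x y hxy h),
          Or.inr (hDr d hd y x (d.1.symm hxy) (Ne.symm h))⟩
  · ext v
    simp only [Set.mem_ofPred_eq, birth_lt_birth hD.1]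
    exact ⟨fun ⟨e, he, hv, hew⟩ => hmax' e he hew hv, fun hv => ⟨d, hd, hv, hdw⟩⟩
  · ext v
    refine ⟨?_, fun hv => Or.inr ⟨Or.inr (d.1.refl r), hv⟩⟩
    rintro (rfl | h)
    · exact Or.inr (d.1.refl r)
    · exact h.2

theorem birth_root_lt (hD : IsMaxChain (· ≤ ·) D) {v : Fin n} (hv : v ≠ r) :
    birth D r r < birth D r v :=
  (birth_lt_birth hD.1).2
    ⟨_, bot_mem_of_isMaxChain hD, rfl, fun h : r = v => hv h.symm⟩

theorem birth_injective (hD : IsMaxChain (· ≤ ·) D)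
    (hDr : ∀ d ∈ D, ∀ x y, d.1 x y → x ≠ y → d.1 r x) :
    Function.Injective (birth D r) := by
  intro u v huv
  by_contra hne
  by_cases hu : u = r
  · subst hu
    exact (birth_root_lt hD (Ne.symm hne)).ne huv
  obtain ⟨d, hd, e, he, h1, h2⟩ := exists_initial_segments hD hDr hu
  have hv : v ∉ {v | e.1 r v} := by
    rw [h2, ← h1]
    rintro (h | h)
    · exact hne h.symm
    · exact absurd huv.symm (ne_of_lt h)
  have hu' : u ∈ {v | e.1 r v} := h2 ▸ Set.mem_insert u _
  exact absurd huv (ne_of_lt ((birth_lt_birth hD.1).2 ⟨e, he, hu', hv⟩))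

theorem exists_boolean_sublattice_of_arcs (hD : IsMaxChain (· ≤ ·) D)
    (hDr : ∀ d ∈ D, ∀ x y, d.1 x y → x ≠ y → d.1 r x)
    (harc : ∀ d ∈ D, IsArc {v | d.1 r v}) {C : Set (NCP n)} (hC : IsMaxChain (· ≤ ·) C) :
    ∃ L : Set (NCP n), C ∪ D ⊆ L ∧ LatClosed L ∧ Nonempty (L ≃o Set (Fin (n - 1))) := by
  refine exists_boolean_sublattice_of_order (birth_injective hD hDr)
    (fun v => birth_root_lt hD) ?_ hC.1 ⟨_, top_mem_of_isMaxChain hC, rfl⟩ hDr ?_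
  · intro w Z hZ hZw
    have hw : w ≠ r := by
      rintro rfl
      obtain ⟨z, hz⟩ := hZ
      have h := hZw z hz
      by_cases hzw : z = w
      · exact lt_irrefl _ (hzw ▸ h)
      · exact lt_asymm h (birth_root_lt hD hzw)
    obtain ⟨d, hd, e, he, h1, h2⟩ := exists_initial_segments hD hDr hw
    have h3 := harc d hd
    have h4 := harc e he
    rw [h2] at h4
    rw [← h1] at h3 h4
    exact h3.exists_chord (by simp) h4 hZ hZw
  · intro d hd v w hvw hdw
    obtain ⟨e, he, hv, hw⟩ := (birth_lt_birth hD.1).1 hvw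
    rcases hD.1.total hd he with h | h
    · exact absurd (h hdw) hw
    · exact h hv

theorem exists_boolean_sublattice_of_universal (hD : IsMaxChain (· ≤ ·) D)
    (hU : ∀ P ∈ D, P.1 ≠ ⊥ → P.1 ≠ ⊤ → IsUniversalNCP P) {C : Set (NCP n)}
    (hC : IsMaxChain (· ≤ ·) C) :
    ∃ L : Set (NCP n), C ∪ D ⊆ L ∧ LatClosed L ∧ Nonempty (L ≃o Set (Fin (n - 1))) := by
  rcases Nat.eq_zero_or_pos n with rfl | hn
  · have hsub : Subsingleton (NCP 0) := ⟨fun P Q => Subtype.ext (Setoid.ext fun a => a.elim0)⟩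
    have hL : Unique (Set.univ : Set (NCP 0)) :=
      ⟨⟨⟨⟨⊥, isNoncrossing_bot 0⟩, trivial⟩⟩, fun _ => Subsingleton.elim _ _⟩
    exact ⟨Set.univ, Set.subset_univ _, ⟨fun _ _ _ _ _ _ => trivial, fun _ _ _ _ _ _ => trivial⟩,
      ⟨OrderIso.ofUnique _ (Set (Fin 0))⟩⟩
  have hr : ∃ r : Fin n, ∀ d ∈ D, d.1 ≠ ⊥ → ∃ y, y ≠ r ∧ d.1 r y := by
    by_cases hex : ∃ d ∈ D, d.1 ≠ ⊥
    · obtain ⟨d, ⟨hd, hdb⟩, hmin⟩ := Set.Finite.exists_minimal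
        (Set.toFinite {d : NCP n | d ∈ D ∧ d.1 ≠ ⊥}) hex
      have : ∃ a b, d.1 a b ∧ a ≠ b := by
        by_contra! h
        exact hdb (le_bot_iff.1 fun {a b} hab => h a b hab)
      obtain ⟨a, b, hab, hne⟩ := this
      refine ⟨a, fun e he heb => ⟨b, hne.symm, ?_⟩⟩
      rcases hD.1.total hd he with h | h
      · exact h hab
      · exact hmin ⟨he, heb⟩ h hab
    · push Not at hex
      exact ⟨⟨0, hn⟩, fun d hd h => absurd (hex d hd) h⟩
  obtain ⟨r, hr⟩ := hr
  refine exists_boolean_sublattice_of_arcs (r := r) hD ?_ ?_ hC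
  · intro d hd x y hxy hne
    by_cases hb : d.1 = ⊥
    · rw [hb] at hxy
      exact absurd hxy hne
    by_cases ht : d.1 = ⊤
    · rw [ht]; trivial
    obtain ⟨z, hz, hrz⟩ := hr d hd hb
    exact (hU d hd hb ht).2.1 r z x y hz.symm hrz hne hxy
  · intro d hd
    by_cases hb : d.1 = ⊥
    · refine ⟨r, 1, fun x => ?_⟩
      rw [Set.mem_ofPred_eq, hb]
      simp only [Nat.lt_one_iff, exists_eq_left, add_zero, Nat.mod_eq_of_lt r.2]
      rw [← Fin.ext_iff]
      exact eq_comm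
    by_cases ht : d.1 = ⊤
    · refine ⟨⟨0, hn⟩, n, fun x => ?_⟩
      rw [Set.mem_ofPred_eq, ht]
      exact iff_of_true trivial ⟨x, x.2, by simp [Nat.mod_eq_of_lt x.2]⟩
    obtain ⟨z, hz, hrz⟩ := hr d hd hb
    obtain ⟨-, huniq, s, m, hsm⟩ := hU d hd hb ht
    refine ⟨s, m, fun x => Iff.trans ⟨fun hx => ?_, fun ⟨y, hy, hxy⟩ => ?_⟩ (hsm x)⟩
    · by_cases h : x = r
      · exact ⟨z, h ▸ hz, h ▸ hrz⟩
      · exact ⟨r, Ne.symm h, d.1.symm hx⟩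
    · exact huniq r z x y hz.symm hrz hy.symm hxy

end Order

section Rank

variable {n : ℕ}

/-- The rank `n - #blocks` of a partition, counted as the number of elements that are not the
smallest in their block. -/
noncomputable def blockRank (P : Setoid (Fin n)) : ℕ := {x : Fin n | ∃ y < x, P y x}.ncard

theorem exists_block_min (P : Setoid (Fin n)) (x : Fin n) : ∃ m, P x m ∧ ∀ y, P x y → m ≤ y := by
  obtain ⟨m, hm, hmin⟩ := Set.exists_min_image {y | P x y} id (Set.toFinite _) ⟨x, P.refl x⟩
  exact ⟨m, hm, hmin⟩

theorem blockRank_strictMono : StrictMono (blockRank : Setoid (Fin n) → ℕ) := by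
  intro P Q h
  refine Set.ncard_lt_ncard ⟨fun x ⟨y, hy, hxy⟩ => ⟨y, hy, h.le hxy⟩, fun hs => ?_⟩
    (Set.toFinite _)
  refine h.not_ge fun {x y} hxy => ?_
  obtain ⟨a, hxa, ha⟩ := exists_block_min P x
  obtain ⟨b, hyb, hb⟩ := exists_block_min P y
  have hab : Q a b := Q.trans (Q.symm (h.le hxa)) (Q.trans hxy (h.le hyb))
  rcases lt_trichotomy a b with hlt | rfl | hlt
  · obtain ⟨c, hc, hcb⟩ := hs ⟨a, hlt, hab⟩
    exact absurd (hb c (P.trans hyb (P.symm hcb))) (not_le.2 hc)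
  · exact P.trans hxa (P.symm hyb)
  · obtain ⟨c, hc, hca⟩ := hs ⟨b, hlt, Q.symm hab⟩
    exact absurd (ha c (P.trans hxa (P.symm hca))) (not_le.2 hc)

theorem blockRank_le (P : Setoid (Fin n)) : blockRank P ≤ n - 1 := by
  rcases Nat.eq_zero_or_pos n with rfl | hn
  · exact (Set.ncard_le_card _).trans (by simp)
  · have h : blockRank P < (Set.univ : Set (Fin n)).ncard := by
      refine Set.ncard_lt_ncard ⟨Set.subset_univ _, fun h => ?_⟩ (Set.toFinite _)
      obtain ⟨y, hy, -⟩ := h (Set.mem_univ (⟨0, hn⟩ : Fin n))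
      exact absurd (Fin.lt_def.1 hy) (Nat.not_lt_zero _)
    simp only [Set.ncard_univ, Nat.card_eq_fintype_card, Fintype.card_fin] at h
    omega

theorem blockRank_bot : blockRank (⊥ : Setoid (Fin n)) = 0 := by
  rw [blockRank, Set.ncard_eq_zero]
  exact Set.eq_empty_of_forall_notMem fun x ⟨y, hy, hxy⟩ => hy.ne hxy

/-- The partition obtained from `P` by merging the blocks of `a` and `b`. -/
def merge (P : Setoid (Fin n)) (a b : Fin n) : Setoid (Fin n) where
  r x y := P x y ∨ ((P a x ∨ P b x) ∧ (P a y ∨ P b y))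
  iseqv :=
    ⟨fun x => Or.inl (P.refl x),
     fun h => h.imp P.symm And.symm,
     by
      have hs : ∀ x y, P x y → P y x := fun x y => P.symm
      have ht : ∀ x y z, P x y → P y z → P x z := fun x y z => P.trans
      grind⟩

theorem merge_apply {P : Setoid (Fin n)} {a b x y : Fin n} :
    merge P a b x y ↔ P x y ∨ ((P a x ∨ P b x) ∧ (P a y ∨ P b y)) := Iff.rfl

theorem merge_rel (P : Setoid (Fin n)) (a b : Fin n) : merge P a b a b :=
  Or.inr ⟨Or.inl (P.refl a), Or.inr (P.refl b)⟩

theorem le_merge (P : Setoid (Fin n)) (a b : Fin n) : P ≤ merge P a b := fun {_ _} => Or.inl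

theorem lt_merge {P : Setoid (Fin n)} {a b : Fin n} (h : ¬ P a b) : P < merge P a b :=
  lt_of_le_not_ge (le_merge P a b) fun h' => h (h' (merge_rel P a b))

theorem merge_le {P Q : Setoid (Fin n)} {a b : Fin n} (h : P ≤ Q) (hab : Q a b) :
    merge P a b ≤ Q := by
  have key : ∀ x, P a x ∨ P b x → Q a x := fun x hx =>
    hx.elim (fun h' => h h') fun h' => Q.trans hab (h h')
  rintro x y (hxy | ⟨hx, hy⟩)
  · exact h hxy
  · exact Q.trans (Q.symm (key x hx)) (key y hy)

theorem blockRank_merge_le (P : Setoid (Fin n)) (a b : Fin n) :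
    blockRank (merge P a b) ≤ blockRank P + 1 := by
  have hone : ({x : Fin n | ∃ y < x, merge P a b y x} \ {x | ∃ y < x, P y x}).ncard ≤ 1 := by
    rw [Set.ncard_le_one_iff]
    have hs : ∀ x y, P x y → P y x := fun x y => P.symm
    have ht : ∀ x y z, P x y → P y z → P x z := fun x y z => P.trans
    have main : ∀ x y : Fin n, x < y → (∃ z < x, merge P a b z x) → (¬ ∃ z < x, P z x) →
        (∃ z < y, merge P a b z y) → (¬ ∃ z < y, P z y) → False := by
      rintro x y hxy ⟨z, hz, hzx⟩ hx ⟨w, hw, hwy⟩ hy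
      push Not at hx hy
      have h1 := hx z hz
      have h2 := hy w hw
      have h3 := hy x hxy
      have h4 := hy z (hz.trans hxy)
      rcases hzx.resolve_left h1 with ⟨h5, h6⟩
      rcases hwy.resolve_left h2 with ⟨-, h8⟩
      rcases h5 with h5 | h5 <;> rcases h6 with h6 | h6 <;> rcases h8 with h8 | h8
      · exact h1 (ht _ _ _ (hs _ _ h5) h6)
      · exact h1 (ht _ _ _ (hs _ _ h5) h6)
      · exact h4 (ht _ _ _ (hs _ _ h5) h8)
      · exact h3 (ht _ _ _ (hs _ _ h6) h8)
      · exact h3 (ht _ _ _ (hs _ _ h6) h8)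
      · exact h4 (ht _ _ _ (hs _ _ h5) h8)
      · exact h1 (ht _ _ _ (hs _ _ h5) h6)
      · exact h1 (ht _ _ _ (hs _ _ h5) h6)
    rintro x y ⟨hx1, hx2⟩ ⟨hy1, hy2⟩
    rcases lt_trichotomy x y with h | h | h
    · exact (main x y h hx1 hx2 hy1 hy2).elim
    · exact h
    · exact (main y x h hy1 hy2 hx1 hx2).elim
  have := Set.ncard_le_ncard_sdiff_add_ncard {x : Fin n | ∃ y < x, merge P a b y x}
    {x | ∃ y < x, P y x} (Set.toFinite _)
  unfold blockRank
  omega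

end Rank

theorem ncard_le_of_strictMono {m : ℕ} {g : Set (Fin m) → ℕ} (hg : StrictMono g)
    (S : Set (Fin m)) : S.ncard ≤ g S := by
  induction h : S.ncard generalizing S with
  | zero => exact Nat.zero_le _
  | succ k ih =>
    obtain ⟨x, hx⟩ : S.Nonempty := Set.nonempty_of_ncard_ne_zero (by omega)
    have h1 := ih (S \ {x}) (by have := Set.ncard_sdiff_singleton_add_one hx; omega)
    have h2 := hg (show S \ {x} < S from ⟨Set.sdiff_subset, fun h => (h hx).2 rfl⟩)
    omega

theorem eq_ncard_of_strictMono {m : ℕ} {g : Set (Fin m) → ℕ} (hg : StrictMono g)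
    (hm : ∀ S, g S ≤ m) (S : Set (Fin m)) : g S = S.ncard := by
  refine le_antisymm ?_ (ncard_le_of_strictMono hg S)
  have h := ncard_le_of_strictMono (g := fun T => m - g Tᶜ) (fun T U hTU => by
    have h1 : g Uᶜ < g Tᶜ := hg (compl_lt_compl_iff_lt.2 hTU)
    have h2 := hm Tᶜ
    simp only
    omega) Sᶜ
  have h3 := Set.ncard_add_ncard_compl S
  simp only [compl_compl, Nat.card_eq_fintype_card, Fintype.card_fin] at h h3
  have h4 := hm S
  omega

section Boolean

variable {n : ℕ} {L : Set (NCP n)} {P Q : NCP n}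

theorem ncard_eq_blockRank (e : L ≃o Set (Fin (n - 1))) (P : L) :
    (e P).ncard = blockRank P.1.1 := by
  have h := eq_ncard_of_strictMono (g := fun S => blockRank (e.symm S).1.1)
    (fun S T hST => blockRank_strictMono (show (e.symm S).1.1 < (e.symm T).1.1 from
      (e.symm.lt_iff_lt.2 hST)))
    (fun S => blockRank_le _) (e P)
  simpa using h.symm

theorem exists_upperBound_blockRank_le (e : L ≃o Set (Fin (n - 1))) (hP : P ∈ L) (hQ : Q ∈ L) :
    ∃ U : NCP n, P ≤ U ∧ Q ≤ U ∧ blockRank U.1 ≤ blockRank P.1 + blockRank Q.1 := by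
  refine ⟨(e.symm (e ⟨P, hP⟩ ∪ e ⟨Q, hQ⟩)).1, ?_, ?_, ?_⟩
  · exact (e.le_symm_apply (x := ⟨P, hP⟩)).2 Set.subset_union_left
  · exact (e.le_symm_apply (x := ⟨Q, hQ⟩)).2 Set.subset_union_right
  · rw [← ncard_eq_blockRank e, OrderIso.apply_symm_apply, ← ncard_eq_blockRank e ⟨P, hP⟩,
      ← ncard_eq_blockRank e ⟨Q, hQ⟩]
    exact Set.ncard_union_le _ _

theorem add_blockRank_le_of_isLUB (e : L ≃o Set (Fin (n - 1))) (hL : LatClosed L) (hP : P ∈ L)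
    (hQ : Q ∈ L) (hdisj : ∀ x y, P.1 x y → Q.1 x y → x = y) {M : NCP n}
    (hM : IsLUB {P, Q} M) : blockRank P.1 + blockRank Q.1 ≤ blockRank M.1 := by
  have hML := hL.1 P hP Q hQ M hM
  have hcard : (e ⟨P, hP⟩ ∩ e ⟨Q, hQ⟩).ncard = 0 := by
    set B := e.symm (e ⟨P, hP⟩ ∩ e ⟨Q, hQ⟩) with hB
    have h1 : B ≤ ⟨P, hP⟩ := e.symm_apply_le.2 Set.inter_subset_left
    have h2 : B ≤ ⟨Q, hQ⟩ := e.symm_apply_le.2 Set.inter_subset_right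
    have h3 : B.1.1 = ⊥ := le_bot_iff.1 fun {x y} hxy => hdisj x y (h1 hxy) (h2 hxy)
    have h4 := ncard_eq_blockRank e B
    rwa [h3, blockRank_bot, hB, OrderIso.apply_symm_apply] at h4
  have h := Set.ncard_union_add_ncard_inter (e ⟨P, hP⟩) (e ⟨Q, hQ⟩)
  have hle : (e ⟨P, hP⟩ ∪ e ⟨Q, hQ⟩).ncard ≤ (e ⟨M, hML⟩).ncard := by
    refine Set.ncard_le_ncard (Set.union_subset ?_ ?_) (Set.toFinite _)
    · exact e.le_iff_le.2 (hM.1 (Or.inl rfl) : P ≤ M)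
    · exact e.le_iff_le.2 (hM.1 (Or.inr rfl) : Q ≤ M)
  rw [hcard, ncard_eq_blockRank, ncard_eq_blockRank] at h
  rw [ncard_eq_blockRank] at hle
  simp only at h hle
  omega

end Boolean

theorem isArc_of_not_cross {n : ℕ} {X : Set (Fin n)} (hne : X.Nonempty)
    (h : ∀ a b c d, a ∉ X → b ∉ X → c ∈ X → d ∈ X → ¬ Cross a b c d) : IsArc X := by
  obtain ⟨l, hl, hlmin⟩ := Set.exists_min_image X id (Set.toFinite X) hne
  obtain ⟨u, hu, humax⟩ := Set.exists_max_image X id (Set.toFinite X) hne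
  simp only [id] at hlmin humax
  by_cases hconv : ∀ x, l ≤ x → x ≤ u → x ∈ X
  · refine ⟨l, u.val + 1 - l.val, fun x => ⟨fun hx => ?_, ?_⟩⟩
    · have h1 := Fin.le_def.1 (hlmin x hx)
      have h2 := Fin.le_def.1 (humax x hx)
      refine ⟨x.val - l.val, by omega, ?_⟩
      rw [Nat.add_sub_cancel' h1, Nat.mod_eq_of_lt x.2]
    · rintro ⟨i, hi, hx⟩
      have hu2 := u.2
      rw [Nat.mod_eq_of_lt (by omega)] at hx
      exact hconv x (Fin.le_def.2 (by omega)) (Fin.le_def.2 (by omega))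
  · push Not at hconv
    obtain ⟨c, hlc, hcu, hc⟩ := hconv
    have hlc : l < c := lt_of_le_of_ne hlc (by rintro rfl; exact hc hl)
    have hcu : c < u := lt_of_le_of_ne hcu (by rintro rfl; exact hc hu)
    obtain ⟨a, ha, hamin⟩ := Set.exists_min_image Xᶜ id (Set.toFinite _) ⟨c, hc⟩
    obtain ⟨b, hb, hbmax⟩ := Set.exists_max_image Xᶜ id (Set.toFinite _) ⟨c, hc⟩
    simp only [id] at hamin hbmax
    have hac := hamin c hc
    have hcb := hbmax c hc
    have hmem : ∀ x, x ∈ X ↔ x < a ∨ b < x := by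
      refine fun x => ⟨fun hx => ?_, fun hx => ?_⟩
      · by_contra hcon
        have h1 := h a b x l ha hb hx hl
        have h2 := h a b x u ha hb hx hu
        have h3 := h a c l u ha hc hl hu
        have h4 := h c b l u hc hb hl hu
        have hxa : x ≠ a := by rintro rfl; exact ha hx
        have hxb : x ≠ b := by rintro rfl; exact hb hx
        have hla : l ≠ a := by rintro rfl; exact ha hl
        have hlb : l ≠ b := by rintro rfl; exact hb hl
        have hua : u ≠ a := by rintro rfl; exact ha hu
        have hub : u ≠ b := by rintro rfl; exact hb hu
        clear hlmin humax hamin hbmax h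
        unfold Cross at *
        grind
      · by_contra hxX
        rcases hx with hx | hx
        · exact absurd (hamin x hxX) (not_le.2 hx)
        · exact absurd (hbmax x hxX) (not_le.2 hx)
    have ha2 := a.2
    have hb2 := b.2
    have hab : a.val ≤ b.val := Fin.le_def.1 (hac.trans hcb)
    simp only [Fin.lt_def] at hmem
    by_cases hbn : b.val + 1 < n
    · refine ⟨⟨b.val + 1, hbn⟩, n - 1 - b.val + a.val, fun x => (hmem x).trans ⟨?_, ?_⟩⟩
      · have hx2 := x.2
        rintro (hx | hx)
        · refine ⟨n - 1 - b.val + x.val, by omega, ?_⟩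
          simp only
          rw [show b.val + 1 + (n - 1 - b.val + x.val) = x.val + n by omega, Nat.add_mod_right,
            Nat.mod_eq_of_lt x.2]
        · refine ⟨x.val - b.val - 1, by omega, ?_⟩
          simp only
          rw [show b.val + 1 + (x.val - b.val - 1) = x.val by omega, Nat.mod_eq_of_lt x.2]
      · rintro ⟨i, hi, hx⟩
        simp only at hx
        by_cases hlt : b.val + 1 + i < n
        · rw [Nat.mod_eq_of_lt hlt] at hx
          omega
        · rw [Nat.mod_eq_sub_mod (by omega), Nat.mod_eq_of_lt (by omega)] at hx
          omega
    · refine ⟨⟨0, by omega⟩, a.val, fun x => (hmem x).trans ⟨fun hx => ?_, ?_⟩⟩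
      · have hx2 := x.2
        exact ⟨x.val, by omega, by simp [Nat.mod_eq_of_lt hx2]⟩
      · rintro ⟨i, hi, hx⟩
        simp only [zero_add] at hx
        rw [Nat.mod_eq_of_lt (by omega)] at hx
        omega

section Universal

variable {n : ℕ} {P : NCP n}

theorem rel_of_cross_of_sublattices
    (hex : ∀ Q : NCP n, ∃ L : Set (NCP n), P ∈ L ∧ Q ∈ L ∧ LatClosed L ∧
      Nonempty (L ≃o Set (Fin (n - 1))))
    {a b c d : Fin n} (h : Cross a b c d) (hcd : P.1 c d) : P.1 a c ∨ P.1 b c := by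
  by_contra! hn
  obtain ⟨hac, hbc⟩ := hn
  obtain ⟨L, hP, hQ, -, ⟨e⟩⟩ := hex (oneBlock {a, b})
  obtain ⟨U, hPU, hQU, hU⟩ := exists_upperBound_blockRank_le e hP hQ
  have hab : ¬ P.1 a b := fun hab => hac (P.2.rel_of_cross hab hcd h)
  have hUab : U.1 a b := hQU (Or.inr ⟨by simp, by simp⟩)
  have hUac : U.1 a c := U.2.rel_of_cross hUab (hPU hcd) h
  have h1 : blockRank (oneBlock {a, b}).1 ≤ blockRank (merge (⊥ : Setoid (Fin n)) a b) := by
    refine blockRank_strictMono.monotone ?_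
    rintro x y (rfl | ⟨hx, hy⟩)
    · exact (merge ⊥ a b).refl x
    · exact Or.inr ⟨hx.imp Eq.symm Eq.symm, hy.imp Eq.symm Eq.symm⟩
  have h2 := blockRank_merge_le (⊥ : Setoid (Fin n)) a b
  rw [blockRank_bot] at h2
  have h3 := blockRank_strictMono (lt_merge hab)
  have h4 : ¬ merge P.1 a b a c := by
    rintro (h | ⟨-, h | h⟩)
    exacts [hac h, hac h, hbc h]
  have h5 := blockRank_strictMono (lt_merge h4)
  have h6 := blockRank_strictMono.monotone (merge_le (merge_le hPU hUab) hUac)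
  omega

theorem cross_of_sublattices
    (hex : ∀ Q : NCP n, ∃ L : Set (NCP n), P ∈ L ∧ Q ∈ L ∧ LatClosed L ∧
      Nonempty (L ≃o Set (Fin (n - 1))))
    {a b a' b' : Fin n} (ha : a ≠ a') (hb : b ≠ b') (haa : P.1 a a') (hbb : P.1 b b')
    (hab : ¬ P.1 a b) : Cross a b a' b' := by
  by_contra hcr
  have hab' : ¬ P.1 a b' := fun h => hab (P.1.trans h (P.1.symm hbb))
  have ha'b : ¬ P.1 a' b := fun h => hab (P.1.trans haa h)
  have ha'b' : ¬ P.1 a' b' := fun h => hab' (P.1.trans haa h)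
  have ne : ∀ {x y}, ¬ P.1 x y → x ≠ y := by rintro x y h rfl; exact h (P.1.refl x)
  have hQapp : ∀ x y, merge (merge ⊥ a b) a' b' x y ↔
      x = y ∨ ((x = a ∨ x = b) ∧ (y = a ∨ y = b)) ∨
        ((x = a' ∨ x = b') ∧ (y = a' ∨ y = b')) := by
    intro x y
    have hbot : ∀ u v : Fin n, (⊥ : Setoid (Fin n)) u v ↔ u = v := fun _ _ => Iff.rfl
    have := ne hab
    have := ne hab'
    have := ne ha'b
    have := ne ha'b'
    simp only [merge_apply, hbot]
    grind
  let Q : NCP n := ⟨merge (merge ⊥ a b) a' b', isNoncrossing_of_cross (by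
    intro x y z w hxy hzw hxz hc
    rw [hQapp] at hxy hzw hxz
    have := ne hab
    have := ne ha'b'
    clear hex hQapp ne haa hbb hab hab' ha'b ha'b'
    unfold Cross at hcr hc
    grind (splits := 20))⟩
  let M : NCP n := ⟨merge P.1 a b, isNoncrossing_of_cross (by
    intro x y z w hxy hzw hxz hc
    have hle := le_merge P.1 a b
    rcases id hxy with h1 | h1 <;> rcases id hzw with h2 | h2
    · exact hxz (hle (P.2.rel_of_cross h1 h2 hc))
    · rcases rel_of_cross_of_sublattices hex hc.symm h1 with h | h
      · exact hxz (Setoid.symm' _ (hle h))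
      · exact hxz (Setoid.symm' _ (Setoid.trans' _ hzw (hle h)))
    · rcases rel_of_cross_of_sublattices hex hc h2 with h | h
      · exact hxz (hle h)
      · exact hxz (Setoid.trans' _ hxy (hle h))
    · exact hxz (Or.inr ⟨h1.1, h2.1⟩))⟩
  have hQle : ∀ R : Setoid (Fin n), R a b → R a' b' → Q.1 ≤ R := fun R h h' =>
    merge_le (merge_le bot_le h) h'
  have hM : IsLUB {P, Q} M := by
    refine ⟨?_, fun R hR => ?_⟩
    · rintro _ (rfl | rfl)
      · exact le_merge _ _ _
      · exact hQle _ (merge_rel _ _ _) (Or.inr ⟨Or.inl haa, Or.inr hbb⟩)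
    · have h1 : P ≤ R := hR (Or.inl rfl)
      have h2 : Q ≤ R := hR (Or.inr rfl)
      exact merge_le h1 (h2 (le_merge _ _ _ (merge_rel _ _ _)))
  obtain ⟨L, hP, hQ, hL, ⟨e⟩⟩ := hex Q
  have hsum := add_blockRank_le_of_isLUB e hL hP hQ (fun x y hxy hQxy => by
    have hs : ∀ x y, P.1 x y → P.1 y x := fun x y => P.1.symm
    have := (hQapp x y).1 hQxy
    grind) hM
  have h1 := blockRank_merge_le P.1 a b
  have h2 := blockRank_strictMono (lt_merge (P := ⊥) (a := a) (b := b) (ne hab))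
  have h3 : ¬ merge ⊥ a b a' b' := by
    rintro (h | ⟨h | h, -⟩)
    exacts [ne ha'b' h, ha h, ne ha'b h.symm]
  have h4 := blockRank_strictMono (lt_merge h3)
  change blockRank P.1 + blockRank (merge (merge ⊥ a b) a' b') ≤ blockRank (merge P.1 a b)
    at hsum
  omega

theorem isUniversalNCP_of_sublattices (hbot : P.1 ≠ ⊥)
    (hex : ∀ Q : NCP n, ∃ L : Set (NCP n), P ∈ L ∧ Q ∈ L ∧ LatClosed L ∧
      Nonempty (L ≃o Set (Fin (n - 1)))) : IsUniversalNCP P := by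
  have h1 : ∃ a b : Fin n, a ≠ b ∧ P.1 a b := by
    by_contra! h
    exact hbot (le_bot_iff.1 fun {a b} hab => by
      by_contra hne
      exact h a b hne hab)
  have h2 : ∀ a b a' b' : Fin n, a ≠ b → P.1 a b → a' ≠ b' → P.1 a' b' → P.1 a a' := by
    intro a a' b b' ha haa hb hbb
    by_contra hab
    have c1 := cross_of_sublattices hex ha hb haa hbb hab
    have c2 := cross_of_sublattices hex ha hb.symm haa (P.1.symm hbb)
      fun h => hab (P.1.trans h (P.1.symm hbb))
    unfold Cross at c1 c2
    grind
  refine ⟨h1, h2, ?_⟩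
  obtain ⟨a, b, hab, hP⟩ := h1
  have harc : IsArc {x | P.1 a x} := by
    refine isArc_of_not_cross ⟨a, P.1.refl a⟩ fun c d x y hc hd hx hy hcr => ?_
    rcases rel_of_cross_of_sublattices hex hcr (P.1.trans (P.1.symm hx) hy) with h | h
    · exact hc (P.1.trans hx (P.1.symm h))
    · exact hd (P.1.trans hx (P.1.symm h))
  obtain ⟨s, m, hsm⟩ := harc
  refine ⟨s, m, fun x => Iff.trans ⟨?_, fun hx => ?_⟩ (hsm x)⟩
  · rintro ⟨y, hy, hxy⟩
    exact h2 a b x y hab hP hy.symm hxy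
  · by_cases h : x = a
    · exact ⟨b, h ▸ hab.symm, h ▸ hP⟩
    · exact ⟨a, Ne.symm h, P.1.symm hx⟩

end Universal

/-- a maximal chain `D` of `NCP n` lies in a common maximal Boolean
sublattice (one order-isomorphic to the Boolean lattice of subsets of an
`(n-1)`-element set) with every maximal chain `C` if and only if every element of `D`
other than the bottom and the top is a universal noncrossing partition. -/
theorem universal_chain_characterization (n : ℕ) (D : Set (NCP n))
    (hD : IsMaxChain (· ≤ ·) D) :
    (∀ C : Set (NCP n), IsMaxChain (· ≤ ·) C →
        ∃ L : Set (NCP n), C ∪ D ⊆ L ∧ LatClosed L ∧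
          Nonempty (↥L ≃o Set (Fin (n-1)))) ↔
      (∀ P ∈ D, P.1 ≠ ⊥ → P.1 ≠ ⊤ → IsUniversalNCP P) := by
  refine ⟨fun h P hP hbot _ => isUniversalNCP_of_sublattices hbot fun Q => ?_,
    fun hU C hC => exists_boolean_sublattice_of_universal hD hU hC⟩
  obtain ⟨C, hC, hQC⟩ := (IsChain.singleton (r := (· ≤ ·)) (a := Q)).exists_maxChain
  obtain ⟨L, hsub, hL, hiso⟩ := h C hC
  exact ⟨L, hsub (Or.inr hP), hsub (Or.inl (hQC rfl)), hL, hiso⟩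

end NCPaper
end

section
/- For n ≥ 2, let N be the number of sublattices of NCP_n that are order-isomorphic to the Boolean lattice of all subsets of an (n−1)-element set (these are the maximal Boolean sublattices of NCP_n, i.e. the apartments of the order complex of NCP_n). Then (2n−1) · N = binom(3n−3, n−1); equivalently, N equals the generalized Catalan number (1/(2n−1)) binom(3n−3, n−1). -/
namespace NCPaper

/-- The equivalence relation on `ℕ` of lying in the same connected component of the graph with
edge set `F`. -/
def component (F : Finset (ℕ × ℕ)) : Setoid ℕ :=
  Relation.EqvGen.setoid fun x y => (x, y) ∈ F

lemma component_lift {β : Type*} {F : Finset (ℕ × ℕ)} (s : Setoid β) (g : ℕ → β)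
    (h : ∀ x y, (x, y) ∈ F → s (g x) (g y)) {x y : ℕ} (hxy : component F x y) :
    s (g x) (g y) :=
  (Setoid.eqvGen_le (s := s.comap g) h : component F ≤ s.comap g) hxy

lemma component_of_mem {F : Finset (ℕ × ℕ)} {x y : ℕ} (h : (x, y) ∈ F) : component F x y :=
  Relation.EqvGen.rel _ _ h

lemma component_mono {F G : Finset (ℕ × ℕ)} (h : F ⊆ G) {x y : ℕ} (hxy : component F x y) :
    component G x y :=
  component_lift (component G) id (fun _ _ hm => component_of_mem (h hm)) hxy

/-- A predicate that is constant along the edges is constant on components. -/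
lemma component_cut {F : Finset (ℕ × ℕ)} (p : ℕ → Prop)
    (h : ∀ x y, (x, y) ∈ F → (p x ↔ p y)) {x y : ℕ} (hxy : component F x y) : p x ↔ p y :=
  iff_of_eq (component_lift (⊥ : Setoid Prop) p (fun x y hm => propext (h x y hm)) hxy)

lemma component_insert {F : Finset (ℕ × ℕ)} {u v x y : ℕ}
    (hxy : component (insert (u, v) F) x y) :
    component F x y ∨ (component F x u ∧ component F v y) ∨
      (component F x v ∧ component F u y) := by
  have refl := (component F).refl'
  have symm := fun {a b} => (component F).symm' (x := a) (y := b)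
  have trans := fun {a b c} => (component F).trans' (x := a) (y := b) (z := c)
  induction hxy with
  | rel x y h =>
    rcases Finset.mem_insert.1 h with h | h
    · cases h
      exact Or.inr (Or.inl ⟨refl _, refl _⟩)
    · exact Or.inl (component_of_mem h)
  | refl x => exact Or.inl (refl _)
  | symm x y _ ih =>
    rcases ih with h | ⟨h, h'⟩ | ⟨h, h'⟩
    · exact Or.inl (symm h)
    · exact Or.inr (Or.inr ⟨symm h', symm h⟩)
    · exact Or.inr (Or.inl ⟨symm h', symm h⟩)
  | trans x y z _ _ ih ih' =>
    rcases ih with h | ⟨h, h'⟩ | ⟨h, h'⟩ <;> rcases ih' with k | ⟨k, k'⟩ | ⟨k, k'⟩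
    · exact Or.inl (trans h k)
    · exact Or.inr (Or.inl ⟨trans h k, k'⟩)
    · exact Or.inr (Or.inr ⟨trans h k, k'⟩)
    · exact Or.inr (Or.inl ⟨h, trans h' k⟩)
    · exact Or.inr (Or.inl ⟨h, k'⟩)
    · exact Or.inl (trans h k')
    · exact Or.inr (Or.inr ⟨h, trans h' k⟩)
    · exact Or.inl (trans h k')
    · exact Or.inr (Or.inr ⟨h, k'⟩)

/-- No two edges of `E` cross when drawn as chords between points in convex position. -/
def NoncrossingEdges (E : Finset (ℕ × ℕ)) : Prop :=
  ∀ e ∈ E, ∀ f ∈ E, ¬ (e.1 < f.1 ∧ f.1 < e.2 ∧ e.2 < f.2)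

lemma NoncrossingEdges.mono {E F : Finset (ℕ × ℕ)} (hE : NoncrossingEdges E) (h : F ⊆ E) :
    NoncrossingEdges F :=
  fun e he f hf => hE e (h he) f (h hf)

/-- The components of a noncrossing graph form a noncrossing partition. -/
lemma NoncrossingEdges.component_noncrossing {F : Finset (ℕ × ℕ)} (hF : NoncrossingEdges F)
    (hlt : ∀ e ∈ F, e.1 < e.2) {a b c d : ℕ} (hab : a < b) (hbc : b < c) (hcd : c < d)
    (hac : component F a c) (hbd : component F b d) : component F a b := by
  by_contra hn
  obtain ⟨u, v, huv, hau, hside⟩ : ∃ u v, (u, v) ∈ F ∧ component F a u ∧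
      ¬ ((b < u ∧ u < d) ↔ (b < v ∧ v < d)) := by
    by_contra! hcon
    have := component_cut (fun z => component F a z ∧ (b < z ∧ z < d)) (fun x y hm => by
      constructor
      · rintro ⟨h, h'⟩
        exact ⟨(component F).trans h (component_of_mem hm), (hcon x y hm h).1 h'⟩
      · rintro ⟨h, h'⟩
        have hx := (component F).trans h ((component F).symm (component_of_mem hm))
        exact ⟨hx, (hcon x y hm hx).2 h'⟩) hac
    have := (this.2 ⟨hac, hbc, hcd⟩).2.1
    omega
  have hav := (component F).trans hau (component_of_mem huv)
  have hne : ∀ z, component F b z → z ≠ u ∧ z ≠ v := fun z hz => by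
    constructor <;> rintro rfl
    · exact hn ((component F).trans hau ((component F).symm hz))
    · exact hn ((component F).trans hav ((component F).symm hz))
  obtain ⟨s, t, hst, hbs, hside'⟩ : ∃ s t, (s, t) ∈ F ∧ component F b s ∧
      ¬ ((u < s ∧ s < v) ↔ (u < t ∧ t < v)) := by
    by_contra! hcon
    have := component_cut (fun z => component F b z ∧ (u < z ∧ z < v)) (fun x y hm => by
      constructor
      · rintro ⟨h, h'⟩
        exact ⟨(component F).trans h (component_of_mem hm), (hcon x y hm h).1 h'⟩
      · rintro ⟨h, h'⟩
        have hx := (component F).trans h ((component F).symm (component_of_mem hm))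
        exact ⟨hx, (hcon x y hm hx).2 h'⟩) hbd
    have h1 := hne b ((component F).refl b)
    have h2 := hne d hbd
    have h3 := hlt _ huv
    simp only [(component F).refl b, hbd, true_and] at this
    omega
  have hbt := (component F).trans hbs (component_of_mem hst)
  have h1 := hne s hbs
  have h2 := hne t hbt
  have h3 := hlt _ huv
  have h4 := hlt _ hst
  have h5 := hF _ huv _ hst
  have h6 := hF _ hst _ huv
  simp only at h3 h4 h5 h6
  omega

/-- `E` is the edge set of a noncrossing spanning tree on the points `a, …, b`: a connected
noncrossing graph all of whose edges are bridges. -/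
structure IsNCTree (a b : ℕ) (E : Finset (ℕ × ℕ)) : Prop where
  bounds : ∀ x y, (x, y) ∈ E → a ≤ x ∧ x < y ∧ y ≤ b
  noncrossing : NoncrossingEdges E
  conn : ∀ x y, a ≤ x → x ≤ b → a ≤ y → y ≤ b → component E x y
  bridge : ∀ x y, (x, y) ∈ E → ¬ component (E.erase (x, y)) x y

/-- The graph glued from graphs on `{a, …, i}`, `{i + 1, …, j}` and `{j, …, b}` by adding the edge
from `a` to `j`. -/
def glue (a j : ℕ) (A B C : Finset (ℕ × ℕ)) : Finset (ℕ × ℕ) :=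
  insert (a, j) (A ∪ (B ∪ C))

lemma mem_glue {a j : ℕ} {A B C : Finset (ℕ × ℕ)} {e : ℕ × ℕ} :
    e ∈ glue a j A B C ↔ e = (a, j) ∨ e ∈ A ∨ e ∈ B ∨ e ∈ C := by
  simp [glue]

lemma IsNCTree.sub_tree {a b : ℕ} {E : Finset (ℕ × ℕ)} (hE : IsNCTree a b E) {c d : ℕ}
    {F : Finset (ℕ × ℕ)} (hF : F ⊆ E) (hac : a ≤ c) (hdb : d ≤ b)
    (hbd : ∀ x y, (x, y) ∈ F → c ≤ x ∧ y ≤ d) (g : ℕ → ℕ)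
    (hg : ∀ x, c ≤ x → x ≤ d → g x = x)
    (hgE : ∀ x y, (x, y) ∈ E → (x, y) ∈ F ∨ g x = g y) : IsNCTree c d F where
  bounds x y h := ⟨(hbd x y h).1, (hE.bounds x y (hF h)).2.1, (hbd x y h).2⟩
  noncrossing := hE.noncrossing.mono hF
  conn x y hx hx' hy hy' := by
    have := component_lift (component F) g (fun u v huv => by
      rcases hgE u v huv with h | h
      · have := hbd u v h
        have h' := hE.bounds u v huv
        rw [hg u this.1 (by omega), hg v (by omega) this.2]
        exact component_of_mem h
      · rw [h]) (hE.conn x y (hac.trans hx) (hx'.trans hdb) (hac.trans hy) (hy'.trans hdb))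
    rwa [hg x hx hx', hg y hy hy'] at this
  bridge x y h hc := hE.bridge x y (hF h) (component_mono (Finset.erase_subset_erase _ hF) hc)

/-- Retracting onto a piece that is a tree shows that its edges are bridges. -/
lemma IsNCTree.bridge_of_retract {c d : ℕ} {E F : Finset (ℕ × ℕ)} (hF : IsNCTree c d F)
    (g : ℕ → ℕ) (hg : ∀ x, c ≤ x → x ≤ d → g x = x)
    (hgE : ∀ x y, (x, y) ∈ E → (x, y) ∈ F ∨ g x = g y) (x y : ℕ) (hxy : (x, y) ∈ F) :
    ¬ component (E.erase (x, y)) x y := by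
  intro hc
  apply hF.bridge x y hxy
  have hb := hF.bounds x y hxy
  have := component_lift (component (F.erase (x, y))) g (fun u v huv => by
      rw [Finset.mem_erase] at huv
      rcases hgE u v huv.2 with h | h
      · have := hF.bounds u v h
        rw [hg u this.1 (by omega), hg v (by omega) this.2.2]
        exact component_of_mem (Finset.mem_erase.2 ⟨huv.1, h⟩)
      · rw [h]) hc
  rwa [hg x hb.1 (by omega), hg y (by omega) hb.2.2] at this

lemma component_pieces_iff {a i j b : ℕ} {A B C : Finset (ℕ × ℕ)} (hA : IsNCTree a i A)
    (hB : IsNCTree (i + 1) j B) (hC : IsNCTree j b C) (hai : a ≤ i) (hij : i < j) {x : ℕ}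
    (hx : a ≤ x) : component (A ∪ (B ∪ C)) a x ↔ x ≤ i := by
  constructor
  · intro h
    refine (component_cut (fun z => z ≤ i) (fun u v huv => ?_) h).1 hai
    simp only [Finset.mem_union] at huv
    rcases huv with h | h | h
    · have := hA.bounds _ _ h; omega
    · have := hB.bounds _ _ h; omega
    · have := hC.bounds _ _ h; omega
  · intro h
    exact component_mono Finset.subset_union_left (hA.conn a x le_rfl hai hx h)

lemma IsNCTree.glue {a i j b : ℕ} {A B C : Finset (ℕ × ℕ)} (hA : IsNCTree a i A)
    (hB : IsNCTree (i + 1) j B) (hC : IsNCTree j b C) (hai : a ≤ i) (hij : i < j) (hjb : j ≤ b) :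
    IsNCTree a b (glue a j A B C) where
  bounds x y h := by
    rcases mem_glue.1 h with h | h | h | h
    · cases h; omega
    · have := hA.bounds _ _ h; omega
    · have := hB.bounds _ _ h; omega
    · have := hC.bounds _ _ h; omega
  noncrossing := by
    rintro ⟨x, y⟩ he ⟨z, w⟩ hf
    have key : ∀ {x y}, (x, y) ∈ NCPaper.glue a j A B C → (x = a ∧ y = j) ∨
        ((x, y) ∈ A ∧ a ≤ x ∧ x < y ∧ y ≤ i) ∨ ((x, y) ∈ B ∧ i + 1 ≤ x ∧ x < y ∧ y ≤ j) ∨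
        ((x, y) ∈ C ∧ j ≤ x ∧ x < y ∧ y ≤ b) := by
      intro x y h
      rcases mem_glue.1 h with h | h | h | h
      · cases h; simp
      · exact Or.inr (Or.inl ⟨h, hA.bounds _ _ h⟩)
      · exact Or.inr (Or.inr (Or.inl ⟨h, hB.bounds _ _ h⟩))
      · exact Or.inr (Or.inr (Or.inr ⟨h, hC.bounds _ _ h⟩))
    rcases key he with h | ⟨h, hb⟩ | ⟨h, hb⟩ | ⟨h, hb⟩ <;>
      rcases key hf with k | ⟨k, kb⟩ | ⟨k, kb⟩ | ⟨k, kb⟩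
    all_goals first
      | exact hA.noncrossing _ h _ k
      | exact hB.noncrossing _ h _ k
      | exact hC.noncrossing _ h _ k
      | (simp only; omega)
  conn := by
    have key : ∀ x, a ≤ x → x ≤ b → component (NCPaper.glue a j A B C) j x := by
      intro x hx hx'
      have hsub : A ⊆ NCPaper.glue a j A B C ∧ B ⊆ NCPaper.glue a j A B C ∧
          C ⊆ NCPaper.glue a j A B C :=
        ⟨fun e he => mem_glue.2 (by tauto), fun e he => mem_glue.2 (by tauto),
          fun e he => mem_glue.2 (by tauto)⟩
      rcases le_or_gt x i with h | h
      · exact Setoid.trans' _ (Setoid.symm' _ (component_of_mem (mem_glue.2 (Or.inl rfl))))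
          (component_mono hsub.1 (hA.conn a x le_rfl hai hx h))
      · rcases le_or_gt x j with h' | h'
        · exact component_mono hsub.2.1 (hB.conn j x hij le_rfl h h')
        · exact component_mono hsub.2.2 (hC.conn j x le_rfl hjb h'.le hx')
    exact fun x y hx hx' hy hy' => Setoid.trans' _ (Setoid.symm' _ (key x hx hx')) (key y hy hy')
  bridge x y h := by
    rcases mem_glue.1 h with h | h | h | h
    · cases h
      intro hc
      refine absurd ((component_pieces_iff hA hB hC hai hij (by omega)).1
        (component_mono (fun e he => ?_) hc)) (by omega)
      rw [Finset.mem_erase, mem_glue] at he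
      simp only [Finset.mem_union]
      tauto
    · refine hA.bridge_of_retract (fun z => if z ≤ i then z else a)
        (fun z _ hz => if_pos hz) (fun u v huv => ?_) x y h
      rcases mem_glue.1 huv with k | k | k | k
      · cases k; right; split_ifs <;> omega
      · exact Or.inl k
      · have := hB.bounds _ _ k; right; split_ifs <;> omega
      · have := hC.bounds _ _ k; right; split_ifs <;> omega
    · refine hB.bridge_of_retract (fun z => if z ≤ i then j else min z j)
        (fun z hz hz' => by rw [if_neg (by omega)]; omega) (fun u v huv => ?_) x y h
      rcases mem_glue.1 huv with k | k | k | k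
      · cases k; right; split_ifs <;> omega
      · have := hA.bounds _ _ k; right; split_ifs <;> omega
      · exact Or.inl k
      · have := hC.bounds _ _ k; right; split_ifs <;> omega
    · refine hC.bridge_of_retract (fun z => max z j)
        (fun z hz hz' => by omega) (fun u v huv => ?_) x y h
      rcases mem_glue.1 huv with k | k | k | k
      · cases k; right; omega
      · have := hA.bounds _ _ k; right; omega
      · have := hB.bounds _ _ k; right; omega
      · exact Or.inl k

/-- Every noncrossing tree with an edge is glued from three smaller ones. -/
lemma IsNCTree.exists_glue {a b : ℕ} {E : Finset (ℕ × ℕ)} (hE : IsNCTree a b E) (hab : a < b) :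
    ∃ i j A B C, a ≤ i ∧ i < j ∧ j ≤ b ∧ IsNCTree a i A ∧ IsNCTree (i + 1) j B ∧
      IsNCTree j b C ∧ E = NCPaper.glue a j A B C := by
  classical
  obtain ⟨j, hj, hjmax⟩ : ∃ j, (a, j) ∈ E ∧ ∀ k, (a, k) ∈ E → k ≤ j := by
    have hne : (E.filter (fun e => e.1 = a)).Nonempty := by
      by_contra hcon
      rw [Finset.not_nonempty_iff_eq_empty, Finset.filter_eq_empty_iff] at hcon
      have := component_cut (fun z => z = a) (fun x y h => by
        have h1 := hE.bounds x y h
        have h2 := hcon h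
        simp only at h2
        omega) (hE.conn a b le_rfl hab.le hab.le le_rfl)
      omega
    obtain ⟨e, he, hmax⟩ := Finset.exists_max_image _ Prod.snd hne
    obtain ⟨x, y⟩ := e
    simp only [Finset.mem_filter] at he hmax
    obtain ⟨he, rfl⟩ := he
    exact ⟨y, he, fun k hk => hmax _ ⟨hk, rfl⟩⟩
  have hjb := hE.bounds _ _ hj
  set E' := E.erase (a, j) with hE'
  have hins : insert (a, j) E' = E := Finset.insert_erase hj
  have hnaj : ¬ component E' a j := hE.bridge _ _ hj
  have hcover : ∀ x, a ≤ x → x ≤ b → ¬ component E' a x → component E' j x := by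
    intro x hx hx' hax
    have h := hE.conn a x le_rfl hab.le hx hx'
    rw [← hins] at h
    rcases component_insert h with h | h | h
    · exact absurd h hax
    · exact h.2
    · exact absurd h.2 hax
  obtain ⟨i, hi, hib, himax⟩ : ∃ i, component E' a i ∧ (a ≤ i ∧ i ≤ b) ∧
      ∀ k, a ≤ k → k ≤ b → component E' a k → k ≤ i := by
    obtain ⟨i, hi, hmax⟩ := Finset.exists_max_image
      ((Finset.Icc a b).filter (fun x => component E' a x)) id
      ⟨a, by simp [hab.le]⟩
    simp only [Finset.mem_filter, Finset.mem_Icc, id] at hi hmax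
    exact ⟨i, hi.2, hi.1, fun k h1 h2 h3 => hmax k ⟨⟨h1, h2⟩, h3⟩⟩
  have hij : i < j := by
    by_contra hcon
    have := (component_cut (fun z => component E' a z ∧ z < j) (fun x y h => by
      have hb := hE.bounds x y (Finset.mem_of_mem_erase h)
      have hc : component E' a x ↔ component E' a y :=
        ⟨fun k => Setoid.trans' _ k (component_of_mem h),
          fun k => Setoid.trans' _ k (Setoid.symm' _ (component_of_mem h))⟩
      refine ⟨fun k => ⟨hc.1 k.1, ?_⟩, fun k => ⟨hc.2 k.1, by omega⟩⟩
      by_contra hy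
      have hyj : y ≠ j := fun h' => hnaj (h' ▸ hc.1 k.1)
      have hxa : x ≠ a := fun h' => by
        have := hjmax y (h' ▸ Finset.mem_of_mem_erase h)
        omega
      have := hE.noncrossing _ hj _ (Finset.mem_of_mem_erase h)
      simp only at this
      omega) hi).1 ⟨Setoid.refl' _ a, hjb.2.1⟩
    omega
  have hA : ∀ x, a ≤ x → x ≤ b → (component E' a x ↔ x ≤ i) := by
    intro x hx hx'
    refine ⟨himax x hx hx', fun hxi => ?_⟩
    by_contra hn
    have hjx := hcover x hx hx' hn
    have hxa : x ≠ a := fun h => hn (h ▸ Setoid.refl' _ _)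
    have hxi' : x ≠ i := fun h => hn (h ▸ hi)
    exact hn ((hE.noncrossing.mono (Finset.erase_subset _ _)).component_noncrossing
      (fun e he => (hE.bounds _ _ (Finset.mem_of_mem_erase he)).2.1)
      (by omega) (by omega) hij hi (Setoid.symm' _ hjx))
  have hedge : ∀ x y, (x, y) ∈ E → (x = a ∧ y = j) ∨ (y ≤ i) ∨ (i + 1 ≤ x ∧ y ≤ j) ∨ j ≤ x := by
    intro x y h
    by_cases hxy : (x, y) = (a, j)
    · simp only [Prod.mk.injEq] at hxy; exact Or.inl hxy
    have hb := hE.bounds x y h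
    have hm : (x, y) ∈ E' := Finset.mem_erase.2 ⟨hxy, h⟩
    have hc : component E' a x ↔ component E' a y :=
      ⟨fun k => Setoid.trans' _ k (component_of_mem hm),
        fun k => Setoid.trans' _ k (Setoid.symm' _ (component_of_mem hm))⟩
    rw [hA x (by omega) (by omega), hA y (by omega) (by omega)] at hc
    have := hE.noncrossing _ hj _ h
    simp only at this
    omega
  refine ⟨i, j, E.filter (fun e => e.2 ≤ i), E.filter (fun e => i + 1 ≤ e.1 ∧ e.2 ≤ j),
    E.filter (fun e => j ≤ e.1), hib.1, hij, hjb.2.2, ?_, ?_, ?_, ?_⟩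
  · refine hE.sub_tree (Finset.filter_subset _ _) le_rfl hib.2 (fun x y h => ?_)
      (fun z => if z ≤ i then z else a) (fun z _ hz => if_pos hz) (fun u v huv => ?_)
    · rw [Finset.mem_filter] at h
      exact ⟨(hE.bounds _ _ h.1).1, h.2⟩
    · have := hE.bounds _ _ huv
      rcases hedge u v huv with h | h | h | h
      · right; split_ifs <;> omega
      · exact Or.inl (Finset.mem_filter.2 ⟨huv, h⟩)
      · right; split_ifs <;> omega
      · right; split_ifs <;> omega
  · refine hE.sub_tree (Finset.filter_subset _ _) (by omega) hjb.2.2 (fun x y h => ?_)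
      (fun z => if z ≤ i then j else min z j)
      (fun z hz hz' => by rw [if_neg (by omega)]; omega) (fun u v huv => ?_)
    · exact (Finset.mem_filter.1 h).2
    · have := hE.bounds _ _ huv
      rcases hedge u v huv with h | h | h | h
      · right; split_ifs <;> omega
      · right; split_ifs <;> omega
      · exact Or.inl (Finset.mem_filter.2 ⟨huv, h⟩)
      · right; split_ifs <;> omega
  · refine hE.sub_tree (Finset.filter_subset _ _) (by omega) le_rfl (fun x y h => ?_)
      (fun z => max z j) (fun z hz hz' => by omega) (fun u v huv => ?_)
    · rw [Finset.mem_filter] at h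
      exact ⟨h.2, (hE.bounds _ _ h.1).2.2⟩
    · have := hE.bounds _ _ huv
      rcases hedge u v huv with h | h | h | h
      · right; omega
      · right; omega
      · right; omega
      · exact Or.inl (Finset.mem_filter.2 ⟨huv, h⟩)
  · ext ⟨x, y⟩
    simp only [mem_glue, Finset.mem_filter, Prod.mk.injEq]
    constructor
    · intro h
      have := hedge x y h
      tauto
    · rintro (⟨rfl, rfl⟩ | h | h | h)
      exacts [hj, h.1, h.1, h.1]

lemma glue_injective {a b i j i' j' : ℕ} {A B C A' B' C' : Finset (ℕ × ℕ)}
    (hA : IsNCTree a i A) (hB : IsNCTree (i + 1) j B) (hC : IsNCTree j b C) (hai : a ≤ i)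
    (hij : i < j) (hA' : IsNCTree a i' A') (hB' : IsNCTree (i' + 1) j' B')
    (hC' : IsNCTree j' b C') (hai' : a ≤ i') (hij' : i' < j')
    (h : NCPaper.glue a j A B C = NCPaper.glue a j' A' B' C') :
    i = i' ∧ j = j' ∧ A = A' ∧ B = B' ∧ C = C' := by
  have hjle : ∀ {i j A B C} (_ : IsNCTree a i A) (_ : IsNCTree (i + 1) j B) (_ : IsNCTree j b C)
      (_ : a ≤ i) (_ : i < j) (k : ℕ) (_ : (a, k) ∈ NCPaper.glue a j A B C), k ≤ j := by
    intro i j A B C hA hB hC hai hij k hk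
    rcases mem_glue.1 hk with h | h | h | h
    · simp only [Prod.mk.injEq] at h; omega
    · have := hA.bounds _ _ h; omega
    · have := hB.bounds _ _ h; omega
    · have := hC.bounds _ _ h; omega
  have hjj : j = j' := le_antisymm
    (hjle hA' hB' hC' hai' hij' j (h ▸ mem_glue.2 (Or.inl rfl)))
    (hjle hA hB hC hai hij j' (h ▸ mem_glue.2 (Or.inl rfl)))
  subst hjj
  have herase : ∀ {i A B C} (_ : IsNCTree a i A) (_ : IsNCTree (i + 1) j B) (_ : IsNCTree j b C)
      (_ : a ≤ i) (_ : i < j), (NCPaper.glue a j A B C).erase (a, j) = A ∪ (B ∪ C) := by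
    intro i A B C hA hB hC hai hij
    refine Finset.erase_insert fun hm => ?_
    simp only [Finset.mem_union] at hm
    rcases hm with h | h | h
    · have := hA.bounds _ _ h; omega
    · have := hB.bounds _ _ h; omega
    · have := hC.bounds _ _ h; omega
  have heq : A ∪ (B ∪ C) = A' ∪ (B' ∪ C') := by
    rw [← herase hA hB hC hai hij, ← herase hA' hB' hC' hai' hij', h]
  have hii : i = i' := by
    have h1 := component_pieces_iff hA hB hC hai hij hai'
    have h2 := component_pieces_iff hA' hB' hC' hai' hij' hai
    have h3 := component_pieces_iff hA hB hC hai hij hai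
    have h4 := component_pieces_iff hA' hB' hC' hai' hij' hai'
    rw [heq] at h1 h3
    exact le_antisymm (h2.1 (h3.2 le_rfl)) (h1.1 (h4.2 le_rfl))
  subst hii
  have hparts : ∀ {A B C} (_ : IsNCTree a i A) (_ : IsNCTree (i + 1) j B) (_ : IsNCTree j b C),
      A = (A ∪ (B ∪ C)).filter (fun e => e.2 ≤ i) ∧
      B = (A ∪ (B ∪ C)).filter (fun e => i + 1 ≤ e.1 ∧ e.2 ≤ j) ∧
      C = (A ∪ (B ∪ C)).filter (fun e => j ≤ e.1) := by
    intro A B C hA hB hC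
    refine ⟨?_, ?_, ?_⟩ <;> ext ⟨x, y⟩ <;> simp only [Finset.mem_filter, Finset.mem_union]
    all_goals
      have h1 := hA.bounds x y
      have h2 := hB.bounds x y
      have h3 := hC.bounds x y
      constructor
      · intro h
        simp only [h, true_implies, true_or, or_true, true_and] at h1 h2 h3 ⊢
        omega
      · rintro ⟨h | h | h, h'⟩ <;>
          first | exact h | (simp only [h, true_implies] at h1 h2 h3; omega)
  obtain ⟨a1, a2, a3⟩ := hparts hA hB hC
  obtain ⟨b1, b2, b3⟩ := hparts hA' hB' hC'
  refine ⟨rfl, rfl, ?_, ?_, ?_⟩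
  · rw [a1, b1, heq]
  · rw [a2, b2, heq]
  · rw [a3, b3, heq]

open PowerSeries in
/-- The coefficients of the powers of a series `U` with `U = 1 + X * U ^ 3`. -/
lemma coeff_pow_of_cubic {U : PowerSeries ℚ} (hU : U = 1 + X * U ^ 3) (m r : ℕ) :
    (3 * m + r : ℚ) * coeff m (U ^ r) = r * (3 * m + r).choose m := by
  induction m generalizing r with
  | zero =>
    have h0 : constantCoeff U = 1 := by
      rw [hU]; simp
    simp [h0]
  | succ m ih =>
    induction r with
    | zero => simp [coeff_one]
    | succ r ihr =>
      have hstep : coeff (m + 1) (U ^ (r + 1)) = coeff (m + 1) (U ^ r) + coeff m (U ^ (r + 3)) := by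
        have : U ^ (r + 1) = U ^ r + X * U ^ (r + 3) := by
          calc U ^ (r + 1) = U ^ r * U := pow_succ _ _
            _ = U ^ r * (1 + X * U ^ 3) := by rw [← hU]
            _ = _ := by ring
        rw [this, map_add, coeff_succ_X_mul]
      have h3 := ih (r + 3)
      have hN : 3 * (m + 1) + r = 3 * m + (r + 3) := by ring
      have hN' : 3 * (m + 1) + (r + 1) = 3 * m + (r + 3) + 1 := by ring
      rw [hN] at ihr
      rw [hN', Nat.choose_succ_succ, hstep]
      have hc : ((3 * m + (r + 3)).choose (m + 1) : ℚ) * (m + 1) =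
          (3 * m + (r + 3)).choose m * (2 * m + r + 3) := by
        have := Nat.choose_succ_right_eq (3 * m + (r + 3)) m
        rw [show 3 * m + (r + 3) - m = 2 * m + r + 3 by omega] at this
        exact_mod_cast this
      push_cast at ihr h3 ⊢
      have hpos : (3 * m + r + 3 : ℚ) ≠ 0 := by positivity
      apply mul_left_cancel₀ hpos
      linear_combination (3 * m + r + 4 : ℚ) * ihr + (3 * m + r + 4 : ℚ) * h3 - 3 * hc

/-- The number of ternary trees from the recurrence obtained by removing the root. -/
lemma ternary_recurrence_solution {u : ℕ → ℕ} (h0 : u 0 = 1)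
    (hs : ∀ m, u (m + 1) = ∑ p ∈ Finset.HasAntidiagonal.antidiagonal m,
      ∑ q ∈ Finset.HasAntidiagonal.antidiagonal p.2, u p.1 * (u q.1 * u q.2)) (m : ℕ) :
    (2 * m + 1) * u m = (3 * m).choose m := by
  have hU : (PowerSeries.mk fun k => (u k : ℚ)) =
      1 + PowerSeries.X * (PowerSeries.mk fun k => (u k : ℚ)) ^ 3 := by
    ext k
    cases k with
    | zero => simp [h0]
    | succ k =>
      rw [pow_succ', pow_two, map_add, PowerSeries.coeff_succ_X_mul, PowerSeries.coeff_mul]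
      simp [PowerSeries.coeff_mul, PowerSeries.coeff_one, hs, Finset.mul_sum]
  have h := coeff_pow_of_cubic hU m 1
  rw [pow_one, PowerSeries.coeff_mk] at h
  have h' : (3 * m + 1) * u m = (3 * m + 1).choose m := by
    have : (((3 * m + 1) * u m : ℕ) : ℚ) = ((3 * m + 1).choose m : ℕ) := by
      push_cast at h ⊢
      linarith
    exact_mod_cast this
  have hc := Nat.choose_mul_succ_eq (3 * m) m
  rw [show 3 * m + 1 - m = 2 * m + 1 by omega, ← h'] at hc
  apply Nat.eq_of_mul_eq_mul_left (show 0 < 3 * m + 1 by omega)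
  linarith

open Classical in
/-- The noncrossing spanning trees on the points `a, …, b`. -/
noncomputable def ncTrees (a b : ℕ) : Finset (Finset (ℕ × ℕ)) :=
  (Finset.Icc a b ×ˢ Finset.Icc a b).powerset.filter (IsNCTree a b)

lemma mem_ncTrees {a b : ℕ} {E : Finset (ℕ × ℕ)} : E ∈ ncTrees a b ↔ IsNCTree a b E := by
  simp only [ncTrees, Finset.mem_filter, Finset.mem_powerset, and_iff_right_iff_imp]
  rintro h ⟨x, y⟩ hxy
  have := h.bounds x y hxy
  simp only [Finset.mem_product, Finset.mem_Icc]
  omega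

lemma IsNCTree.eq_empty {a : ℕ} {E : Finset (ℕ × ℕ)} (h : IsNCTree a a E) : E = ∅ := by
  refine Finset.eq_empty_of_forall_notMem fun ⟨x, y⟩ hxy => ?_
  have := h.bounds x y hxy
  omega

lemma isNCTree_empty (a : ℕ) : IsNCTree a a ∅ where
  bounds := by simp
  noncrossing := by simp [NoncrossingEdges]
  conn x y hx hx' hy hy' := by
    obtain rfl : x = y := by omega
    exact Setoid.refl' _ _
  bridge := by simp

lemma card_ncTrees_self (a : ℕ) : (ncTrees a a).card = 1 :=
  Finset.card_eq_one.2 ⟨∅, by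
    ext E
    rw [mem_ncTrees, Finset.mem_singleton]
    exact ⟨IsNCTree.eq_empty, fun h => h ▸ isNCTree_empty a⟩⟩

lemma card_ncTrees_succ (a m : ℕ) : (ncTrees a (a + (m + 1))).card =
    ∑ p ∈ Finset.HasAntidiagonal.antidiagonal m,
      ∑ q ∈ Finset.HasAntidiagonal.antidiagonal p.2, (ncTrees a (a + p.1)).card *
        ((ncTrees (a + p.1 + 1) (a + p.1 + 1 + q.1)).card *
          (ncTrees (a + p.1 + 1 + q.1) (a + p.1 + 1 + q.1 + q.2)).card) := by
  simp only [← Finset.card_product]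
  simp only [← Finset.card_sigma]
  symm
  refine Finset.card_bij
    (fun x _ => glue a (a + x.1.1 + 1 + x.2.1.1) x.2.2.1 x.2.2.2.1 x.2.2.2.2) ?_ ?_ ?_
  · rintro ⟨⟨p, s⟩, ⟨q, r⟩, A, B, C⟩ h
    simp only [Finset.mem_sigma, Finset.mem_product, Finset.HasAntidiagonal.mem_antidiagonal,
      mem_ncTrees] at h
    obtain ⟨hps, hqr, hA, hB, hC⟩ := h
    rw [mem_ncTrees]
    rw [show a + p + 1 + q + r = a + (m + 1) by omega] at hC
    have := hA.glue hB hC (by omega) (by omega) (by omega)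
    exact this
  · rintro ⟨⟨p, s⟩, ⟨q, r⟩, A, B, C⟩ h ⟨⟨p', s'⟩, ⟨q', r'⟩, A', B', C'⟩ h' heq
    simp only [Finset.mem_sigma, Finset.mem_product, Finset.HasAntidiagonal.mem_antidiagonal,
      mem_ncTrees] at h h' heq
    obtain ⟨hps, hqr, hA, hB, hC⟩ := h
    obtain ⟨hps', hqr', hA', hB', hC'⟩ := h'
    rw [show a + p + 1 + q + r = a + (m + 1) by omega] at hC
    rw [show a + p' + 1 + q' + r' = a + (m + 1) by omega] at hC'
    obtain ⟨h1, h2, rfl, rfl, rfl⟩ := glue_injective hA hB hC (by omega) (by omega)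
      hA' hB' hC' (by omega) (by omega) heq
    obtain rfl : p = p' := by omega
    obtain rfl : q = q' := by omega
    obtain rfl : s = s' := by omega
    obtain rfl : r = r' := by omega
    rfl
  · intro E hE
    obtain ⟨i, j, A, B, C, hai, hij, hjb, hA, hB, hC, rfl⟩ :=
      (mem_ncTrees.1 hE).exists_glue (by omega)
    obtain ⟨p, rfl⟩ := Nat.exists_eq_add_of_le hai
    obtain ⟨q, rfl⟩ := Nat.exists_eq_add_of_le (Nat.succ_le_of_lt hij)
    obtain ⟨r, hr⟩ := Nat.exists_eq_add_of_le hjb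
    refine ⟨⟨⟨p, q + r⟩, ⟨q, r⟩, A, B, C⟩, ?_, rfl⟩
    simp only [Finset.mem_sigma, Finset.mem_product, Finset.HasAntidiagonal.mem_antidiagonal,
      mem_ncTrees]
    rw [hr] at hC
    exact ⟨by omega, trivial, hA, hB, hC⟩

lemma card_ncTrees_add (a m : ℕ) : (ncTrees a (a + m)).card = (ncTrees 0 m).card := by
  induction m using Nat.strong_induction_on generalizing a with
  | _ m ih =>
    cases m with
    | zero => simp [card_ncTrees_self]
    | succ m =>
      have h0 := card_ncTrees_succ 0 m
      rw [Nat.zero_add] at h0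
      rw [card_ncTrees_succ, h0]
      refine Finset.sum_congr rfl fun p hp => Finset.sum_congr rfl fun q hq => ?_
      rw [Finset.HasAntidiagonal.mem_antidiagonal] at hp hq
      have h1 := fun a => ih p.1 (by omega) a
      have h2 := fun a => ih q.1 (by omega) a
      have h3 := fun a => ih q.2 (by omega) a
      simp only [h1, h2, h3]

lemma card_ncTrees (m : ℕ) : (2 * m + 1) * (ncTrees 0 m).card = (3 * m).choose m := by
  refine ternary_recurrence_solution (u := fun m => (ncTrees 0 m).card) (card_ncTrees_self 0)
    (fun m => ?_) m
  have h := card_ncTrees_succ 0 m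
  simpa only [card_ncTrees_add, Nat.zero_add] using h

lemma IsNCTree.card {a b : ℕ} {E : Finset (ℕ × ℕ)} (hE : IsNCTree a b E) (hab : a ≤ b) :
    E.card = b - a := by
  induction h : b - a using Nat.strong_induction_on generalizing a b E with
  | _ m ih =>
    subst h
    rcases hab.eq_or_lt with rfl | hlt
    · simp [hE.eq_empty]
    · obtain ⟨i, j, A, B, C, hai, hij, hjb, hA, hB, hC, rfl⟩ := hE.exists_glue hlt
      have h1 := ih _ (by omega) hA hai rfl
      have h2 := ih _ (by omega) hB hij rfl
      have h3 := ih _ (by omega) hC hjb rfl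
      rw [NCPaper.glue, Finset.card_insert_of_notMem, Finset.card_union_of_disjoint,
        Finset.card_union_of_disjoint, h1, h2, h3]
      · omega
      · rw [Finset.disjoint_left]
        rintro ⟨x, y⟩ hx hy
        have := hB.bounds _ _ hx
        have := hC.bounds _ _ hy
        omega
      · rw [Finset.disjoint_left]
        rintro ⟨x, y⟩ hx hy
        have := hA.bounds _ _ hx
        rcases Finset.mem_union.1 hy with hy | hy
        · have := hB.bounds _ _ hy
          omega
        · have := hC.bounds _ _ hy
          omega
      · simp only [Finset.mem_union]
        rintro (h | h | h)
        · have := hA.bounds _ _ h; omega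
        · have := hB.bounds _ _ h; omega
        · have := hC.bounds _ _ h; omega

/-- The partition of `{0, …, n - 1}` into connected components of the graph with edge set `F`. -/
def edgePartition (n : ℕ) (F : Finset (ℕ × ℕ)) : Setoid (Fin n) :=
  (component F).comap Fin.val

/-- `F` consists of pairs `(x, y)` with `x < y ≤ m`. -/
def IsEdgeSet (m : ℕ) (F : Finset (ℕ × ℕ)) : Prop :=
  ∀ x y, (x, y) ∈ F → x < y ∧ y ≤ m

lemma IsEdgeSet.mono {m : ℕ} {E F : Finset (ℕ × ℕ)} (hE : IsEdgeSet m E) (h : F ⊆ E) :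
    IsEdgeSet m F :=
  fun x y hxy => hE x y (h hxy)

lemma IsNCTree.isEdgeSet {m : ℕ} {E : Finset (ℕ × ℕ)} (hE : IsNCTree 0 m E) : IsEdgeSet m E :=
  fun x y h => (hE.bounds x y h).2

lemma edgePartition_le {m : ℕ} {F : Finset (ℕ × ℕ)} (hF : IsEdgeSet m F)
    {P : Setoid (Fin (m + 1))} :
    edgePartition (m + 1) F ≤ P ↔ ∀ x y : Fin (m + 1), (x.1, y.1) ∈ F → P x y := by
  constructor
  · exact fun h x y hxy => h (component_of_mem hxy)
  · intro h x y hxy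
    have hg : ∀ z : Fin (m + 1), (⟨min z.1 m, by omega⟩ : Fin (m + 1)) = z :=
      fun z => Fin.ext (by simp only; omega)
    have := component_lift P (fun z => ⟨min z m, by omega⟩) (fun u v huv => by
      have hb := hF u v huv
      refine h _ _ ?_
      simp only
      rwa [min_eq_left (by omega), min_eq_left (by omega)]) hxy
    rwa [hg, hg] at this

lemma edgePartition_mono {n : ℕ} {F G : Finset (ℕ × ℕ)} (h : F ⊆ G) :
    edgePartition n F ≤ edgePartition n G :=
  fun _ _ hxy => component_mono h hxy

lemma edgePartition_empty (n : ℕ) : edgePartition n ∅ = ⊥ := by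
  refine le_bot_iff.1 fun x y hxy => ?_
  have := component_lift (⊥ : Setoid ℕ) id (by simp) hxy
  exact Fin.ext this

lemma isEdgeSet_singleton {m x y : ℕ} (hxy : x < y) (hy : y ≤ m) : IsEdgeSet m {(x, y)} := by
  intro u v h
  simp only [Finset.mem_singleton, Prod.mk.injEq] at h
  omega

lemma edgePartition_singleton_le {m : ℕ} {x y : Fin (m + 1)} (hxy : x < y)
    {P : Setoid (Fin (m + 1))} : edgePartition (m + 1) {(x.1, y.1)} ≤ P ↔ P x y := by
  rw [edgePartition_le (isEdgeSet_singleton hxy (by omega))]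
  constructor
  · exact fun h => h x y (by simp)
  · intro h u v huv
    simp only [Finset.mem_singleton, Prod.mk.injEq] at huv
    rwa [Fin.ext huv.1, Fin.ext huv.2]

lemma edgePartition_singleton_ne_bot {m : ℕ} {x y : Fin (m + 1)} (hxy : x < y) :
    edgePartition (m + 1) {(x.1, y.1)} ≠ ⊥ := by
  intro h
  have : (⊥ : Setoid (Fin (m + 1))) x y := (edgePartition_singleton_le hxy).1 h.le
  exact hxy.ne this

lemma eq_of_edgePartition_singleton_le {m x y u v : ℕ} (hxy : x < y) (hy : y ≤ m) (huv : u < v)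
    (h : edgePartition (m + 1) {(x, y)} ≤ edgePartition (m + 1) {(u, v)}) :
    (x, y) = (u, v) := by
  have hc : component {(u, v)} x y :=
    h (x := ⟨x, by omega⟩) (y := ⟨y, by omega⟩) (component_of_mem (by simp))
  have : (if x = v then u else x) = if y = v then u else y :=
    component_lift (⊥ : Setoid ℕ) (fun z => if z = v then u else z) (fun s t hst => by
      simp only [Finset.mem_singleton, Prod.mk.injEq] at hst
      change (if s = v then u else s) = if t = v then u else t
      split_ifs <;> omega) hc
  rw [Prod.mk.injEq]
  split_ifs at this <;> omega

/-- The partition of a noncrossing graph, as an element of `NCP`. -/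
def ncEdgePartition {m : ℕ} {F : Finset (ℕ × ℕ)} (hF : IsEdgeSet m F)
    (hnc : NoncrossingEdges F) : NCP (m + 1) :=
  ⟨edgePartition (m + 1) F, fun _ _ _ _ hab hbc hcd hac hbd =>
    hnc.component_noncrossing (fun e he => (hF e.1 e.2 he).1) hab hbc hcd hac hbd⟩

lemma noncrossingEdges_singleton (x y : ℕ) : NoncrossingEdges {(x, y)} := by
  intro e he f hf
  rw [Finset.mem_singleton] at he hf
  subst he hf
  omega

lemma edgePartition_union_le {m : ℕ} {F G : Finset (ℕ × ℕ)} (hF : IsEdgeSet m F)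
    (hG : IsEdgeSet m G) {P : Setoid (Fin (m + 1))} (h : edgePartition (m + 1) F ≤ P)
    (h' : edgePartition (m + 1) G ≤ P) : edgePartition (m + 1) (F ∪ G) ≤ P := by
  rw [edgePartition_le] at *
  · intro x y hxy
    exact (Finset.mem_union.1 hxy).elim (h x y) (h' x y)
  · exact hF
  · exact hG
  · exact fun x y hxy => (Finset.mem_union.1 hxy).elim (hF x y) (hG x y)

lemma IsNCTree.component_sdiff {a b : ℕ} {E : Finset (ℕ × ℕ)} (hE : IsNCTree a b E) {x y : ℕ}
    (hx : a ≤ x) (hx' : x ≤ b) (hy : a ≤ y) (hy' : y ≤ b) (D : Finset (ℕ × ℕ)) (hD : D ⊆ E)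
    (h : ∀ e ∈ D, component (E.erase e) e.1 x ↔ component (E.erase e) e.1 y) :
    component (E \ D) x y := by
  induction D using Finset.induction_on with
  | empty => rw [Finset.sdiff_empty]; exact hE.conn x y hx hx' hy hy'
  | insert e D heD ih =>
    have heE : e ∈ E := hD (Finset.mem_insert_self _ _)
    have hstep := ih ((Finset.subset_insert _ _).trans hD)
      (fun f hf => h f (Finset.mem_insert_of_mem hf))
    have heq : E \ D = insert (e.1, e.2) (E \ insert e D) := by
      ext f
      simp only [Finset.mem_sdiff, Finset.mem_insert]
      by_cases hf : f = e
      · subst hf; simp [heE, heD]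
      · simp [hf]
    have hsub : E \ insert e D ⊆ E.erase e := fun f hf => by
      simp only [Finset.mem_sdiff, Finset.mem_insert, Finset.mem_erase] at hf ⊢
      tauto
    have hbr : ¬ component (E.erase e) e.1 e.2 := hE.bridge e.1 e.2 heE
    have he := h e (Finset.mem_insert_self _ _)
    rw [heq] at hstep
    rcases component_insert hstep with k | ⟨k, k'⟩ | ⟨k, k'⟩
    · exact k
    · have k1 := he.1 (Setoid.symm' _ (component_mono hsub k))
      exact absurd (Setoid.trans' _ k1 (Setoid.symm' _ (component_mono hsub k'))) hbr
    · have k1 := he.2 (component_mono hsub k')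
      exact absurd (Setoid.trans' _ k1 (component_mono hsub k)) hbr

/-- In a tree, two vertices are connected by the edges in `F` iff no edge outside `F` separates
them. -/
lemma IsNCTree.component_iff {a b : ℕ} {E : Finset (ℕ × ℕ)} (hE : IsNCTree a b E) {x y : ℕ}
    (hx : a ≤ x) (hx' : x ≤ b) (hy : a ≤ y) (hy' : y ≤ b) {F : Finset (ℕ × ℕ)} (hF : F ⊆ E) :
    component F x y ↔
      ∀ e ∈ E \ F, (component (E.erase e) e.1 x ↔ component (E.erase e) e.1 y) := by
  constructor
  · intro h e he
    rw [Finset.mem_sdiff] at he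
    refine component_cut _ (fun u v huv => ?_) h
    have hm : component (E.erase e) u v :=
      component_of_mem (Finset.mem_erase.2 ⟨fun h => he.2 (h ▸ huv), hF huv⟩)
    exact ⟨fun k => Setoid.trans' _ k hm, fun k => Setoid.trans' _ k (Setoid.symm' _ hm)⟩
  · intro h
    have := hE.component_sdiff hx hx' hy hy' (E \ F) Finset.sdiff_subset h
    rwa [Finset.sdiff_sdiff_eq_self hF] at this

lemma IsNCTree.edgePartition_inter {m : ℕ} {E F G : Finset (ℕ × ℕ)} (hE : IsNCTree 0 m E)
    (hF : F ⊆ E) (hG : G ⊆ E) {P : Setoid (Fin (m + 1))} (hPF : P ≤ edgePartition (m + 1) F)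
    (hPG : P ≤ edgePartition (m + 1) G) : P ≤ edgePartition (m + 1) (F ∩ G) := by
  intro x y hxy
  have h1 : component F x y := hPF hxy
  have h2 : component G x y := hPG hxy
  change component (F ∩ G) x y
  rw [hE.component_iff (by omega) (by omega) (by omega) (by omega)] at h1 h2 ⊢
  · intro e he
    simp only [Finset.mem_sdiff, Finset.mem_inter] at he h1 h2
    by_cases heF : e ∈ F
    · exact h2 e ⟨he.1, fun h => he.2 ⟨heF, h⟩⟩
    · exact h1 e ⟨he.1, heF⟩
  · exact Finset.inter_subset_left.trans hF
  · exact hG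
  · exact hF

lemma IsNCTree.edgePartition_le_iff {m : ℕ} {E F G : Finset (ℕ × ℕ)} (hE : IsNCTree 0 m E)
    (hF : F ⊆ E) (hG : G ⊆ E) :
    edgePartition (m + 1) F ≤ edgePartition (m + 1) G ↔ F ⊆ G := by
  refine ⟨?_, edgePartition_mono⟩
  rintro h ⟨x, y⟩ he
  by_contra hn
  have hb := hE.bounds x y (hF he)
  have hc : component G x y :=
    h (x := ⟨x, by omega⟩) (y := ⟨y, by omega⟩) (component_of_mem he)
  refine hE.bridge x y (hF he) (component_mono (fun f hf => ?_) hc)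
  exact Finset.mem_erase.2 ⟨fun k => hn (k ▸ hf), hG hf⟩

/-- The sublattice of `NCP (m + 1)` spanned by the edges of a noncrossing tree. -/
def treeSublattice (m : ℕ) (E : Finset (ℕ × ℕ)) : Set (NCP (m + 1)) :=
  {P | ∃ F ⊆ E, P.1 = edgePartition (m + 1) F}

lemma IsNCTree.latClosed {m : ℕ} {E : Finset (ℕ × ℕ)} (hE : IsNCTree 0 m E) :
    LatClosed (treeSublattice m E) := by
  constructor
  · rintro x ⟨F, hF, hxF⟩ y ⟨G, hG, hyG⟩ z hz
    have hU : F ∪ G ⊆ E := Finset.union_subset hF hG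
    refine ⟨F ∪ G, hU, le_antisymm ?_ ?_⟩
    · refine hz.2 (?_ : ncEdgePartition (hE.isEdgeSet.mono hU) (hE.noncrossing.mono hU) ∈
        upperBounds {x, y})
      rintro w (rfl | rfl)
      · exact hxF.le.trans (edgePartition_mono Finset.subset_union_left)
      · exact hyG.le.trans (edgePartition_mono Finset.subset_union_right)
    · exact edgePartition_union_le (hE.isEdgeSet.mono hF) (hE.isEdgeSet.mono hG)
        (hxF.ge.trans (hz.1 (Set.mem_insert _ _)))
        (hyG.ge.trans (hz.1 (Set.mem_insert_of_mem _ rfl)))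
  · rintro x ⟨F, hF, hxF⟩ y ⟨G, hG, hyG⟩ z hz
    have hI : F ∩ G ⊆ E := Finset.inter_subset_left.trans hF
    refine ⟨F ∩ G, hI, le_antisymm ?_ ?_⟩
    · have h1 : z ≤ x := hz.1 (Set.mem_insert _ _)
      have h2 : z ≤ y := hz.1 (Set.mem_insert_of_mem _ rfl)
      exact hE.edgePartition_inter hF hG (le_trans h1 hxF.le) (le_trans h2 hyG.le)
    · refine hz.2 (?_ : ncEdgePartition (hE.isEdgeSet.mono hI) (hE.noncrossing.mono hI) ∈
        lowerBounds {x, y})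
      rintro w (rfl | rfl)
      · exact (edgePartition_mono Finset.inter_subset_left).trans hxF.ge
      · exact (edgePartition_mono Finset.inter_subset_right).trans hyG.ge

lemma IsNCTree.nonempty_orderIso {m : ℕ} {E : Finset (ℕ × ℕ)} (hE : IsNCTree 0 m E) :
    Nonempty (↥(treeSublattice m E) ≃o Set (Fin m)) := by
  classical
  let g : Fin m ≃ E := (Finset.equivFinOfCardEq (hE.card (Nat.zero_le _))).symm
  let F : Set (Fin m) → Finset (ℕ × ℕ) := fun S => E.filter (fun e => ∃ i ∈ S, (g i).1 = e)
  have hF : ∀ S, F S ⊆ E := fun S => Finset.filter_subset _ _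
  have hFle : ∀ S T, F S ⊆ F T ↔ S ≤ T := by
    intro S T
    constructor
    · intro h i hi
      have := h (Finset.mem_filter.2 ⟨(g i).2, i, hi, rfl⟩)
      obtain ⟨_, j, hj, hji⟩ := Finset.mem_filter.1 this
      rwa [← g.injective (Subtype.ext hji)]
    · intro h e he
      obtain ⟨heE, i, hi, hie⟩ := Finset.mem_filter.1 he
      exact Finset.mem_filter.2 ⟨heE, i, h hi, hie⟩
  let f : Set (Fin m) ↪o NCP (m + 1) := OrderEmbedding.ofMapLEIff
    (fun S => ncEdgePartition (hE.isEdgeSet.mono (hF S)) (hE.noncrossing.mono (hF S)))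
    (fun S T => (hE.edgePartition_le_iff (hF S) (hF T)).trans (hFle S T))
  have hrange : treeSublattice m E = Set.range f := by
    ext P
    constructor
    · rintro ⟨G, hG, hP⟩
      refine ⟨{i | (g i).1 ∈ G}, Subtype.ext ?_⟩
      have : F {i | (g i).1 ∈ G} = G := by
        ext e
        simp only [F, Finset.mem_filter, Set.mem_ofPred_eq]
        constructor
        · rintro ⟨_, i, hi, rfl⟩
          exact hi
        · intro he
          exact ⟨hG he, g.symm ⟨e, hG he⟩, by simpa using he, by simp⟩
      exact (congrArg (edgePartition (m + 1)) this).trans hP.symm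
    · rintro ⟨S, rfl⟩
      exact ⟨F S, hF S, rfl⟩
  rw [hrange]
  exact ⟨f.orderIso.symm⟩

open Classical in
/-- The edges of the tree associated with a sublattice `L`. -/
noncomputable def sublatticeEdges (m : ℕ) (L : Set (NCP (m + 1))) : Finset (ℕ × ℕ) :=
  (Finset.range (m + 1) ×ˢ Finset.range (m + 1)).filter
    (fun e => e.1 < e.2 ∧ ∃ P ∈ L, P.1 = edgePartition (m + 1) {e})

lemma mem_sublatticeEdges {m : ℕ} {L : Set (NCP (m + 1))} {x y : ℕ} :
    (x, y) ∈ sublatticeEdges m L ↔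
      x < y ∧ y ≤ m ∧ ∃ P ∈ L, P.1 = edgePartition (m + 1) {(x, y)} := by
  simp only [sublatticeEdges, Finset.mem_filter, Finset.mem_product, Finset.mem_range]
  constructor
  · rintro ⟨h1, h2, h3⟩
    exact ⟨h2, by omega, h3⟩
  · rintro ⟨h1, h2, h3⟩
    exact ⟨by omega, h1, h3⟩

lemma isEdgeSet_sublatticeEdges (m : ℕ) (L : Set (NCP (m + 1))) :
    IsEdgeSet m (sublatticeEdges m L) := by
  intro x y h
  have := mem_sublatticeEdges.1 h
  exact ⟨this.1, this.2.1⟩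

lemma IsNCTree.sublatticeEdges_treeSublattice {m : ℕ} {E : Finset (ℕ × ℕ)}
    (hE : IsNCTree 0 m E) : sublatticeEdges m (treeSublattice m E) = E := by
  ext ⟨x, y⟩
  rw [mem_sublatticeEdges]
  constructor
  · rintro ⟨hxy, hy, P, ⟨F, hF, hPF⟩, hP⟩
    rcases F.eq_empty_or_nonempty with rfl | ⟨⟨u, v⟩, hf⟩
    · rw [edgePartition_empty, hP] at hPF
      exact absurd hPF (edgePartition_singleton_ne_bot (x := ⟨x, by omega⟩) (y := ⟨y, by omega⟩)
        hxy)
    · have hb := hE.bounds u v (hF hf)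
      have : edgePartition (m + 1) {(u, v)} ≤ edgePartition (m + 1) {(x, y)} := by
        rw [← hP, hPF]
        exact edgePartition_mono (Finset.singleton_subset_iff.2 hf)
      rw [← eq_of_edgePartition_singleton_le hb.2.1 hb.2.2 hxy this]
      exact hF hf
  · intro h
    have hb := hE.bounds x y h
    exact ⟨hb.2.1, hb.2.2, ncEdgePartition (isEdgeSet_singleton hb.2.1 hb.2.2)
      (noncrossingEdges_singleton x y), ⟨_, Finset.singleton_subset_iff.2 h, rfl⟩, rfl⟩

lemma card_quotient_lt {α : Type*} [Finite α] {P Q : Setoid α} (h : P < Q) :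
    Nat.card (Quotient Q) < Nat.card (Quotient P) := by
  have hsurj : Function.Surjective (Quotient.map (sa := P) (sb := Q) id h.le) := by
    rintro ⟨x⟩
    exact ⟨Quotient.mk P x, rfl⟩
  refine lt_of_le_of_ne (Nat.card_le_card_of_surjective _ hsurj) fun heq => h.not_ge ?_
  have hbij := (Nat.bijective_iff_surjective_and_card _).2 ⟨hsurj, heq.symm⟩
  intro x y hxy
  exact Quotient.exact (s := P) (hbij.1 (a₁ := Quotient.mk P x) (a₂ := Quotient.mk P y)
    (Quotient.sound (s := Q) hxy))

lemma card_quotient_add_three_le {n : ℕ} {P : Setoid (Fin n)} {a b c d : Fin n} (hab : a < b)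
    (hbc : b < c) (hcd : c < d) (h1 : P a b) (h2 : P a c) (h3 : P a d) :
    Nat.card (Quotient P) + 3 ≤ n := by
  classical
  have hcard : ({b, c, d} : Finset (Fin n)).card = 3 :=
    Finset.card_eq_three.2 ⟨b, c, d, hbc.ne, (hbc.trans hcd).ne, hcd.ne, rfl⟩
  have hle : Nat.card (Quotient P) ≤ (Finset.univ \ {b, c, d} : Finset (Fin n)).card := by
    rw [Nat.card_eq_fintype_card, ← Finset.card_univ]
    refine (Finset.card_le_card (fun q _ => ?_)).trans
      (Finset.card_image_le (f := Quotient.mk P) (s := Finset.univ \ {b, c, d}))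
    induction q using Quotient.inductionOn with
    | h x =>
      rw [Finset.mem_image]
      by_cases hx : x ∈ ({b, c, d} : Finset (Fin n))
      · refine ⟨a, ?_, Quotient.sound ?_⟩
        · simp [hab.ne, (hab.trans hbc).ne, (hab.trans (hbc.trans hcd)).ne]
        · simp only [Finset.mem_insert, Finset.mem_singleton] at hx
          rcases hx with rfl | rfl | rfl
          exacts [h1, h2, h3]
      · exact ⟨x, by simpa using hx, rfl⟩
  have hsub := Finset.card_le_univ ({b, c, d} : Finset (Fin n))
  rw [Finset.card_sdiff_of_subset (Finset.subset_univ _), hcard, Finset.card_univ,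
    Fintype.card_fin] at hle
  rw [hcard, Fintype.card_fin] at hsub
  omega

section BooleanSublattice

variable {m : ℕ} (f : Set (Fin m) ↪o NCP (m + 1))

lemma card_quotient_strictAnti {S T : Set (Fin m)} (h : S ⊂ T) :
    Nat.card (Quotient (f T).1) < Nat.card (Quotient (f S).1) :=
  card_quotient_lt (show (f S).1 < (f T).1 from f.strictMono h)

lemma le_card_quotient (s : Finset (Fin m)) :
    m + 1 ≤ Nat.card (Quotient (f s).1) + s.card := by
  have key : ∀ t : Finset (Fin m),
      t.card + 1 ≤ Nat.card (Quotient (f ((tᶜ : Finset _) : Set _)).1) := by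
    intro t
    induction t using Finset.induction_on with
    | empty =>
      have : Nonempty (Quotient (f (((∅ : Finset (Fin m))ᶜ : Finset _) : Set _)).1) :=
        ⟨Quotient.mk _ 0⟩
      rw [Finset.card_empty]
      exact Nat.card_pos
    | insert a t ha ih =>
      rw [Finset.card_insert_of_notMem ha]
      refine Nat.succ_le_of_lt (ih.trans_lt (card_quotient_strictAnti f ?_))
      rw [Finset.coe_ssubset, Finset.ssubset_iff]
      exact ⟨a, by simp, by
        intro x hx
        rw [Finset.mem_insert] at hx
        rcases hx with rfl | hx
        · simpa using ha
        · simp only [Finset.mem_compl, Finset.mem_insert, not_or] at hx ⊢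
          exact hx.2⟩
  have h := key sᶜ
  rw [compl_compl, Finset.card_compl, Fintype.card_fin] at h
  have := Finset.card_le_univ s
  rw [Fintype.card_fin] at this
  omega

lemma card_quotient_le (s : Finset (Fin m)) :
    Nat.card (Quotient (f s).1) + s.card ≤ m + 1 := by
  induction s using Finset.induction_on with
  | empty =>
    have := Nat.card_le_card_of_surjective (Quotient.mk (f ((∅ : Finset (Fin m)) : Set _)).1)
      Quotient.mk_surjective
    rwa [Nat.card_eq_fintype_card (α := Fin (m + 1)), Fintype.card_fin] at this
  | insert a s ha ih =>
    rw [Finset.card_insert_of_notMem ha]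
    have := card_quotient_strictAnti f (S := s) (T := (insert a s : Finset _)) (by
      rw [Finset.coe_ssubset]
      exact Finset.ssubset_insert ha)
    omega

lemma boolean_empty : (f ∅).1 = ⊥ := by
  by_contra h
  have h1 := card_quotient_lt (bot_lt_iff_ne_bot.2 h)
  have h2 := le_card_quotient f ∅
  have h3 := Nat.card_le_card_of_surjective (Quotient.mk (⊥ : Setoid (Fin (m + 1))))
    Quotient.mk_surjective
  rw [Nat.card_eq_fintype_card (α := Fin (m + 1)), Fintype.card_fin] at h3
  rw [Finset.coe_empty, Finset.card_empty] at h2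
  omega

lemma boolean_univ (x y : Fin (m + 1)) : (f Set.univ).1 x y := by
  have h := card_quotient_le f Finset.univ
  rw [Finset.coe_univ, Finset.card_univ, Fintype.card_fin] at h
  have : Subsingleton (Quotient (f Set.univ).1) :=
    Finite.card_le_one_iff_subsingleton.1 (by omega)
  exact Quotient.exact (s := (f Set.univ).1) (Subsingleton.elim _ _)

lemma boolean_singleton (i : Fin m) :
    ∃ x y : Fin (m + 1), x < y ∧ (f {i}).1 = edgePartition (m + 1) {(x.1, y.1)} := by
  have hlt : (f ∅).1 < (f {i}).1 :=
    f.strictMono ((Set.empty_ssubset).2 (Set.singleton_nonempty i))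
  rw [boolean_empty] at hlt
  obtain ⟨x, y, hxy, hP⟩ : ∃ x y : Fin (m + 1), x < y ∧ (f {i}).1 x y := by
    by_contra! hcon
    refine hlt.not_ge fun x y hxy => ?_
    rcases lt_trichotomy x y with h | h | h
    · exact absurd hxy (hcon x y h)
    · exact h
    · exact absurd (Setoid.symm' _ hxy) (hcon y x h)
  refine ⟨x, y, hxy, ?_⟩
  by_contra hne
  have h1 := card_quotient_lt
    (lt_of_le_of_ne ((edgePartition_singleton_le hxy).2 hP) (Ne.symm hne))
  have h2 := card_quotient_lt (bot_lt_iff_ne_bot.2 (edgePartition_singleton_ne_bot hxy))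
  have h3 := Nat.card_le_card_of_surjective (Quotient.mk (⊥ : Setoid (Fin (m + 1))))
    Quotient.mk_surjective
  rw [Nat.card_eq_fintype_card (α := Fin (m + 1)), Fintype.card_fin] at h3
  have h4 := le_card_quotient f {i}
  rw [Finset.coe_singleton, Finset.card_singleton] at h4
  omega

lemma boolean_mem_edges (i : Fin m) :
    ∃ x y, (x, y) ∈ sublatticeEdges m (Set.range f) ∧
      (f {i}).1 = edgePartition (m + 1) {(x, y)} := by
  obtain ⟨x, y, hxy, h⟩ := boolean_singleton f i
  exact ⟨x, y, mem_sublatticeEdges.2 ⟨hxy, by omega, f {i}, ⟨_, rfl⟩, h⟩, h⟩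

lemma boolean_edge_index {x y : ℕ} (h : (x, y) ∈ sublatticeEdges m (Set.range f)) :
    ∃ i, (f {i}).1 = edgePartition (m + 1) {(x, y)} := by
  obtain ⟨hxy, hy, _, ⟨S, rfl⟩, hS⟩ := mem_sublatticeEdges.1 h
  rcases S.eq_empty_or_nonempty with rfl | ⟨i, hi⟩
  · rw [boolean_empty] at hS
    exact absurd hS.symm (edgePartition_singleton_ne_bot (x := ⟨x, by omega⟩)
      (y := ⟨y, by omega⟩) hxy)
  · refine ⟨i, ?_⟩
    obtain ⟨u, v, huv, h'⟩ := boolean_singleton f i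
    have hle : (f {i}).1 ≤ (f S).1 := f.monotone (Set.singleton_subset_iff.2 hi)
    rw [h', hS] at hle
    rw [h', eq_of_edgePartition_singleton_le huv (by omega) hxy hle]

lemma noncrossingEdges_boolean : NoncrossingEdges (sublatticeEdges m (Set.range f)) := by
  rintro ⟨a, c⟩ he ⟨b, d⟩ hf ⟨hab, hbc, hcd⟩
  simp only at hab hbc hcd
  obtain ⟨i, hi⟩ := boolean_edge_index f he
  obtain ⟨j, hj⟩ := boolean_edge_index f hf
  have hd := (mem_sublatticeEdges.1 hf).2.1
  have hle : ∀ k ∈ ({i, j} : Finset (Fin m)), (f {k}).1 ≤ (f ({i, j} : Finset (Fin m))).1 :=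
    fun k hk => f.monotone (Set.singleton_subset_iff.2 (Finset.mem_coe.2 hk))
  let a' : Fin (m + 1) := ⟨a, by omega⟩
  let b' : Fin (m + 1) := ⟨b, by omega⟩
  let c' : Fin (m + 1) := ⟨c, by omega⟩
  let d' : Fin (m + 1) := ⟨d, by omega⟩
  have hac : (f ({i, j} : Finset (Fin m))).1 a' c' :=
    (edgePartition_singleton_le (show a' < c' from hab.trans hbc)).1 (hi ▸ hle i (by simp))
  have hbd : (f ({i, j} : Finset (Fin m))).1 b' d' :=
    (edgePartition_singleton_le (show b' < d' from hbc.trans hcd)).1 (hj ▸ hle j (by simp))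
  have hab' : (f ({i, j} : Finset (Fin m))).1 a' b' :=
    (f ({i, j} : Finset (Fin m))).2 a' b' c' d' hab hbc hcd hac hbd
  have h1 := card_quotient_add_three_le (P := (f ({i, j} : Finset (Fin m))).1)
    (show a' < b' from hab) (show b' < c' from hbc) (show c' < d' from hcd) hab' hac
    (Setoid.trans' _ hab' hbd)
  have h2 := le_card_quotient f {i, j}
  have h3 : ({i, j} : Finset (Fin m)).card ≤ 2 := Finset.card_le_two
  omega

variable {f}

lemma ncEdgePartition_mem_range (hf : LatClosed (Set.range f)) {F : Finset (ℕ × ℕ)}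
    (hF : F ⊆ sublatticeEdges m (Set.range f)) :
    ∃ S, (f S).1 = edgePartition (m + 1) F := by
  induction F using Finset.induction_on with
  | empty => exact ⟨∅, by rw [boolean_empty, edgePartition_empty]⟩
  | insert e F _ ih =>
    obtain ⟨S, hS⟩ := ih ((Finset.subset_insert _ _).trans hF)
    obtain ⟨i, hi⟩ := boolean_edge_index f (hF (Finset.mem_insert_self e F))
    have hE := isEdgeSet_sublatticeEdges m (Set.range f)
    obtain ⟨T, hT⟩ := hf.1 (f {i}) ⟨_, rfl⟩ (f S) ⟨_, rfl⟩
      (ncEdgePartition (hE.mono hF) ((noncrossingEdges_boolean f).mono hF)) (by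
        constructor
        · rintro w (rfl | rfl)
          · exact hi.le.trans (edgePartition_mono (by simp))
          · exact hS.le.trans (edgePartition_mono (Finset.subset_insert _ _))
        · intro w hw
          have h1 : f {i} ≤ w := hw (Set.mem_insert _ _)
          have h2 : f S ≤ w := hw (Set.mem_insert_of_mem _ rfl)
          change edgePartition (m + 1) (insert e F) ≤ w.1
          rw [Finset.insert_eq]
          exact edgePartition_union_le
            (hE.mono (Finset.singleton_subset_iff.2 (hF (Finset.mem_insert_self e F))))
            (hE.mono ((Finset.subset_insert _ _).trans hF))
            (hi.ge.trans h1) (hS.ge.trans h2))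
    exact ⟨T, congrArg Subtype.val hT⟩

lemma treeSublattice_boolean (hf : LatClosed (Set.range f)) :
    treeSublattice m (sublatticeEdges m (Set.range f)) = Set.range f := by
  classical
  ext P
  constructor
  · rintro ⟨F, hF, hP⟩
    obtain ⟨S, hS⟩ := ncEdgePartition_mem_range hf hF
    exact ⟨S, Subtype.ext (hS.trans hP.symm)⟩
  · rintro ⟨S, rfl⟩
    set F := (sublatticeEdges m (Set.range f)).filter
      (fun e => edgePartition (m + 1) {e} ≤ (f S).1) with hFdef
    have hF : F ⊆ sublatticeEdges m (Set.range f) := Finset.filter_subset _ _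
    have hEF : IsEdgeSet m F := (isEdgeSet_sublatticeEdges m _).mono hF
    obtain ⟨T, hT⟩ := ncEdgePartition_mem_range hf hF
    refine ⟨F, hF, ?_⟩
    rw [← hT]
    refine congrArg (fun S => (f S).1) (Set.Subset.antisymm (fun i hi => ?_) ?_)
    · obtain ⟨x, y, hxy, h⟩ := boolean_mem_edges f i
      have h1 : (f {i}).1 ≤ (f S).1 := f.monotone (Set.singleton_subset_iff.2 hi)
      have h2 : (f {i}).1 ≤ (f T).1 := by
        rw [hT, h]
        refine edgePartition_mono (Finset.singleton_subset_iff.2 ?_)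
        exact Finset.mem_filter.2 ⟨hxy, h ▸ h1⟩
      exact Set.singleton_subset_iff.1 (f.le_iff_le.1 h2)
    · refine f.le_iff_le.1 (show (f T).1 ≤ (f S).1 from ?_)
      rw [hT, edgePartition_le hEF]
      exact fun x y hxy => (Finset.mem_filter.1 hxy).2 (component_of_mem (by simp))

lemma isNCTree_boolean (hf : LatClosed (Set.range f)) :
    IsNCTree 0 m (sublatticeEdges m (Set.range f)) where
  bounds x y h := ⟨Nat.zero_le _, isEdgeSet_sublatticeEdges m _ x y h⟩
  noncrossing := noncrossingEdges_boolean f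
  conn x y _ hx _ hy := by
    obtain ⟨S, hS⟩ := ncEdgePartition_mem_range hf (Finset.Subset.refl _)
    have huniv : S = Set.univ := by
      refine Set.eq_univ_of_forall fun i => ?_
      obtain ⟨x, y, hxy, h⟩ := boolean_mem_edges f i
      have : (f {i}).1 ≤ (f S).1 := by
        rw [h, hS]
        exact edgePartition_mono (Finset.singleton_subset_iff.2 hxy)
      exact Set.singleton_subset_iff.1 (f.le_iff_le.1 this)
    have h := boolean_univ f ⟨x, by omega⟩ ⟨y, by omega⟩
    rw [← huniv, hS] at h
    exact h
  bridge x y h hc := by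
    obtain ⟨i, hi⟩ := boolean_edge_index f h
    have hE := isEdgeSet_sublatticeEdges m (Set.range f)
    have hb := hE x y h
    have hle : edgePartition (m + 1) ((sublatticeEdges m (Set.range f)).erase (x, y)) ≤
        (f {i}ᶜ).1 := by
      rw [edgePartition_le (hE.mono (Finset.erase_subset _ _))]
      intro u v huv
      obtain ⟨hne, huv⟩ := Finset.mem_erase.1 huv
      obtain ⟨j, hj⟩ := boolean_edge_index f huv
      have hji : j ∈ ({i}ᶜ : Set (Fin m)) := by
        rintro rfl
        have hb' := hE _ _ huv
        exact hne (eq_of_edgePartition_singleton_le hb'.1 hb'.2 hb.1 (hj.symm.trans hi).le)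
      have h' : (f {j}).1 ≤ (f {i}ᶜ).1 := f.monotone (Set.singleton_subset_iff.2 hji)
      rw [hj] at h'
      exact h' (component_of_mem (by simp))
    have hxy : (f {i}ᶜ).1 ⟨x, by omega⟩ ⟨y, by omega⟩ :=
      hle (x := ⟨x, by omega⟩) (y := ⟨y, by omega⟩) hc
    have h1 := (edgePartition_singleton_le (x := ⟨x, by omega⟩) (y := ⟨y, by omega⟩)
      (Fin.mk_lt_mk.2 hb.1)).2 hxy
    rw [← hi] at h1
    exact Set.singleton_subset_iff.1 (f.le_iff_le.1 h1) rfl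

end BooleanSublattice

lemma exists_orderEmbedding_range {m : ℕ} {L : Set (NCP (m + 1))}
    (h : Nonempty (↥L ≃o Set (Fin m))) : ∃ f : Set (Fin m) ↪o NCP (m + 1), Set.range f = L := by
  obtain ⟨φ⟩ := h
  refine ⟨φ.symm.toOrderEmbedding.trans (OrderEmbedding.subtype (· ∈ L)), ?_⟩
  ext P
  constructor
  · rintro ⟨S, rfl⟩
    exact (φ.symm S).2
  · intro hP
    exact ⟨φ ⟨P, hP⟩, by simp⟩

lemma card_boolean_sublattices (m : ℕ) :
    Nat.card {L : Set (NCP (m + 1)) // LatClosed L ∧ Nonempty (↥L ≃o Set (Fin m))} =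
      (ncTrees 0 m).card := by
  have hL : ∀ {L : Set (NCP (m + 1))}, LatClosed L ∧ Nonempty (↥L ≃o Set (Fin m)) →
      IsNCTree 0 m (sublatticeEdges m L) ∧ treeSublattice m (sublatticeEdges m L) = L := by
    rintro L ⟨hL, hiso⟩
    obtain ⟨f, rfl⟩ := exists_orderEmbedding_range hiso
    exact ⟨isNCTree_boolean hL, treeSublattice_boolean hL⟩
  let e : {L : Set (NCP (m + 1)) // LatClosed L ∧ Nonempty (↥L ≃o Set (Fin m))} ≃ ncTrees 0 m :=
    { toFun := fun L => ⟨sublatticeEdges m L.1, mem_ncTrees.2 (hL L.2).1⟩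
      invFun := fun E => ⟨treeSublattice m E.1, (mem_ncTrees.1 E.2).latClosed,
        (mem_ncTrees.1 E.2).nonempty_orderIso⟩
      left_inv := fun L => Subtype.ext (hL L.2).2
      right_inv := fun E => Subtype.ext (mem_ncTrees.1 E.2).sublatticeEdges_treeSublattice }
  rw [Nat.card_congr e, Nat.card_eq_fintype_card, Fintype.card_coe]

/-- the number `N` of sublattices of `NCP n` order-isomorphic to the
Boolean lattice of all subsets of an `(n-1)`-element set satisfies
`(2n-1) · N = (3n-3).choose (n-1)`, i.e. `N` is the generalized Catalan number. -/
theorem count_maximal_boolean_sublattices (n : ℕ) (hn : 2 ≤ n) :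
    (2 * n - 1) *
      Nat.card {L : Set (NCP n) // LatClosed L ∧ Nonempty (↥L ≃o Set (Fin (n-1)))} =
      Nat.choose (3 * n - 3) (n - 1) := by
  obtain ⟨m, rfl⟩ : ∃ m, n = m + 1 := ⟨n - 1, by omega⟩
  have h := card_ncTrees m
  rw [← card_boolean_sublattices m] at h
  rw [show 2 * (m + 1) - 1 = 2 * m + 1 by omega, show 3 * (m + 1) - 3 = 3 * m by omega]
  exact h

end NCPaper
end
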